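/- Let ⟨S | R⟩ be a classical C'(1/6) presentation with group G. If a geodesic α in Cay(G,S) is (ρ1,ρ2)-contracting with ρ2 bounded, then α is strongly contracting. -/

import Mathlib

/- Common definitions: words, classical C'(1/6) presentations, word metrics,
   contraction, Morse property, etc. -/

namespace GSC

open Filter

/-- A word over the alphabet `S`: a list of letters with an exponent `±1`
(`true` = the letter, `false` = its formal inverse). -/
abbrev Word (S : Type) := List (S × Bool)

/-- The formal inverse of a word. -/
def wordInv {S : Type} (w : Word S) : Word S := (w.map fun l => (l.1, !l.2)).reverse

/-- A word is (freely) reduced if no letter is followed by its formal inverse. -/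
def Reduced {S : Type} (w : Word S) : Prop :=
  List.Chain' (fun a b => a.1 ≠ b.1 ∨ a.2 = b.2) w

/-- A word is cyclically reduced if its square is reduced. -/
def CyclicallyReduced {S : Type} (w : Word S) : Prop := Reduced (w ++ w)

/-- A piece with respect to a set of relators `R`: a word occurring as a prefix of
two distinct elements of `R`. -/
def IsPiece {S : Type} (R : Set (Word S)) (p : Word S) : Prop :=
  ∃ r₁ ∈ R, ∃ r₂ ∈ R, r₁ ≠ r₂ ∧ p <+: r₁ ∧ p <+: r₂

/-- Closure of a set of words under inversion and cyclic permutation. -/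
def symmClosure {S : Type} (R : Set (Word S)) : Set (Word S) :=
  {w | ∃ r ∈ R, ∃ n : ℕ, w = r.rotate n ∨ w = wordInv (r.rotate n)}

/-- A classical `C'(1/den)` collection of cyclically reduced words: after closing under
inversion and cyclic permutation, every piece `p` contained in a relator `r` satisfies
`den * |p| < |r|`. -/
def CprimeCollection {S : Type} (den : ℕ) (R : Set (Word S)) : Prop :=
  (∀ r ∈ R, CyclicallyReduced r) ∧
  ∀ r ∈ symmClosure R, ∀ p : Word S, p <+: r → IsPiece (symmClosure R) p →
    den * p.length < r.length

/-- A classical `C'(1/6)` presentation: a set of cyclically reduced relators, closed under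
inversion and cyclic permutation, in which every piece contained in a relator `r` has
length `< |r|/6`. -/
structure C6Presentation (S : Type) where
  rels : Set (Word S)
  cyclically_reduced : ∀ r ∈ rels, CyclicallyReduced r
  inv_mem : ∀ r ∈ rels, wordInv r ∈ rels
  rotate_mem : ∀ r ∈ rels, ∀ n : ℕ, r.rotate n ∈ rels
  small_cancellation : ∀ r ∈ rels, ∀ p : Word S, p <+: r → IsPiece rels p →
    6 * p.length < r.length

/-- The element of the free group represented by a word. -/
def wordVal {S : Type} (w : Word S) : FreeGroup S :=
  (w.map fun l => (FreeGroup.of l.1) ^ (if l.2 then (1 : ℤ) else -1)).prod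

/-- The group defined by a `C'(1/6)` presentation. -/
abbrev C6Presentation.Grp {S : Type} (P : C6Presentation S) : Type :=
  PresentedGroup (wordVal '' P.rels)

/-- The generating set of the presented group (the images of the letters of `S`). -/
def C6Presentation.gens {S : Type} (P : C6Presentation S) : Set P.Grp :=
  Set.range fun a : S => (PresentedGroup.of a : P.Grp)

/-- The element of the presented group represented by a word. -/
def C6Presentation.elt {S : Type} (P : C6Presentation S) (w : Word S) : P.Grp :=
  (w.map fun l => (PresentedGroup.of l.1 : P.Grp) ^ (if l.2 then (1 : ℤ) else -1)).prod

/-- The word length of `g` with respect to a generating set `S ⊆ G`: the least `n`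
such that `g` is a product of `n` elements of `S ∪ S⁻¹`. -/
noncomputable def wordLength {G : Type*} [Group G] (S : Set G) (g : G) : ℕ :=
  sInf {n : ℕ | ∃ l : List G, l.length = n ∧ (∀ x ∈ l, x ∈ S ∨ x⁻¹ ∈ S) ∧ l.prod = g}

/-- The word metric on `G` with respect to `S`, as a real-valued function. -/
noncomputable def wdist {G : Type*} [Group G] (S : Set G) (g h : G) : ℝ :=
  (wordLength S (g⁻¹ * h) : ℝ)

/-- Distance from a point to a subset, in the word metric. -/
noncomputable def setDist {G : Type*} [Group G] (S : Set G) (x : G) (Y : Set G) : ℝ :=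
  sInf (wdist S x '' Y)

/-- Closest point projection to a subset `Y`, in the word metric. -/
def proj {G : Type*} [Group G] (S : Set G) (Y : Set G) (x : G) : Set G :=
  {y ∈ Y | wdist S x y = setDist S x Y}

/-- Diameter of a subset, in the word metric. -/
noncomputable def setDiam {G : Type*} [Group G] (S : Set G) (A : Set G) : ℝ :=
  sSup {d : ℝ | ∃ x ∈ A, ∃ y ∈ A, d = wdist S x y}

/-- Admissibility of a pair of contraction gauges `(ρ₁, ρ₂)`: both non-decreasing and
eventually non-negative, `ρ₁ r ≤ r`, `ρ₁` unbounded, and `ρ₂/ρ₁ → 0` at infinity. -/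
def Admissible (ρ₁ ρ₂ : ℝ → ℝ) : Prop :=
  Monotone ρ₁ ∧ Monotone ρ₂ ∧
  (∀ᶠ r in atTop, 0 ≤ ρ₁ r) ∧ (∀ᶠ r in atTop, 0 ≤ ρ₂ r) ∧
  (∀ r : ℝ, ρ₁ r ≤ r) ∧ (∀ M : ℝ, ∃ r : ℝ, M ≤ ρ₁ r) ∧
  Tendsto (fun r => ρ₂ r / ρ₁ r) atTop (nhds 0)

/-- `Y` is `(ρ₁,ρ₂)`-contracting inside the subspace `X` (with the metric induced by the
word metric of `S`): whenever `x, x' ∈ X` satisfy `d(x,x') ≤ ρ₁(d(x,Y))`, the projections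
`π(x) ∪ π(x')` have diameter at most `ρ₂(d(x,Y))`. -/
def ContractingIn {G : Type*} [Group G] (S : Set G) (X Y : Set G) (ρ₁ ρ₂ : ℝ → ℝ) : Prop :=
  Admissible ρ₁ ρ₂ ∧
  ∀ x ∈ X, ∀ x' ∈ X, wdist S x x' ≤ ρ₁ (setDist S x Y) →
    ∀ y ∈ proj S Y x ∪ proj S Y x', ∀ y' ∈ proj S Y x ∪ proj S Y x',
      wdist S y y' ≤ ρ₂ (setDist S x Y)

/-- `Y` is `(ρ₁,ρ₂)`-contracting in `Cay(G,S)`. -/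
def ContractingWith {G : Type*} [Group G] (S : Set G) (ρ₁ ρ₂ : ℝ → ℝ) (Y : Set G) : Prop :=
  ContractingIn S Set.univ Y ρ₁ ρ₂

/-- `Y` is strongly contracting: `(r, C)`-contracting for some constant `C`. -/
def StronglyContracting {G : Type*} [Group G] (S : Set G) (Y : Set G) : Prop :=
  ∃ C : ℝ, ContractingWith S (fun r => r) (fun _ => C) Y

/-- A sublinear function: non-decreasing, eventually non-negative, `f(r)/r → 0`. -/
def Sublinear (f : ℝ → ℝ) : Prop :=
  Monotone f ∧ (∀ᶠ r in atTop, 0 ≤ f r) ∧ Tendsto (fun r => f r / r) atTop (nhds 0)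

/-- `f ⪯ g`: there are constants `C₁, C₂ > 0` and `C₃, C₄ ≥ 0` with
`f(x) ≤ C₁ g(C₂ x + C₃) + C₄` for all `x`. -/
def Preceq (f g : ℝ → ℝ) : Prop :=
  ∃ C₁ C₂ C₃ C₄ : ℝ, 0 < C₁ ∧ 0 < C₂ ∧ 0 ≤ C₃ ∧ 0 ≤ C₄ ∧
    ∀ x : ℝ, f x ≤ C₁ * g (C₂ * x + C₃) + C₄

/-- `f ≍ g`: `f ⪯ g` and `g ⪯ f`. -/
def Asymp (f g : ℝ → ℝ) : Prop := Preceq f g ∧ Preceq g f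

/-- `α ⊆ G` is a geodesic of `Cay(G,S)`: the image of an isometric embedding of a
subinterval of `ℤ` into `(G, d_S)`. -/
def IsGeodesic {G : Type*} [Group G] (S : Set G) (α : Set G) : Prop :=
  ∃ (I : Set ℤ) (γ : ℤ → G), I.OrdConnected ∧
    (∀ m ∈ I, ∀ n ∈ I, wdist S (γ m) (γ n) = |(m : ℝ) - (n : ℝ)|) ∧ α = γ '' I

/-- `α ⊆ G` is a bi-infinite geodesic of `Cay(G,S)`. -/
def IsBiInfGeodesic {G : Type*} [Group G] (S : Set G) (α : Set G) : Prop :=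
  ∃ γ : ℤ → G, (∀ m n : ℤ, wdist S (γ m) (γ n) = |(m : ℝ) - (n : ℝ)|) ∧ α = Set.range γ

/-- `Y` is Morse: there is `μ` such that every `(L,A)`-quasi-geodesic with endpoints on
`Y` stays in the `μ(L,A)`-neighborhood of `Y`. -/
def IsMorse {G : Type*} [Group G] (S : Set G) (Y : Set G) : Prop :=
  ∃ μ : ℝ → ℝ → ℝ, ∀ L A : ℝ, 1 ≤ L → 0 ≤ A →
    ∀ (q : ℤ → G) (m n : ℤ), m ≤ n → q m ∈ Y → q n ∈ Y →
    (∀ i j : ℤ, m ≤ i → i ≤ n → m ≤ j → j ≤ n →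
      L⁻¹ * |(i : ℝ) - (j : ℝ)| - A ≤ wdist S (q i) (q j) ∧
      wdist S (q i) (q j) ≤ L * |(i : ℝ) - (j : ℝ)| + A) →
    ∀ i : ℤ, m ≤ i → i ≤ n → setDist S (q i) Y ≤ μ L A

/-- Two subsets are at finite Hausdorff distance in the word metric. -/
def FinHausdorffDist {G : Type*} [Group G] (S : Set G) (A B : Set G) : Prop :=
  ∃ ε : ℝ, (∀ a ∈ A, ∃ b ∈ B, wdist S a b ≤ ε) ∧ ∀ b ∈ B, ∃ a ∈ A, wdist S a b ≤ ε

/-- The embedded relator cycle determined by `g ∈ G(Γ)` and a relator `r`: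
the set `{g ⋅ p̄ : p a prefix of r}`. -/
def relatorCycle {S : Type} (P : C6Presentation S) (g : P.Grp) (r : Word S) :
    Set P.Grp :=
  {x | ∃ p : Word S, p <+: r ∧ x = g * P.elt p}

/-- A geodesic `α` is locally `(ρ₁,ρ₂)`-contracting: for every embedded relator cycle
`Γ₀` meeting `α`, the set `Γ₀ ∩ α` is `(ρ₁,ρ₂)`-contracting as a subspace of `Γ₀`. -/
def LocallyContracting {S : Type} (P : C6Presentation S) (α : Set P.Grp)
    (ρ₁ ρ₂ : ℝ → ℝ) : Prop :=
  ∀ (g : P.Grp) (r : Word S), r ∈ P.rels → (relatorCycle P g r ∩ α).Nonempty →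
    ContractingIn P.gens (relatorCycle P g r) (relatorCycle P g r ∩ α) ρ₁ ρ₂

/-- The generating set `S ∪ W` of the coned-off space: `W` is the set of elements
represented by subwords of cyclic permutations of relators (equivalently, by prefixes
of relators, since the relator set is closed under cyclic permutation). -/
def conedGens {S : Type} (P : C6Presentation S) : Set P.Grp :=
  P.gens ∪ {x | ∃ r ∈ P.rels, ∃ p : Word S, p <+: r ∧ x = P.elt p}

/-- The exponential growth rate of `(G,S)`. -/
noncomputable def growthRate {G : Type*} [Group G] (S : Set G) : ℝ :=
  limsup (fun n : ℕ => Real.log (Nat.card {g : G // wordLength S g ≤ n}) / (n : ℝ)) atTop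

/-- Quasi-isometry of marked groups `(G,S)` and `(H,T)` via word metrics. -/
def QIsom {G H : Type*} [Group G] [Group H] (S : Set G) (T : Set H) : Prop :=
  ∃ (f : G → H) (L A : ℝ), 1 ≤ L ∧ 0 ≤ A ∧
    (∀ x y : G, L⁻¹ * wdist S x y - A ≤ wdist T (f x) (f y) ∧
      wdist T (f x) (f y) ≤ L * wdist S x y + A) ∧
    ∀ h : H, ∃ x : G, wdist T (f x) h ≤ A

/-- A subgroup is virtually cyclic if it contains a cyclic subgroup of finite index. -/
def VirtuallyCyclic {G : Type*} [Group G] (E : Subgroup G) : Prop :=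
  ∃ g : G, Subgroup.zpowers g ≤ E ∧ ((Subgroup.zpowers g).subgroupOf E).index ≠ 0

end GSC
namespace GSC

open Equiv

set_option linter.unusedSectionVars false

section

section Counting

variable {D : Type} [Finite D]

/-- The number of classes of an equivalence relation. -/
noncomputable def numClasses (r : Setoid D) : ℕ := Nat.card (Quotient r)

theorem numClasses_le {r s : Setoid D} (h : r ≤ s) : numClasses s ≤ numClasses r :=
  Nat.card_le_card_of_surjective (Quotient.map' id fun _ _ hxy => h hxy) fun q =>
    Quotient.inductionOn' q fun x => ⟨Quotient.mk'' x, rfl⟩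

theorem numClasses_lt {r s : Setoid D} (h : r ≤ s) {a b : D} (hr : ¬ r a b) (hs : s a b) :
    numClasses s + 1 ≤ numClasses r := by
  have hsurj : Function.Surjective
      (Quotient.map' id fun _ _ hxy => h hxy : Quotient r → Quotient s) := fun q =>
    Quotient.inductionOn' q fun x => ⟨Quotient.mk'' x, rfl⟩
  rcases (numClasses_le h).lt_or_eq with hlt | heq
  · exact hlt
  · have hbij := (Nat.bijective_iff_surjective_and_card _).2 ⟨hsurj, heq.symm⟩
    exact absurd (Quotient.exact (hbij.1 (Quotient.sound hs :
      (Quotient.mk'' a : Quotient s) = Quotient.mk'' b) :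
        (Quotient.mk r a) = Quotient.mk r b)) hr

/-- The equivalence relation obtained from `r` by joining the classes of `a` and `b`. -/
def joinPair (r : Setoid D) (a b : D) : Setoid D where
  r x y := r x y ∨ ((r x a ∨ r x b) ∧ (r y a ∨ r y b))
  iseqv := by
    refine ⟨fun x => Or.inl (r.refl x), ?_, ?_⟩
    · rintro x y (h | h)
      · exact Or.inl (r.symm h)
      · exact Or.inr h.symm
    · rintro x y z (h | ⟨h1, h2⟩) (h' | ⟨h1', h2'⟩)
      · exact Or.inl (r.trans h h')
      · exact Or.inr ⟨h1'.imp (r.trans h) (r.trans h), h2'⟩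
      · exact Or.inr ⟨h1, h2.imp (r.trans (r.symm h')) (r.trans (r.symm h'))⟩
      · exact Or.inr ⟨h1, h2'⟩

theorem numClasses_le_add_one {r s : Setoid D} {a b : D} (h : s ≤ joinPair r a b) :
    numClasses r ≤ numClasses s + 1 := by
  classical
  have : numClasses s + 1 = Nat.card (Option (Quotient s)) := (Finite.card_option).symm
  rw [this]
  refine Nat.card_le_card_of_injective (fun q : Quotient r =>
    if r q.out b then none else some (Quotient.mk s q.out)) ?_
  intro p q hpq
  have key : r p.out q.out → p = q := fun hh => by
    rw [← Quotient.out_eq p, ← Quotient.out_eq q]; exact Quotient.sound hh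
  apply key
  by_cases h1 : r p.out b <;> by_cases h2 : r q.out b <;> simp only [h1, h2, if_true, if_false,
    reduceCtorEq, Option.some.injEq] at hpq
  · exact r.trans h1 (r.symm h2)
  · rcases h (Quotient.exact hpq) with h3 | ⟨h3, h4⟩
    · exact h3
    · exact r.trans (h3.resolve_right h1) (r.symm (h4.resolve_right h2))

/-- The number of cycles (including fixed points) of a permutation. -/
noncomputable def cyc (φ : Perm D) : ℕ := numClasses (Perm.SameCycle.setoid φ)

theorem sameCycle_le {φ : Perm D} {s : Setoid D} (h : ∀ x, s x (φ x)) :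
    Perm.SameCycle.setoid φ ≤ s := by
  rintro x y hxy
  obtain ⟨i, -, rfl⟩ := Perm.SameCycle.exists_pow_eq' (show φ.SameCycle x y from hxy)
  clear hxy
  induction i with
  | zero => exact s.refl x
  | succ n ih => rw [pow_succ']; exact s.trans ih (h _)

/-- The relation of lying in the same connected component. -/
def conn (φ e : Perm D) : Setoid D := Relation.EqvGen.setoid fun x y => y = φ x ∨ y = e x

theorem conn_le {φ e : Perm D} {s : Setoid D} (h1 : ∀ x, s x (φ x)) (h2 : ∀ x, s x (e x)) :
    conn φ e ≤ s := by
  intro x y h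
  induction h with
  | rel x y h => rcases h with rfl | rfl; exacts [h1 _, h2 _]
  | refl x => exact s.refl x
  | symm x y _ ih => exact s.symm ih
  | trans x y z _ _ ih1 ih2 => exact s.trans ih1 ih2

theorem conn_left (φ e : Perm D) (x : D) : conn φ e x (φ x) := Relation.EqvGen.rel _ _ (Or.inl rfl)

theorem conn_right (φ e : Perm D) (x : D) : conn φ e x (e x) :=
  Relation.EqvGen.rel _ _ (Or.inr rfl)

theorem sameCycle_le_conn (φ e : Perm D) : Perm.SameCycle.setoid φ ≤ conn φ e :=
  sameCycle_le fun x => conn_left φ e x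

theorem conn_mul (φ e : Perm D) : Perm.SameCycle.setoid (φ * e) ≤ conn φ e :=
  sameCycle_le fun x => (conn φ e).trans (conn_right φ e x) (conn_left φ e (e x))

variable [DecidableEq D]

theorem joinPair_swap {r : Setoid D} {φ : Perm D} (h : ∀ x, r x (φ x)) (a b x : D) :
    joinPair r a b x ((φ * swap a b) x) := by
  rw [Perm.mul_apply]
  by_cases hxa : x = a
  · subst hxa; rw [swap_apply_left]; exact Or.inr ⟨Or.inl (r.refl _), Or.inr (r.symm (h _))⟩
  by_cases hxb : x = b
  · subst hxb; rw [swap_apply_right]; exact Or.inr ⟨Or.inr (r.refl _), Or.inl (r.symm (h _))⟩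
  rw [swap_apply_of_ne_of_ne hxa hxb]; exact Or.inl (h x)

theorem cyc_le_swap (φ : Perm D) (a b : D) : cyc φ ≤ cyc (φ * swap a b) + 1 :=
  numClasses_le_add_one (a := a) (b := b) <| sameCycle_le <|
    joinPair_swap (fun x => (Perm.sameCycle_apply_right.2 (Perm.SameCycle.refl φ x))) a b

theorem conn_swap_le (φ e : Perm D) (a b : D) :
    numClasses (conn (φ * swap a b) e) ≤ numClasses (conn φ e) + 1 := by
  refine numClasses_le_add_one (a := a) (b := b) (conn_le (fun x => ?_)
    fun x => Or.inl (conn_right _ _ _))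
  have := joinPair_swap (conn_left (φ * swap a b) e) a b x
  rwa [mul_assoc, swap_mul_self, mul_one] at this

theorem SameCycle.invariant {φ : Perm D} {A : Set D} (hA : ∀ x ∈ A, φ x ∈ A) {x y : D}
    (h : φ.SameCycle x y) (hx : x ∈ A) : y ∈ A := by
  obtain ⟨i, -, rfl⟩ := h.exists_pow_eq'
  clear h
  induction i with
  | zero => exact hx
  | succ n ih => rw [pow_succ']; exact hA _ ih

theorem not_sameCycle_swap {φ : Perm D} {a b : D} (hab : a ≠ b) (h : φ.SameCycle a b) :
    ¬ (φ * swap a b).SameCycle a b := by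
  have hex : ∃ k : ℕ, (φ ^ k) b = a := by
    obtain ⟨i, -, hi⟩ := h.symm.exists_pow_eq'
    exact ⟨i, hi⟩
  classical
  have hk := Nat.find_spec hex
  have hmin := fun m => Nat.find_min hex (m := m)
  set k := Nat.find hex
  intro hs
  have hk0 : 0 < k := by
    rcases Nat.eq_zero_or_pos k with h0 | h0
    · rw [h0] at hk; exact absurd hk.symm hab
    · exact h0
  have hA : ∀ j, 1 ≤ j → j ≤ k → (φ ^ j) b ≠ b := by
    intro j h1 h2 h3
    rcases h2.lt_or_eq with h2 | rfl
    · apply hmin (k - j) (by omega)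
      rw [← h3, ← Perm.mul_apply, ← pow_add, Nat.sub_add_cancel h2.le, hk]
    · exact hab (hk.symm.trans h3)
  have := SameCycle.invariant (A := {x | ∃ j, 1 ≤ j ∧ j ≤ k ∧ (φ ^ j) b = x}) ?_ hs
    ⟨k, hk0, le_rfl, hk⟩
  · obtain ⟨j, h1, h2, h3⟩ := this
    exact hA j h1 h2 h3
  · rintro x ⟨j, h1, h2, rfl⟩
    rcases h2.lt_or_eq with h2 | rfl
    · refine ⟨j + 1, by omega, h2, ?_⟩
      rw [Perm.mul_apply, swap_apply_of_ne_of_ne (hmin j h2) (hA j h1 h2.le), pow_succ',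
        Perm.mul_apply]
    · exact ⟨1, le_rfl, hk0, by rw [hk, Perm.mul_apply, swap_apply_left, pow_one]⟩

theorem sameCycle_swap {φ : Perm D} {a b : D} (h : ¬ φ.SameCycle a b) :
    (φ * swap a b).SameCycle a b := by
  obtain ⟨k, hk0, hk⟩ : ∃ k : ℕ, 0 < k ∧ (φ ^ k) b = b :=
    ⟨orderOf φ, orderOf_pos φ, by simp [pow_orderOf_eq_one]⟩
  by_contra hs
  have key : ∀ j : ℕ, (φ * swap a b).SameCycle a ((φ ^ (j + 1)) b) := by
    intro j
    induction j with
    | zero =>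
      have := Perm.sameCycle_apply_right.2 (Perm.SameCycle.refl (φ * swap a b) a)
      simpa using this
    | succ j ih =>
      have h1 : (φ ^ (j + 1)) b ≠ b := fun h1 => hs (by rwa [h1] at ih)
      have h2 : (φ ^ (j + 1)) b ≠ a := fun h3 => h (Perm.SameCycle.symm ⟨((j + 1 : ℕ) : ℤ), by rw [zpow_natCast]; exact h3⟩)
      have := Perm.sameCycle_apply_right.2 ih
      rwa [Perm.mul_apply, swap_apply_of_ne_of_ne h2 h1, ← Perm.mul_apply, ← pow_succ'] at this
  apply hs
  have := key (k - 1)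
  rwa [Nat.sub_add_cancel hk0, hk] at this

theorem cyc_swap {φ : Perm D} {a b : D} (hab : a ≠ b) (h : φ.SameCycle a b) :
    cyc φ + 1 ≤ cyc (φ * swap a b) := by
  refine numClasses_lt (sameCycle_le fun x => ?_) (not_sameCycle_swap hab h) h
  rcases joinPair_swap (r := Perm.SameCycle.setoid φ)
    (fun x => (Perm.sameCycle_apply_right.2 (Perm.SameCycle.refl φ x))) a b x with h1 | ⟨h1, h2⟩
  · exact h1
  · have h3 : φ.SameCycle x a := h1.elim id fun h1 => Perm.SameCycle.trans h1 h.symm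
    have h4 : φ.SameCycle ((φ * swap a b) x) a := h2.elim id fun h1 => Perm.SameCycle.trans h1 h.symm
    exact h3.trans h4.symm

end Counting

section Period

variable {D : Type} [Fintype D]

/-- The length of the cycle of `φ` through `d`. -/
noncomputable def per (φ : Perm D) (d : D) : ℕ := Function.minimalPeriod φ d

theorem mem_periodicPts (φ : Perm D) (d : D) : d ∈ Function.periodicPts φ := by
  refine ⟨orderOf φ, orderOf_pos φ, ?_⟩
  rw [Function.IsPeriodicPt, Function.IsFixedPt, ← Perm.coe_pow, pow_orderOf_eq_one, Perm.one_apply]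

theorem per_pos (φ : Perm D) (d : D) : 0 < per φ d :=
  Function.minimalPeriod_pos_of_mem_periodicPts (mem_periodicPts φ d)

theorem iterate_per (φ : Perm D) (d : D) : φ^[per φ d] d = d := Function.iterate_minimalPeriod

theorem per_iterate (φ : Perm D) (d : D) (n : ℕ) : per φ (φ^[n] d) = per φ d :=
  Function.minimalPeriod_apply_iterate (mem_periodicPts φ d) n

theorem per_apply (φ : Perm D) (d : D) : per φ (φ d) = per φ d :=
  Function.minimalPeriod_apply (mem_periodicPts φ d)

theorem iterate_inj_lt {φ : Perm D} {d : D} {i j : ℕ} (hi : i < per φ d) (hj : j < per φ d)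
    (h : φ^[i] d = φ^[j] d) : i = j :=
  (Function.iterate_eq_iterate_iff_of_lt_minimalPeriod hi hj).1 h

theorem iterate_mod_per (φ : Perm D) (d : D) (n : ℕ) : φ^[n % per φ d] d = φ^[n] d :=
  Function.iterate_mod_minimalPeriod_eq

theorem sameCycle_iff {φ : Perm D} {d x : D} :
    φ.SameCycle d x ↔ ∃ i < per φ d, φ^[i] d = x := by
  constructor
  · intro h
    obtain ⟨i, -, rfl⟩ := h.exists_pow_eq'
    exact ⟨i % per φ d, Nat.mod_lt _ (per_pos φ d), by rw [iterate_mod_per, Perm.coe_pow]⟩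
  · rintro ⟨i, -, rfl⟩
    exact ⟨(i : ℤ), by rw [zpow_natCast, Perm.coe_pow]⟩

theorem sameCycle_iterate (φ : Perm D) (d : D) (i : ℕ) : φ.SameCycle d (φ^[i] d) :=
  ⟨(i : ℤ), by rw [zpow_natCast, Perm.coe_pow]⟩

theorem per_eq_of_sameCycle {φ : Perm D} {x y : D} (h : φ.SameCycle x y) : per φ x = per φ y := by
  obtain ⟨i, -, rfl⟩ := sameCycle_iff.1 h
  exact (per_iterate φ x i).symm

open Classical in
/-- The cycle of `φ` through `d`. -/
noncomputable def cycleOf (φ : Perm D) (d : D) : Finset D := {x | φ.SameCycle d x}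

theorem mem_cycleOf {φ : Perm D} {d x : D} : x ∈ cycleOf φ d ↔ φ.SameCycle d x := by
  simp [cycleOf]

theorem cycleOf_eq_image [DecidableEq D] (φ : Perm D) (d : D) :
    cycleOf φ d = (Finset.range (per φ d)).image fun i => φ^[i] d := by
  ext x
  rw [mem_cycleOf, sameCycle_iff]
  simp

theorem card_cycleOf (φ : Perm D) (d : D) : (cycleOf φ d).card = per φ d := by
  classical
  rw [cycleOf_eq_image, Finset.card_image_of_injOn, Finset.card_range]
  intro i hi j hj h
  exact iterate_inj_lt (by simpa using hi) (by simpa using hj) h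

theorem cycleOf_eq {φ : Perm D} {x y : D} (h : φ.SameCycle x y) : cycleOf φ x = cycleOf φ y := by
  ext z
  rw [mem_cycleOf, mem_cycleOf]
  exact ⟨h.symm.trans, h.trans⟩

/-- Summation over `D` by cycles of `φ`. -/
theorem sum_div_per (φ : Perm D) (s : D → Prop) [DecidablePred s] (f : D → ℚ)
    (hs : ∀ x, s x → s (φ x)) :
    ∑ d with s d, f d = ∑ d with s d, (∑ x ∈ cycleOf φ d, f x) / per φ d := by
  classical
  have hinv : ∀ x y, φ.SameCycle x y → s x → s y := fun x y h hx =>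
    SameCycle.invariant (A := {x | s x}) hs h hx
  have h1 : ∀ d : D, (∑ x ∈ cycleOf φ d, f x) / per φ d =
      ∑ x, if φ.SameCycle d x then f x / per φ x else 0 := by
    intro d
    rw [Finset.sum_div, cycleOf, Finset.sum_filter]
    refine Finset.sum_congr rfl fun x _ => ?_
    split_ifs with h
    · rw [per_eq_of_sameCycle h]
    · rfl
  simp only [h1, Finset.sum_filter]
  have h2 : ∀ d : D, (if s d then ∑ x, if φ.SameCycle d x then f x / per φ x else 0 else 0) =
      ∑ x, if s x ∧ φ.SameCycle x d then f x / per φ x else 0 := by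
    intro d
    split_ifs with h
    · refine Finset.sum_congr rfl fun x _ => ?_
      congr 1
      simp only [eq_iff_iff]
      exact ⟨fun h' => ⟨hinv _ _ h' h, h'.symm⟩, fun h' => h'.2.symm⟩
    · symm
      refine Finset.sum_eq_zero fun x _ => ?_
      rw [if_neg]
      rintro ⟨h3, h4⟩
      exact h (hinv _ _ h4 h3)
  simp only [h2]
  rw [Finset.sum_comm]
  refine Finset.sum_congr rfl fun x _ => ?_
  split_ifs with h
  · simp only [h, true_and]
    rw [← Finset.sum_filter, Finset.sum_const]
    have : (Finset.univ.filter fun y => φ.SameCycle x y).card = per φ x := by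
      rw [← card_cycleOf]; congr 1
    rw [this, nsmul_eq_mul, mul_div_cancel₀]
    exact_mod_cast (per_pos φ x).ne'
  · simp [h]

theorem sum_inv_per (φ : Perm D) : ∑ d, (1 : ℚ) / per φ d = cyc φ := by
  classical
  have : Fintype (Quotient (Perm.SameCycle.setoid φ)) := Fintype.ofFinite _
  rw [← Finset.sum_fiberwise (s := Finset.univ)
    (g := fun d => (Quotient.mk (Perm.SameCycle.setoid φ) d))]
  rw [cyc, numClasses, Nat.card_eq_fintype_card, ← Finset.card_univ, Finset.cast_card]
  refine Finset.sum_congr rfl fun q _ => ?_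
  induction q using Quotient.inductionOn with
  | h d =>
    have h1 : (Finset.univ.filter fun x : D => Quotient.mk (Perm.SameCycle.setoid φ) x =
        Quotient.mk (Perm.SameCycle.setoid φ) d) = cycleOf φ d := by
      ext x
      simp only [Finset.mem_filter, Finset.mem_univ, true_and, mem_cycleOf]
      exact ⟨fun h => Perm.SameCycle.symm (Quotient.exact h),
        fun h => Quotient.sound (s := Perm.SameCycle.setoid φ) (Perm.SameCycle.symm h)⟩
    rw [h1, Finset.sum_congr rfl (g := fun _ => (1 : ℚ) / per φ d), Finset.sum_const, card_cycleOf,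
      nsmul_eq_mul, mul_one_div_cancel]
    · exact_mod_cast (per_pos φ d).ne'
    · intro x hx
      rw [per_eq_of_sameCycle (mem_cycleOf.1 hx)]

theorem card_of_involution (φ : Perm D) (h1 : ∀ x, φ (φ x) = x) (h2 : ∀ x, φ x ≠ x) :
    Fintype.card D = 2 * cyc φ := by
  have h3 : ∀ d, per φ d = 2 := by
    intro d
    have ha : per φ d ∣ 2 := Function.IsPeriodicPt.minimalPeriod_dvd (n := 2) (h1 d)
    have hb : per φ d ≠ 1 := fun h => h2 d (Function.minimalPeriod_eq_one_iff_isFixedPt.1 h)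
    rcases (Nat.dvd_prime Nat.prime_two).1 ha with h | h
    · exact absurd h hb
    · exact h
  have h4 := sum_inv_per φ
  simp only [h3, Finset.sum_const, Finset.card_univ, nsmul_eq_mul] at h4
  have h5 : (Fintype.card D : ℚ) = 2 * cyc φ := by rw [← h4]; push_cast; ring
  exact_mod_cast h5

end Period

end

section

section Words

variable {S : Type}

/-- The inverse of a letter. -/
def linv (l : S × Bool) : S × Bool := (l.1, !l.2)

@[simp] theorem linv_linv (l : S × Bool) : linv (linv l) = l := by simp [linv]

theorem linv_ne (l : S × Bool) : linv l ≠ l := by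
  intro h
  have := congrArg Prod.snd h
  simp [linv] at this

@[simp] theorem wordInv_nil : wordInv ([] : Word S) = [] := rfl

@[simp] theorem wordInv_append (u v : Word S) : wordInv (u ++ v) = wordInv v ++ wordInv u := by
  simp [wordInv]

@[simp] theorem wordInv_cons (a : S × Bool) (u : Word S) : wordInv (a :: u) = wordInv u ++ [linv a] := by
  simp [wordInv, linv]

@[simp] theorem wordInv_wordInv (u : Word S) : wordInv (wordInv u) = u := by
  induction u with
  | nil => rfl
  | cons a u ih => simp [ih]

@[simp] theorem length_wordInv (u : Word S) : (wordInv u).length = u.length := by simp [wordInv]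

theorem wordInv_eq_reverse_map (u : Word S) : wordInv u = (u.map linv).reverse := rfl

/-- The value of a letter in the presented group. -/
def C6Presentation.ltr (P : C6Presentation S) (l : S × Bool) : P.Grp :=
  (PresentedGroup.of l.1 : P.Grp) ^ (if l.2 then (1 : ℤ) else -1)

variable (P : C6Presentation S)

theorem ltr_linv (l : S × Bool) : P.ltr (linv l) = (P.ltr l)⁻¹ := by
  rcases l with ⟨a, _ | _⟩ <;> simp [C6Presentation.ltr, linv]

@[simp] theorem elt_nil : P.elt [] = 1 := rfl

@[simp] theorem elt_cons (a : S × Bool) (u : Word S) : P.elt (a :: u) = P.ltr a * P.elt u := by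
  simp [C6Presentation.elt, C6Presentation.ltr]

@[simp] theorem elt_append (u v : Word S) : P.elt (u ++ v) = P.elt u * P.elt v := by
  simp [C6Presentation.elt]

@[simp] theorem elt_wordInv (u : Word S) : P.elt (wordInv u) = (P.elt u)⁻¹ := by
  induction u with
  | nil => simp
  | cons a u ih => simp [ih, ltr_linv]

theorem wordVal_cons (a : S × Bool) (u : Word S) :
    wordVal (a :: u) = FreeGroup.of a.1 ^ (if a.2 then (1 : ℤ) else -1) * wordVal u := by
  simp [wordVal]

theorem wordVal_append (u v : Word S) : wordVal (u ++ v) = wordVal u * wordVal v := by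
  simp [wordVal]

theorem wordVal_eq_mk (u : Word S) : wordVal u = FreeGroup.mk u := by
  induction u with
  | nil => rfl
  | cons a u ih =>
    rw [wordVal_cons, ih]
    rcases a with ⟨a, _ | _⟩ <;> simp [FreeGroup.of, FreeGroup.invRev]

theorem wordVal_wordInv (u : Word S) : wordVal (wordInv u) = (wordVal u)⁻¹ := by
  rw [wordVal_eq_mk, wordVal_eq_mk, FreeGroup.inv_mk]; rfl

theorem elt_eq_mk (u : Word S) : P.elt u = PresentedGroup.mk (wordVal '' P.rels) (wordVal u) := by
  induction u with
  | nil => simp [wordVal]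
  | cons a u ih =>
    rw [elt_cons, ih, wordVal_cons, map_mul, map_zpow]
    rfl

theorem elt_eq_one_of_wordVal {u : Word S} (h : wordVal u = 1) : P.elt u = 1 := by
  rw [elt_eq_mk, h, map_one]

theorem elt_rel {r : Word S} (h : r ∈ P.rels) : P.elt r = 1 := by
  rw [elt_eq_mk]
  exact (QuotientGroup.eq_one_iff _).2 (Subgroup.subset_normalClosure ⟨r, h, rfl⟩)

theorem exists_adjacent_of_not_chain {A : Type*} {R : A → A → Prop} {l : List A}
    (h : ¬ l.IsChain R) : ∃ l₁ a b l₂, l = l₁ ++ a :: b :: l₂ ∧ ¬ R a b := by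
  induction l with
  | nil => simp at h
  | cons a l ih =>
    cases l with
    | nil => simp at h
    | cons b l =>
      rw [List.isChain_cons_cons] at h
      by_cases hab : R a b
      · obtain ⟨l₁, c, d, l₂, h1, h2⟩ := ih fun h' => h ⟨hab, h'⟩
        exact ⟨a :: l₁, c, d, l₂, by rw [h1]; rfl, h2⟩
      · exact ⟨[], a, b, l, rfl, hab⟩

theorem exists_cancelling {u : Word S} (hu : u ≠ []) (h : wordVal u = 1) :
    ∃ l₁ a l₂, u = l₁ ++ a :: linv a :: l₂ := by
  by_cases hr : FreeGroup.IsReduced u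
  · classical
    rw [FreeGroup.isReduced_iff_reduce_eq] at hr
    rw [wordVal_eq_mk, ← FreeGroup.toWord_eq_nil_iff, FreeGroup.toWord_mk, hr] at h
    exact absurd h hu
  · obtain ⟨l₁, a, b, l₂, h1, h2⟩ := exists_adjacent_of_not_chain hr
    refine ⟨l₁, a, l₂, ?_⟩
    rw [h1]
    congr
    push Not at h2
    rcases a with ⟨a, x⟩
    rcases b with ⟨b, y⟩
    simp only [linv, Prod.mk.injEq] at h2 ⊢
    refine ⟨h2.1.symm, ?_⟩
    cases x <;> cases y <;> simp_all

open Classical in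
/-- A word representing the identity becomes freely trivial after appending a product of
conjugates of relators. -/
theorem exists_conjugates {w : Word S} (h : P.elt w = 1) :
    ∃ L : List (Word S × Word S), (∀ x ∈ L, x.2 ∈ P.rels) ∧
      wordVal (w ++ (L.map fun x => x.1 ++ x.2 ++ wordInv x.1).flatten) = 1 := by
  have key : ∀ x ∈ Subgroup.normalClosure (wordVal '' P.rels),
      ∃ L : List (Word S × Word S), (∀ x ∈ L, x.2 ∈ P.rels) ∧
        wordVal (L.map fun x => x.1 ++ x.2 ++ wordInv x.1).flatten = x := by
    intro x hx
    rw [Subgroup.normalClosure] at hx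
    induction hx using Subgroup.closure_induction with
    | mem x hx =>
      rw [Group.mem_conjugatesOfSet_iff] at hx
      obtain ⟨a, ⟨r, hr, rfl⟩, hc⟩ := hx
      obtain ⟨c, rfl⟩ := isConj_iff.1 hc
      refine ⟨[(FreeGroup.toWord c, r)], by simpa using hr, ?_⟩
      have hw : wordVal (FreeGroup.toWord c) = c := by rw [wordVal_eq_mk, FreeGroup.mk_toWord]
      simp only [List.map_cons, List.map_nil, List.flatten_cons, List.flatten_nil, List.append_nil,
        wordVal_append, wordVal_wordInv, hw]
    | one => exact ⟨[], by simp, rfl⟩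
    | mul x y _ _ hx hy =>
      obtain ⟨L, h1, h2⟩ := hx
      obtain ⟨L', h1', h2'⟩ := hy
      refine ⟨L ++ L', ?_, ?_⟩
      · intro z hz
        rcases List.mem_append.1 hz with h | h
        exacts [h1 z h, h1' z h]
      · rw [List.map_append, List.flatten_append, wordVal_append, h2, h2']
    | inv x _ hx =>
      obtain ⟨L, h1, h2⟩ := hx
      refine ⟨(L.map fun x => (x.1, wordInv x.2)).reverse, ?_, ?_⟩
      · intro z hz
        simp only [List.mem_reverse, List.mem_map] at hz
        obtain ⟨y, hy, rfl⟩ := hz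
        exact P.inv_mem _ (h1 y hy)
      · rw [← h2]
        clear h1 h2
        induction L with
        | nil => simp [wordVal]
        | cons a L ih =>
          simp only [List.map_cons, List.reverse_cons, List.map_append, List.flatten_append,
            wordVal_append, List.flatten_cons, ih]
          simp [show wordVal ([] : Word S) = 1 from rfl, wordVal_wordInv, mul_assoc]
  rw [elt_eq_mk] at h
  have h1 := (QuotientGroup.eq_one_iff _).1 h
  obtain ⟨L, h2, h3⟩ := key _ (inv_mem h1)
  exact ⟨L, h2, by rw [wordVal_append, h3, mul_inv_cancel]⟩

end Words

end

section

section Faces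

variable {D : Type}

/-- The list `l` runs once around a cycle of `φ` (or is empty). -/
def IsFace (φ : Perm D) (l : List D) : Prop := l.Nodup ∧ (l ++ l).IsChain fun a b => φ a = b

theorem IsFace.nil (φ : Perm D) : IsFace φ [] := ⟨List.nodup_nil, by simp⟩

theorem isFace_append_comm {φ : Perm D} {a b : List D} (h : IsFace φ (a ++ b)) :
    IsFace φ (b ++ a) := by
  obtain ⟨h1, h2⟩ := h
  refine ⟨List.nodup_append_comm.1 h1, ?_⟩
  rcases eq_or_ne a [] with rfl | ha
  · simpa using h2
  rcases eq_or_ne b [] with rfl | hb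
  · simpa using h2
  have e1 : b ++ a ++ (b ++ a) = b ++ (a ++ b) ++ a := by simp
  have h3 : (a ++ (b ++ a) ++ b).IsChain fun a b => φ a = b := by simpa using h2
  have h4 := (List.isChain_append.1 (List.isChain_append.1 h3).1).2.1
  have h5 := List.isChain_append.1 h4
  have h6 : (a ++ b).IsChain fun a b => φ a = b := (List.isChain_append.1 h2).1
  rw [e1, List.isChain_append, List.isChain_append]
  refine ⟨⟨h5.1, h6, ?_⟩, h5.2.1, ?_⟩
  · simpa [List.head?_append_of_ne_nil _ ha] using h5.2.2
  · intro x hx y hy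
    refine h5.2.2 x ?_ y hy
    simpa [List.getLast?_append_of_ne_nil _ hb] using hx

theorem IsFace.congr {φ ψ : Perm D} {l : List D} (h : IsFace φ l) (hc : ∀ x ∈ l, ψ x = φ x) :
    IsFace ψ l := by
  refine ⟨h.1, ?_⟩
  refine List.IsChain.imp_of_mem_imp ?_ h.2
  intro a b ha hb hab
  rw [hc a (by simpa using ha), hab]

theorem chain_eq_iterate {φ : Perm D} {d : D} {l : List D}
    (h : (d :: l).IsChain fun a b => φ a = b) :
    d :: l = (List.range (l.length + 1)).map fun i => φ^[i] d := by
  induction l generalizing d with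
  | nil => rfl
  | cons b l ih =>
    rw [List.isChain_cons_cons] at h
    rw [List.length_cons, ih h.2, List.range_succ_eq_map (n := l.length + 1), List.map_cons,
      List.map_map, ← h.1]
    rfl

variable [Fintype D]

/-- The list of darts around the cycle of `φ` through `d`, starting at `d`. -/
noncomputable def faceList (φ : Perm D) (d : D) : List D :=
  (List.range (per φ d)).map fun i => φ^[i] d

@[simp] theorem length_faceList (φ : Perm D) (d : D) : (faceList φ d).length = per φ d := by
  simp [faceList]

theorem chain_map_iterate (φ : Perm D) (d : D) (n : ℕ) :
    ((List.range n).map fun i => φ^[i] d).IsChain fun a b => φ a = b := by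
  rw [List.isChain_iff_getElem]
  intro i hi
  simp [Function.iterate_succ_apply']

theorem faceList_append_faceList (φ : Perm D) (d : D) : faceList φ d ++ faceList φ d =
    (List.range (per φ d + per φ d)).map fun i => φ^[i] d := by
  rw [List.range_add, List.map_append, List.map_map, faceList]
  congr 1
  refine List.map_congr_left fun i _ => ?_
  rw [Function.comp_apply, add_comm, Function.iterate_add_apply, iterate_per]

theorem isFace_faceList (φ : Perm D) (d : D) : IsFace φ (faceList φ d) := by
  refine ⟨?_, ?_⟩
  · refine List.Nodup.map_on ?_ List.nodup_range
    intro i hi j hj h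
    exact iterate_inj_lt (List.mem_range.1 hi) (List.mem_range.1 hj) h
  · rw [faceList_append_faceList]
    exact chain_map_iterate _ _ _

theorem IsFace.eq_faceList {φ : Perm D} {d : D} {l : List D} (h : IsFace φ (d :: l)) :
    d :: l = faceList φ d := by
  have h1 := chain_eq_iterate (List.isChain_append.1 h.2).1
  have h2 : φ^[l.length + 1] d = d := by
    have h3 := chain_eq_iterate (d := d) (l := l ++ d :: l) (by simpa using h.2)
    have h4 := congrArg (fun m => m[l.length + 1]?) h3
    rw [List.getElem?_map, List.getElem?_range (by simp)] at h4
    simpa using h4.symm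
  have h3 : l.length + 1 = per φ d := by
    apply le_antisymm
    · have hd := h.1
      rw [h1] at hd
      by_contra hlt
      push Not at hlt
      have := List.inj_on_of_nodup_map hd (x := 0) (by simp) (y := per φ d) (by simpa using hlt)
        (by simp [iterate_per])
      have := per_pos φ d
      omega
    · exact Function.IsPeriodicPt.minimalPeriod_le (Nat.succ_pos _) h2
  rw [h1, h3, faceList]

theorem mem_faceList {φ : Perm D} {d x : D} : x ∈ faceList φ d ↔ φ.SameCycle d x := by
  rw [sameCycle_iff]; simp only [faceList, List.mem_map, List.mem_range]

theorem IsFace.sameCycle {φ : Perm D} {l : List D} (h : IsFace φ l) {x y : D} (hx : x ∈ l) :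
    φ.SameCycle x y ↔ y ∈ l := by
  obtain ⟨d, l, rfl⟩ : ∃ d t, l = d :: t := by
    cases l with
    | nil => simp at hx
    | cons d t => exact ⟨d, t, rfl⟩
  rw [h.eq_faceList, mem_faceList] at hx ⊢
  exact ⟨hx.trans, hx.symm.trans⟩

theorem IsFace.apply_mem {φ : Perm D} {l : List D} (h : IsFace φ l) {x : D} :
    φ x ∈ l ↔ x ∈ l := by
  constructor
  · intro hx; exact (h.sameCycle hx).1 (Perm.sameCycle_apply_left.2 (Perm.SameCycle.refl _ _))
  · intro hx; exact (h.sameCycle hx).1 (Perm.sameCycle_apply_right.2 (Perm.SameCycle.refl _ _))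

end Faces

end

section

section Planar

variable {D : Type} [Fintype D] [DecidableEq D]

/-- The combinatorial map with face permutation `φ` and edge involution `e` is a disjoint
union of spheres. -/
def Planar (φ e : Perm D) : Prop :=
  Fintype.card D + 4 * numClasses (conn φ e) ≤ 2 * (cyc φ + cyc (φ * e))

theorem swap_mul_involution {φ e : Perm D} (he : ∀ d, e (e d) = d) (a b : D) :
    φ * swap a b * e = φ * e * swap (e a) (e b) := by
  ext x
  simp only [Perm.mul_apply]
  congr 1
  rcases eq_or_ne x (e a) with rfl | h1
  · rw [he, swap_apply_left, swap_apply_left, he]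
  rcases eq_or_ne x (e b) with rfl | h2
  · rw [he, swap_apply_right, swap_apply_right, he]
  rw [swap_apply_of_ne_of_ne h1 h2, swap_apply_of_ne_of_ne]
  · rintro h; exact h1 (by rw [← h, he])
  · rintro h; exact h2 (by rw [← h, he])

theorem conn_le_of_conn_swap {φ e : Perm D} {a b : D} (h : conn (φ * swap a b) e a b) :
    conn φ e ≤ conn (φ * swap a b) e := by
  refine conn_le (fun x => ?_) fun x => conn_right _ _ _
  have key := joinPair_swap (conn_left (φ * swap a b) e) a b x
  rw [mul_assoc, swap_mul_self, mul_one] at key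
  set s := conn (φ * swap a b) e
  rcases key with h1 | ⟨h1, h2⟩
  · exact h1
  · exact s.trans (h1.elim id fun h1 => s.trans h1 (s.symm h))
      (s.symm (h2.elim id fun h1 => s.trans h1 (s.symm h)))

theorem Planar.swap {φ e : Perm D} (hp : Planar φ e) (he : ∀ d, e (e d) = d) {a b : D}
    (hab : a ≠ b) (h : φ.SameCycle a b ∨ (φ * e).SameCycle (e a) (e b)) :
    Planar (φ * Equiv.swap a b) e := by
  unfold Planar at hp ⊢
  have hs := swap_mul_involution (φ := φ) he a b
  rw [hs]
  have hne : e a ≠ e b := fun h => hab (e.injective h)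
  have hC := conn_swap_le φ e a b
  by_cases h1 : φ.SameCycle a b
  · have hF := cyc_swap hab h1
    by_cases h2 : (φ * e).SameCycle (e a) (e b)
    · have hV := cyc_swap hne h2
      omega
    · have hV := cyc_le_swap (φ * e) (e a) (e b)
      have h3 := sameCycle_swap h2
      rw [← hs] at h3
      have h4 := conn_mul _ _ h3
      have h5 : conn (φ * Equiv.swap a b) e a b :=
        Setoid.trans' _ (conn_right _ _ a) (Setoid.trans' _ h4 (Setoid.symm' _ (conn_right _ _ b)))
      have := numClasses_le (conn_le_of_conn_swap h5)
      omega
  · have h2 := h.resolve_left h1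
    have hV := cyc_swap hne h2
    have hF := cyc_le_swap φ a b
    have h4 := sameCycle_le_conn _ e (sameCycle_swap h1)
    have := numClasses_le (conn_le_of_conn_swap h4)
    omega

/-- Regluing along the edges of `d` and `d'`, where `[d, d']` is a face: the two outer sides are
glued to each other, and `d` is glued to `d'`. -/
def reglue (e : Perm D) (d d' : D) : Perm D := e * Equiv.swap d (e d') * Equiv.swap d' (e d)

variable {φ e : Perm D} {d d' : D}

theorem reglue_apply (he : ∀ d, e (e d) = d) (hne : ∀ d, e d ≠ d) (h1 : d ≠ d') (h2 : e d ≠ d') :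
    reglue e d d' d = d' ∧ reglue e d d' d' = d ∧ reglue e d d' (e d) = e d' ∧
      reglue e d d' (e d') = e d ∧
      ∀ z, z ≠ d → z ≠ d' → z ≠ e d → z ≠ e d' → reglue e d d' z = e z := by
  have h3 : e d' ≠ d := fun h => h2 (by rw [← h, he])
  have h4 : e d ≠ e d' := fun h => h1 (e.injective h)
  simp only [reglue, Perm.mul_apply]
  refine ⟨?_, ?_, ?_, ?_, ?_⟩
  · rw [swap_apply_of_ne_of_ne h1 (hne d).symm, swap_apply_left, he]
  · rw [swap_apply_left, swap_apply_of_ne_of_ne (hne d) h4, he]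
  · rw [swap_apply_right, swap_apply_of_ne_of_ne h1.symm (hne d').symm]
  · rw [swap_apply_of_ne_of_ne (hne d') h4.symm, swap_apply_right]
  · intro z a b c d
    rw [swap_apply_of_ne_of_ne b c, swap_apply_of_ne_of_ne a d]

theorem Planar.reglue (hp : Planar φ e) (he : ∀ d, e (e d) = d) (hne : ∀ d, e d ≠ d)
    (h1 : d ≠ d') (h2 : e d ≠ d') (hd : φ d = d') (hd' : φ d' = d) :
    Planar φ (reglue e d d') := by
  have h3 : e d' ≠ d := fun h => h2 (by rw [← h, he])
  have h4 : e d ≠ e d' := fun h => h1 (e.injective h)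
  unfold Planar at hp ⊢
  have e1 : φ * GSC.reglue e d d' = φ * e * Equiv.swap d (e d') * Equiv.swap d' (e d) := by
    simp only [GSC.reglue, mul_assoc]
  rw [e1]
  have hV1 : cyc (φ * e) + 1 ≤ cyc (φ * e * Equiv.swap d (e d')) := by
    refine cyc_swap h3.symm (Perm.SameCycle.symm ?_)
    refine Perm.SameCycle.trans (Perm.sameCycle_apply_right.2 (Perm.SameCycle.refl _ _)) ?_
    rw [Perm.mul_apply, he, hd']
  have hV2 : cyc (φ * e * Equiv.swap d (e d')) + 1 ≤
      cyc (φ * e * Equiv.swap d (e d') * Equiv.swap d' (e d)) := by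
    refine cyc_swap h2.symm (Perm.SameCycle.symm ?_)
    refine Perm.SameCycle.trans (Perm.sameCycle_apply_right.2 (Perm.SameCycle.refl _ _)) ?_
    rw [Perm.mul_apply, swap_apply_of_ne_of_ne (hne d) h4, Perm.mul_apply, he, hd]
  have hC : numClasses (conn φ (GSC.reglue e d d')) ≤ numClasses (conn φ e) + 1 := by
    obtain ⟨r1, r2, r3, r4, r5⟩ := reglue_apply he hne h1 h2
    refine numClasses_le_add_one (a := d) (b := e d) (conn_le (fun x => ?_) fun x => ?_)
    · exact Or.inl (conn_left _ _ _)
    · have k1 := conn_right φ (GSC.reglue e d d') d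
      have k2 := conn_right φ (GSC.reglue e d d') (e d)
      rw [r1] at k1
      rw [r3] at k2
      have m1 : ∀ z, z = d ∨ z = d' ∨ z = e d ∨ z = e d' →
          (conn φ (GSC.reglue e d d')) z d ∨ (conn φ (GSC.reglue e d d')) z (e d) := by
        rintro z (rfl | rfl | rfl | rfl)
        · exact Or.inl (Setoid.refl' _ _)
        · exact Or.inl (Setoid.symm' _ k1)
        · exact Or.inr (Setoid.refl' _ _)
        · exact Or.inr (Setoid.symm' _ k2)
      by_cases hx : x = d ∨ x = d' ∨ x = e d ∨ x = e d'
      · refine Or.inr ⟨m1 x hx, m1 _ ?_⟩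
        rcases hx with rfl | rfl | rfl | rfl <;> simp [he]
      · push Not at hx
        have := conn_right φ (GSC.reglue e d d') x
        rw [r5 x hx.1 hx.2.1 hx.2.2.1 hx.2.2.2] at this
        exact Or.inl this
  omega

end Planar

section Config

variable {S : Type} (P : C6Presentation S) {D : Type} [Fintype D] [DecidableEq D]

/-- A union of spheres, tessellated and labelled consistently with the Cayley graph. -/
structure Cfg (lab : D → S × Bool) (pos : D → P.Grp) where
  φ : Perm D
  e : Perm D
  e_e : ∀ d, e (e d) = d
  e_ne : ∀ d, e d ≠ d
  lab_e : ∀ d, lab (e d) = linv (lab d)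
  pos_e : ∀ d, pos (e d) = pos d * P.ltr (lab d)
  pos_φ : ∀ d, pos (φ d) = pos d * P.ltr (lab d)
  planar : Planar φ e

variable {P} {lab : D → S × Bool} {pos : D → P.Grp}

namespace Cfg

/-- An edge forming its own connected component, with a single face of length two. -/
def Dead (c : Cfg P lab pos) (d : D) : Prop := c.φ d = c.e d ∧ c.φ (c.e d) = d

theorem Dead.e {c : Cfg P lab pos} {d : D} (h : c.Dead d) : c.Dead (c.e d) :=
  ⟨by rw [h.2, c.e_e], by rw [c.e_e, h.1]⟩

/-- Interchanging the successors of two face corners at the same vertex. -/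
def swapMove (c : Cfg P lab pos) (a b : D) (hab : a ≠ b) (hpos : pos (c.φ a) = pos (c.φ b))
    (h : c.φ.SameCycle a b ∨ (c.φ * c.e).SameCycle (c.e a) (c.e b)) : Cfg P lab pos where
  φ := c.φ * swap a b
  e := c.e
  e_e := c.e_e
  e_ne := c.e_ne
  lab_e := c.lab_e
  pos_e := c.pos_e
  pos_φ d := by
    rw [Perm.mul_apply]
    rcases eq_or_ne d a with rfl | h1
    · rw [swap_apply_left, ← hpos, c.pos_φ]
    rcases eq_or_ne d b with rfl | h2
    · rw [swap_apply_right, hpos, c.pos_φ]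
    rw [swap_apply_of_ne_of_ne h1 h2, c.pos_φ]
  planar := c.planar.swap c.e_e hab h

/-- Regluing along a face of length two with inverse labels. -/
def reglueMove (c : Cfg P lab pos) (d d' : D) (h1 : d ≠ d') (h2 : c.e d ≠ d') (hd : c.φ d = d')
    (hd' : c.φ d' = d) (hl : lab d' = linv (lab d)) : Cfg P lab pos where
  φ := c.φ
  e := reglue c.e d d'
  e_e z := by
    obtain ⟨r1, r2, r3, r4, r5⟩ := reglue_apply c.e_e c.e_ne h1 h2
    by_cases hz : z = d ∨ z = d' ∨ z = c.e d ∨ z = c.e d'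
    · rcases hz with rfl | rfl | rfl | rfl
      · rw [r1, r2]
      · rw [r2, r1]
      · rw [r3, r4]
      · rw [r4, r3]
    · push Not at hz
      rw [r5 z hz.1 hz.2.1 hz.2.2.1 hz.2.2.2, r5, c.e_e]
      · rintro rfl; exact hz.2.2.1 (c.e_e z).symm
      · rintro rfl; exact hz.2.2.2 (c.e_e z).symm
      · intro h; exact hz.1 (c.e.injective h)
      · intro h; exact hz.2.1 (c.e.injective h)
  e_ne z := by
    obtain ⟨r1, r2, r3, r4, r5⟩ := reglue_apply c.e_e c.e_ne h1 h2
    by_cases hz : z = d ∨ z = d' ∨ z = c.e d ∨ z = c.e d'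
    · rcases hz with rfl | rfl | rfl | rfl
      · rw [r1]; exact h1.symm
      · rw [r2]; exact h1
      · rw [r3]; exact fun h => h1 (c.e.injective h).symm
      · rw [r4]; exact fun h => h1 (c.e.injective h)
    · push Not at hz
      rw [r5 z hz.1 hz.2.1 hz.2.2.1 hz.2.2.2]
      exact c.e_ne z
  lab_e z := by
    obtain ⟨r1, r2, r3, r4, r5⟩ := reglue_apply c.e_e c.e_ne h1 h2
    by_cases hz : z = d ∨ z = d' ∨ z = c.e d ∨ z = c.e d'
    · rcases hz with rfl | rfl | rfl | rfl
      · rw [r1, hl]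
      · rw [r2, hl, linv_linv]
      · rw [r3, c.lab_e, c.lab_e, hl]
      · rw [r4, c.lab_e, c.lab_e, hl, linv_linv]
    · push Not at hz
      rw [r5 z hz.1 hz.2.1 hz.2.2.1 hz.2.2.2, c.lab_e]
  pos_e z := by
    obtain ⟨r1, r2, r3, r4, r5⟩ := reglue_apply c.e_e c.e_ne h1 h2
    by_cases hz : z = d ∨ z = d' ∨ z = c.e d ∨ z = c.e d'
    · rcases hz with rfl | rfl | rfl | rfl
      · rw [r1, ← c.pos_φ, hd]
      · rw [r2, ← c.pos_φ, hd']
      · rw [r3, c.pos_e, c.pos_e, c.lab_e, hl, ltr_linv, ← hd, c.pos_φ]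
      · rw [r4, c.pos_e, c.pos_e, c.lab_e, hl, linv_linv, ltr_linv, ← hd, c.pos_φ,
          inv_mul_cancel_right]
    · push Not at hz
      rw [r5 z hz.1 hz.2.1 hz.2.2.1 hz.2.2.2, c.pos_e]
  pos_φ := c.pos_φ
  planar := c.planar.reglue c.e_e c.e_ne h1 h2 hd hd'

theorem pos_chain (c : Cfg P lab pos) (d : D) (n : ℕ) :
    pos (c.φ^[n] d) = pos d * P.elt (((List.range n).map fun i => c.φ^[i] d).map lab) := by
  induction n with
  | zero => simp
  | succ n ih =>
    rw [Function.iterate_succ_apply', c.pos_φ, ih, List.range_succ, List.map_append,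
      List.map_append, elt_append, mul_assoc]
    simp

end Cfg

end Config

end

section

section Moves

variable {S : Type} {P : C6Presentation S} {D : Type} [Fintype D] [DecidableEq D]
  {lab : D → S × Bool} {pos : D → P.Grp}

theorem isFace_concat {φ ψ : Perm D} {l : List D} {a : D} (h1 : (l ++ [a]).Nodup)
    (h2 : (l ++ [a]).IsChain fun x y => φ x = y) (h3 : ∀ x ∈ l, ψ x = φ x)
    (h4 : ∀ y ∈ (l ++ [a]).head?, ψ a = y) : IsFace ψ (l ++ [a]) := by
  have h5 : (l ++ [a]).IsChain fun x y => ψ x = y := by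
    rw [List.isChain_append] at h2 ⊢
    refine ⟨?_, by simp, ?_⟩
    · refine List.IsChain.imp_of_mem_imp ?_ h2.1
      intro x y hx _ hxy
      rw [h3 x hx, hxy]
    · intro x hx y hy
      rw [h3 x (List.mem_of_mem_getLast? hx), h2.2.2 x hx y hy]
  refine ⟨h1, ?_⟩
  rw [List.isChain_append]
  refine ⟨h5, h5, ?_⟩
  intro x hx y hy
  rw [List.getLast?_concat, Option.mem_some_iff] at hx
  rw [← hx, h4 y hy]

theorem Cfg.pos_concat (c : Cfg P lab pos) {l : List D} {a : D}
    (h : (l ++ [a]).IsChain fun x y => c.φ x = y) {y : D} (hy : y ∈ (l ++ [a]).head?) :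
    pos (c.φ a) = pos y * P.elt ((l ++ [a]).map lab) := by
  induction l generalizing y with
  | nil =>
    simp only [List.nil_append, List.head?_cons, Option.mem_some_iff] at hy
    subst hy
    simp [c.pos_φ]
  | cons b l ih =>
    simp only [List.cons_append, List.head?_cons, Option.mem_some_iff] at hy
    subst hy
    obtain ⟨z, hz⟩ : ∃ z, z ∈ (l ++ [a]).head? := by cases l <;> simp
    rw [List.cons_append, List.isChain_cons] at h
    rw [ih h.2 hz, ← h.1 z hz, c.pos_φ, List.cons_append, List.map_cons, elt_cons, mul_assoc]

/-- A face can be split along a subword representing the identity. -/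
theorem Cfg.exists_split (c : Cfg P lab pos) {l₁ l₂ : List D} (h : IsFace c.φ (l₁ ++ l₂))
    (hw : P.elt (l₁.map lab) = 1) : ∃ c' : Cfg P lab pos, c'.e = c.e ∧
      (∀ z ∉ l₁ ++ l₂, c'.φ z = c.φ z) ∧ IsFace c'.φ l₁ ∧ IsFace c'.φ l₂ := by
  rcases List.eq_nil_or_concat' l₁ with rfl | ⟨l₁, a, rfl⟩
  · exact ⟨c, rfl, fun _ _ => rfl, IsFace.nil _, h⟩
  rcases List.eq_nil_or_concat' l₂ with rfl | ⟨l₂, b, rfl⟩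
  · exact ⟨c, rfl, fun _ _ => rfl, by simpa using h, IsFace.nil _⟩
  have hnd := List.nodup_append.1 h.1
  have hch := List.isChain_append.1 (List.isChain_append.1 h.2).1
  obtain ⟨y₁, hy₁⟩ : ∃ z, z ∈ (l₁ ++ [a]).head? := by cases l₁ <;> simp
  obtain ⟨y₂, hy₂⟩ : ∃ z, z ∈ (l₂ ++ [b]).head? := by cases l₂ <;> simp
  have ha : c.φ a = y₂ := hch.2.2 a (by simp) y₂ hy₂
  have hb : c.φ b = y₁ := by
    refine (List.isChain_append.1 h.2).2.2 b (by rw [← List.append_assoc, List.getLast?_concat]; rfl) y₁ ?_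
    rw [List.head?_append_of_ne_nil _ (by simp)]
    exact hy₁
  have hab : a ≠ b := hnd.2.2 a (by simp) b (by simp)
  have hp : pos (c.φ a) = pos (c.φ b) := by
    rw [c.pos_concat hch.1 hy₁, hw, hb, mul_one]
  have hsc : c.φ.SameCycle a b := (h.sameCycle (by simp)).2 (by simp)
  have hnd1 := List.nodup_append.1 hnd.1
  have hnd2 := List.nodup_append.1 hnd.2.1
  have key : ∀ z, z ≠ a → z ≠ b → (c.φ * swap a b) z = c.φ z := fun z h1 h2 => by
    rw [Perm.mul_apply, swap_apply_of_ne_of_ne h1 h2]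
  refine ⟨c.swapMove a b hab hp (Or.inl hsc), rfl, ?_, ?_, ?_⟩
  · intro z hz
    simp only [List.mem_append, List.mem_singleton, not_or] at hz
    exact key z hz.1.2 hz.2.2
  · refine isFace_concat hnd.1 hch.1 ?_ ?_
    · intro x hx
      exact key x (hnd1.2.2 x hx a (by simp)) (hnd.2.2 x (by simp [hx]) b (by simp))
    · intro y hy
      change (c.φ * swap a b) a = y
      rw [Perm.mul_apply, swap_apply_left, hb]
      exact Option.mem_unique hy₁ hy
  · refine isFace_concat hnd.2.1 hch.2.1 ?_ ?_
    · intro x hx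
      exact key x (hnd.2.2 a (by simp) x (by simp [hx])).symm (hnd2.2.2 x hx b (by simp))
    · intro y hy
      change (c.φ * swap a b) b = y
      rw [Perm.mul_apply, swap_apply_right, ha]
      exact Option.mem_unique hy₂ hy

theorem Cfg.Dead.of_eq {c c' : Cfg P lab pos} {z : D} (h : c.Dead z) (h1 : c'.φ z = c.φ z)
    (h2 : c'.φ (c.e z) = c.φ (c.e z)) (h3 : c'.e z = c.e z) : c'.Dead z := by
  unfold Cfg.Dead
  rw [h3, h1, h2]
  exact h

theorem Cfg.Dead.e_mem {c : Cfg P lab pos} {z : D} (h : c.Dead z) {l : List D}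
    (hl : IsFace c.φ l) : c.e z ∈ l ↔ z ∈ l := by
  rw [← h.1, hl.apply_mem]

/-- Two successive inverse edges of a face can be glued together. -/
theorem Cfg.exists_zip (c : Cfg P lab pos) {d d' : D} {l : List D}
    (h : IsFace c.φ (d :: d' :: l)) (hl : lab d' = linv (lab d)) : ∃ c' : Cfg P lab pos,
      (∀ z ∉ d :: d' :: l, c'.φ z = c.φ z) ∧ c'.Dead d ∧ c'.Dead d' ∧
      (∀ z ∉ d :: d' :: l, c.Dead z → c'.Dead z) ∧ IsFace c'.φ l := by
  obtain ⟨c₁, he, hfr, hf, hf'⟩ := c.exists_split (l₁ := [d, d']) (l₂ := l) h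
    (by simp [hl, ltr_linv])
  have hne : d ≠ d' := by
    have := hf.1
    simpa using this
  have hd : c₁.φ d = d' ∧ c₁.φ d' = d := by
    have := hf.2
    simp only [List.cons_append, List.nil_append, List.isChain_cons_cons] at this
    exact ⟨this.1, this.2.1⟩
  have hdead : ∀ z ∉ d :: d' :: l, c.Dead z → c₁.Dead z := by
    intro z hz hdz
    exact hdz.of_eq (hfr z hz) (hfr _ fun h' => hz ((hdz.e_mem h).1 h')) (by rw [he])
  by_cases h2 : c₁.e d = d'
  · refine ⟨c₁, hfr, ⟨by rw [hd.1, h2], by rw [h2, hd.2]⟩, ⟨?_, ?_⟩, hdead, hf'⟩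
    · rw [hd.2, ← h2, c₁.e_e]
    · rw [← h2, c₁.e_e, h2, hd.1]
  · obtain ⟨r1, r2, r3, r4, r5⟩ := reglue_apply c₁.e_e c₁.e_ne hne h2
    refine ⟨c₁.reglueMove d d' hne h2 hd.1 hd.2 hl, hfr, ⟨?_, ?_⟩, ⟨?_, ?_⟩, ?_, hf'⟩
    · exact hd.1.trans r1.symm
    · exact (congrArg c₁.φ r1).trans hd.2
    · exact hd.2.trans r2.symm
    · exact (congrArg c₁.φ r2).trans hd.1
    · intro z hz hdz
      have h3 := hdead z hz hdz
      refine h3.of_eq rfl rfl (r5 z ?_ ?_ ?_ ?_)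
      · rintro rfl; simp at hz
      · rintro rfl; simp at hz
      · rintro rfl; have := (h3.e_mem (l := [d, d']) hf).1 (by simp [c₁.e_e]); simp at this hz; tauto
      · rintro rfl; have := (h3.e_mem (l := [d, d']) hf).1 (by simp [c₁.e_e]); simp at this hz; tauto

/-- A freely trivial part of a face can be folded up. -/
theorem Cfg.exists_collapse (c : Cfg P lab pos) {lz l : List D} (h : IsFace c.φ (lz ++ l))
    (hw : wordVal (lz.map lab) = 1) : ∃ c' : Cfg P lab pos,
      (∀ z ∉ lz ++ l, c'.φ z = c.φ z) ∧ (∀ z ∈ lz, c'.Dead z) ∧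
      (∀ z ∉ lz ++ l, c.Dead z → c'.Dead z) ∧ IsFace c'.φ l := by
  induction hn : lz.length using Nat.strong_induction_on generalizing c lz with
  | _ n ih =>
  rcases eq_or_ne lz [] with rfl | hne
  · exact ⟨c, fun _ _ => rfl, by simp, fun _ _ h => h, by simpa using h⟩
  obtain ⟨u₁, a, u₂, hu⟩ := exists_cancelling (by simpa using hne) hw
  rw [List.map_eq_append_iff] at hu
  obtain ⟨m₁, m, rfl, hm₁, hm⟩ := hu
  rw [List.map_eq_cons_iff] at hm
  obtain ⟨d, m, rfl, hd, hm⟩ := hm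
  rw [List.map_eq_cons_iff] at hm
  obtain ⟨d', m₂, rfl, hd', hm₂⟩ := hm
  have h1 : IsFace c.φ (d :: d' :: (m₂ ++ l ++ m₁)) := by
    have := isFace_append_comm (a := m₁) (b := d :: d' :: m₂ ++ l) (by simpa using h)
    simpa using this
  obtain ⟨c₁, f1, f2, f3, f4, f5⟩ := c.exists_zip h1 (by rw [hd', hd])
  have h2 : IsFace c₁.φ (m₁ ++ m₂ ++ l) := by
    have := isFace_append_comm (a := m₂ ++ l) (b := m₁) f5
    simpa using this
  obtain ⟨c₂, g1, g2, g3, g4⟩ := ih (m₁ ++ m₂).length (by subst hn; simp) c₁ h2 (by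
    have e1 : wordVal ([a, linv a] : Word S) = 1 := by
      have : wordInv [a] = [linv a] := rfl
      rw [show [a, linv a] = [a] ++ wordInv [a] from rfl, wordVal_append, wordVal_wordInv,
        mul_inv_cancel]
    have e2 : (m₁ ++ d :: d' :: m₂).map lab = u₁ ++ [a, linv a] ++ u₂ := by
      simp [hm₁, hd, hd', hm₂]
    rw [e2, wordVal_append, wordVal_append, e1, mul_one] at hw
    rw [List.map_append, hm₁, hm₂, wordVal_append, hw]) rfl
  have hnd := h1.1
  refine ⟨c₂, ?_, ?_, ?_, g4⟩
  · intro z hz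
    have : z ∉ m₁ ++ m₂ ++ l ∧ z ∉ d :: d' :: (m₂ ++ l ++ m₁) := by
      simp at hz ⊢; tauto
    rw [g1 z this.1, f1 z this.2]
  · have k : ∀ z, z = d ∨ z = d' → z ∉ m₁ ++ m₂ ++ l := by
      rintro z (rfl | rfl) hz <;> simp at hnd hz <;> tauto
    intro z hz
    by_cases hz1 : z = d ∨ z = d'
    · refine g3 z (k z hz1) ?_
      rcases hz1 with rfl | rfl <;> assumption
    · apply g2
      simp at hz ⊢
      tauto
  · intro z hz hdz
    have : z ∉ m₁ ++ m₂ ++ l ∧ z ∉ d :: d' :: (m₂ ++ l ++ m₁) := by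
      simp at hz ⊢; tauto
    exact g3 z this.1 (f4 z this.2 hdz)

end Moves

end

section

section Filling

variable {S : Type} {P : C6Presentation S} {D : Type} [Fintype D] [DecidableEq D]
  {lab : D → S × Bool} {pos : D → P.Grp}

/-- The face of `d` is labelled by a relator. -/
def Cfg.RelFace (c : Cfg P lab pos) (d : D) : Prop :=
  ∃ l, IsFace c.φ l ∧ d ∈ l ∧ l.map lab ∈ P.rels

/-- The face `l₀` is labelled by `w`, and all other faces are labelled by relators,
except for isolated edges. -/
structure IsFilling (c : Cfg P lab pos) (l₀ : List D) (w : Word S) (g : P.Grp) : Prop where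
  face : IsFace c.φ l₀
  word : l₀.map lab = w
  base : ∀ d ∈ l₀.head?, pos d = g
  rel : ∀ d ∉ l₀, c.Dead d ∨ c.RelFace d

open Classical in
/-- The number of darts on relator faces. -/
noncomputable def Cfg.size (c : Cfg P lab pos) (l₀ : List D) : ℕ :=
  (Finset.univ.filter fun d => d ∉ l₀ ∧ ¬ c.Dead d).card

/-- The word `w` has a filling with `n` darts on relator faces. -/
def FillSize (P : C6Presentation S) (w : Word S) (g : P.Grp) (n : ℕ) : Prop :=
  ∃ (D : Type) (_ : Fintype D) (_ : DecidableEq D) (lab : D → S × Bool) (pos : D → P.Grp)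
    (c : Cfg P lab pos) (l₀ : List D), IsFilling c l₀ w g ∧ c.size l₀ = n

theorem Cfg.RelFace.congr {c c' : Cfg P lab pos} {d : D} (h : c.RelFace d) {l : List D}
    (hl : IsFace c.φ l) (hd : d ∉ l) (hc : ∀ z ∉ l, c'.φ z = c.φ z) : c'.RelFace d := by
  obtain ⟨m, h1, h2, h3⟩ := h
  refine ⟨m, h1.congr fun x hx => hc x fun hx' => hd ?_, h2, h3⟩
  exact (hl.sameCycle hx').1 ((h1.sameCycle hx).2 h2)

theorem Cfg.Dead.congr {c c' : Cfg P lab pos} {d : D} (h : c.Dead d) {l : List D}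
    (hl : IsFace c.φ l) (hd : d ∉ l) (hc : ∀ z ∉ l, c'.φ z = c.φ z) (he : c'.e = c.e) :
    c'.Dead d :=
  h.of_eq (hc d hd) (hc _ fun h' => hd ((h.e_mem hl).1 h')) (by rw [he])

theorem Cfg.exists_filling_aux (L : List (Word S × Word S)) (hL : ∀ x ∈ L, x.2 ∈ P.rels)
    (c : Cfg P lab pos) {l m : List D} (h : IsFace c.φ (l ++ m))
    (hm : m.map lab = (L.map fun x => x.1 ++ x.2 ++ wordInv x.1).flatten)
    (hr : ∀ z ∉ l ++ m, c.Dead z ∨ c.RelFace z) :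
    ∃ c' : Cfg P lab pos, IsFace c'.φ l ∧ ∀ z ∉ l, c'.Dead z ∨ c'.RelFace z := by
  induction L generalizing c m with
  | nil =>
    have : m = [] := by simpa using hm
    subst this
    rw [List.append_nil] at h hr
    exact ⟨c, h, hr⟩
  | cons x L ih =>
    rw [List.map_cons, List.flatten_cons, List.map_eq_append_iff] at hm
    obtain ⟨k, m', rfl, hk, hm'⟩ := hm
    rw [List.map_eq_append_iff] at hk
    obtain ⟨k, k₃, rfl, hk, hk₃⟩ := hk
    rw [List.map_eq_append_iff] at hk
    obtain ⟨k₁, k₂, rfl, hk₁, hk₂⟩ := hk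
    have h1 : IsFace c.φ (k₂ ++ (k₃ ++ m' ++ l ++ k₁)) := by
      have := isFace_append_comm (a := l ++ k₁) (b := k₂ ++ k₃ ++ m') (by simpa using h)
      simpa using this
    obtain ⟨c₁, he₁, f₁, g₁, g₂⟩ := c.exists_split h1
      (by rw [hk₂]; exact elt_rel P (hL x (by simp)))
    have h2 : IsFace c₁.φ (k₁ ++ k₃ ++ (m' ++ l)) := by
      have := isFace_append_comm (a := k₃ ++ m' ++ l) (b := k₁) (by simpa using g₂)
      simpa using this
    obtain ⟨c₂, f₂, d₂, d₂', h3⟩ := c₁.exists_collapse h2 (by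
      rw [List.map_append, hk₁, hk₃, wordVal_append, wordVal_wordInv, mul_inv_cancel])
    refine ih (fun x hx => hL x (by simp [hx])) c₂ (isFace_append_comm h3) hm' ?_
    intro z hz
    have hnd := h1.1
    by_cases hz1 : z ∈ k₁ ++ k₃
    · exact Or.inl (d₂ z hz1)
    by_cases hz2 : z ∈ k₂
    · right
      have : c₁.RelFace z := ⟨k₂, g₁, hz2, by rw [hk₂]; exact hL x (by simp)⟩
      refine this.congr h2 ?_ f₂
      simp at hz1 hz ⊢; tauto
    have hz3 : z ∉ l ++ (k₁ ++ k₂ ++ k₃ ++ m') := by simp at hz hz1 ⊢; tauto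
    have hz4 : z ∉ k₂ ++ (k₃ ++ m' ++ l ++ k₁) := by simp at hz hz1 ⊢; tauto
    have hz5 : z ∉ k₁ ++ k₃ ++ (m' ++ l) := by simp at hz hz1 ⊢; tauto
    rcases hr z hz3 with hd | hd
    · exact Or.inl (d₂' z hz5 (hd.congr h1 hz4 f₁ he₁))
    · exact Or.inr ((hd.congr h1 hz4 f₁).congr h2 hz5 f₂)

end Filling

section Existence

theorem IsFace.map {A B : Type} {φ : Perm A} {ψ : Perm B} {l : List A} (h : IsFace φ l) (f : A → B)
    (hf : Function.Injective f) (hψ : ∀ x, ψ (f x) = f (φ x)) : IsFace ψ (l.map f) := by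
  refine ⟨h.1.map hf, ?_⟩
  rw [← List.map_append, List.isChain_map]
  refine h.2.imp fun a b hab => ?_
  rw [hψ, hab]

theorem IsFace.reverse {A : Type} {φ : Perm A} {l : List A} (h : IsFace φ l) :
    IsFace φ.symm l.reverse := by
  refine ⟨List.nodup_reverse.2 h.1, ?_⟩
  rw [← List.reverse_append, List.isChain_reverse]
  refine h.2.imp fun a b hab => ?_
  rw [← hab, Equiv.symm_apply_apply]

theorem isFace_finRotate (n : ℕ) : IsFace (finRotate (n + 1)) (List.finRange (n + 1)) := by
  rw [List.finRange_succ_last]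
  have h1 : (List.map Fin.castSucc (List.finRange n) ++ [Fin.last n]).IsChain
      fun x y => finRotate (n + 1) x = y := by
    rw [← List.finRange_succ_last, List.isChain_iff_getElem]
    intro i hi
    simp only [List.length_finRange] at hi
    rw [List.getElem_finRange, List.getElem_finRange, finRotate_apply]
    ext
    simp [Fin.val_add, Nat.mod_eq_of_lt hi]
  refine isFace_concat (φ := finRotate (n + 1)) ?_ h1 (fun _ _ => rfl) ?_
  · rw [← List.finRange_succ_last]; exact List.nodup_finRange _
  · intro y hy
    rw [← List.finRange_succ_last, List.finRange_succ] at hy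
    simp only [List.head?_cons, Option.mem_some_iff] at hy
    rw [finRotate_last, hy]

variable {S : Type} {P : C6Presentation S}

theorem elt_take_finRotate {n : ℕ} {W : Word S} (hn : W.length = n + 1) (hW : P.elt W = 1)
    (i : Fin (n + 1)) : P.elt (W.take (finRotate (n + 1) i)) =
      P.elt (W.take i) * P.ltr (W[i]'(by omega)) := by
  have h1 : P.elt (W.take (i + 1)) = P.elt (W.take i) * P.ltr (W[i]'(by omega)) := by
    rw [List.take_succ_eq_append_getElem (by omega), elt_append]
    simp
  rw [← h1]
  rcases eq_or_ne i (Fin.last n) with rfl | hi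
  · rw [finRotate_last]
    simp only [Fin.val_zero, List.take_zero, elt_nil, Fin.val_last]
    rw [← hn, List.take_length, hW]
  · rw [coe_finRotate_of_ne_last hi]

/-- The sphere with two faces labelled by `W` and its inverse. -/
def sphere {n : ℕ} {W : Word S} (hn : W.length = n + 1) (hW : P.elt W = 1) (g : P.Grp) :
    Cfg P (D := Fin (n + 1) ⊕ Fin (n + 1))
      (Sum.elim (fun i => W[i]'(by omega)) fun i => linv (W[i]'(by omega)))
      (Sum.elim (fun i => g * P.elt (W.take i))
        fun i => g * P.elt (W.take (finRotate (n + 1) i))) where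
  φ := Equiv.sumCongr (finRotate (n + 1)) (finRotate (n + 1)).symm
  e := Equiv.sumComm _ _
  e_e d := by rcases d with d | d <;> rfl
  e_ne d := by rcases d with d | d <;> simp
  lab_e d := by rcases d with d | d <;> simp
  pos_e d := by
    rcases d with i | i
    · simp only [Equiv.sumComm_apply, Sum.swap_inl, Sum.elim_inr, Sum.elim_inl]
      rw [elt_take_finRotate hn hW, mul_assoc]
    · simp only [Equiv.sumComm_apply, Sum.swap_inr, Sum.elim_inr, Sum.elim_inl]
      rw [elt_take_finRotate hn hW, ltr_linv, mul_assoc, mul_assoc, mul_inv_cancel, mul_one]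
  pos_φ d := by
    rcases d with i | i
    · simp only [Equiv.sumCongr_apply, Sum.map_inl, Sum.elim_inl]
      rw [elt_take_finRotate hn hW, mul_assoc]
    · simp only [Equiv.sumCongr_apply, Sum.map_inr, Sum.elim_inr,
        Equiv.apply_symm_apply]
      rw [elt_take_finRotate hn hW, ltr_linv, mul_assoc, mul_assoc, mul_inv_cancel, mul_one]
  planar := by
    set φ : Perm (Fin (n + 1) ⊕ Fin (n + 1)) :=
      Equiv.sumCongr (finRotate (n + 1)) (finRotate (n + 1)).symm with hφ
    set e : Perm (Fin (n + 1) ⊕ Fin (n + 1)) := Equiv.sumComm _ _ with he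
    have h1 := card_of_involution (φ * e)
      (by rintro (i | i) <;> simp [hφ, he])
      (by rintro (i | i) <;> simp [hφ, he])
    have h2 : 2 ≤ cyc φ := by
      have h3 : ¬ (Perm.SameCycle.setoid φ) (Sum.inl 0) (Sum.inr 0) := by
        intro h
        have := SameCycle.invariant (A := {x | x.isLeft}) (by rintro (i | i) <;> simp [hφ]) h (by simp)
        simp at this
      have h4 := numClasses_lt (s := ⊤) le_top h3 trivial
      have h5 : 0 < numClasses (⊤ : Setoid (Fin (n + 1) ⊕ Fin (n + 1))) :=
        Nat.card_pos_iff.2 ⟨⟨Quotient.mk _ (Sum.inl 0)⟩, inferInstance⟩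
      unfold cyc
      omega
    have h6 : numClasses (conn φ e) ≤ 1 := by
      have key : ∀ x, conn φ e (Sum.inl 0) x := by
        have k1 : ∀ i : ℕ, ∀ hi : i < n + 1, conn φ e (Sum.inl 0) (Sum.inl ⟨i, hi⟩) := by
          intro i
          induction i with
          | zero => intro hi; exact Setoid.refl' _ _
          | succ i ih =>
            intro hi
            refine Setoid.trans' _ (ih (by omega)) ?_
            have := conn_left φ e (Sum.inl ⟨i, by omega⟩)
            have h7 : φ (Sum.inl ⟨i, by omega⟩) = Sum.inl ⟨i + 1, hi⟩ := by
              rw [hφ]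
              simp only [Equiv.sumCongr_apply, Sum.map_inl, Sum.inl.injEq]
              rw [finRotate_of_lt (by omega)]
            rwa [h7] at this
        rintro (i | i)
        · exact k1 i i.2
        · exact Setoid.trans' _ (k1 i i.2) (conn_right φ e (Sum.inl i))
      have : Subsingleton (Quotient (conn φ e)) := by
        constructor
        intro a b
        induction a using Quotient.inductionOn with
        | h x =>
          induction b using Quotient.inductionOn with
          | h y => exact Quotient.sound (Setoid.trans' _ (Setoid.symm' _ (key x)) (key y))
      exact Finite.card_le_one_iff_subsingleton.2 this
    unfold Planar
    omega

theorem exists_filling {w : Word S} (hw : w ≠ []) (h : P.elt w = 1) (g : P.Grp) :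
    ∃ n, FillSize P w g n := by
  obtain ⟨L, hL, hW⟩ := exists_conjugates P h
  set W := w ++ (L.map fun x => x.1 ++ x.2 ++ wordInv x.1).flatten with hWdef
  obtain ⟨n, hn⟩ : ∃ n, W.length = n + 1 := by
    refine Nat.exists_eq_succ_of_ne_zero ?_
    rw [hWdef, List.length_append]
    have := List.length_pos_iff.2 hw
    omega
  set lab : Fin (n + 1) ⊕ Fin (n + 1) → S × Bool :=
    Sum.elim (fun i => W[i]'(by omega)) fun i => linv (W[i]'(by omega)) with hlab
  obtain ⟨c, hc⟩ : ∃ c : Cfg P lab _, c = sphere hn (elt_eq_one_of_wordVal P hW) g := ⟨_, rfl⟩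
  have hf1 : IsFace c.φ ((List.finRange (n + 1)).map Sum.inl) :=
    (isFace_finRotate n).map _ Sum.inl_injective fun x => by simp [hc, sphere]
  have hf2 : IsFace c.φ ((List.finRange (n + 1)).reverse.map Sum.inr) :=
    (isFace_finRotate n).reverse.map _ Sum.inr_injective fun x => by simp [hc, sphere]
  have hl1 : ((List.finRange (n + 1)).map Sum.inl).map lab = W := by
    apply List.ext_getElem
    · simp [hn]
    · intro i h1 h2
      simp [hlab]
  have hl2 : ((List.finRange (n + 1)).reverse.map Sum.inr).map lab = wordInv W := by
    rw [wordInv_eq_reverse_map, ← hl1]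
    simp [hlab, Function.comp_def]
  obtain ⟨c₁, f₁, d₁, -, -⟩ := c.exists_collapse (lz := (List.finRange (n + 1)).reverse.map Sum.inr)
    (l := []) (by simpa using hf2) (by rw [hl2, wordVal_wordInv, hW, inv_one])
  have hf3 : IsFace c₁.φ ((List.finRange (n + 1)).map Sum.inl) :=
    hf1.congr fun x hx => f₁ x fun h' => by
      simp only [List.append_nil, List.mem_map] at hx h'
      obtain ⟨a, _, rfl⟩ := hx
      obtain ⟨b, _, hb⟩ := h'
      cases hb
  have hl1' := hl1
  rw [hWdef, List.map_eq_append_iff] at hl1'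
  obtain ⟨l, m, hlm, hl, hm⟩ := hl1'
  rw [hlm] at hf3
  obtain ⟨c₂, hf4, hr⟩ := Cfg.exists_filling_aux L hL c₁ hf3 hm (by
    intro z hz
    rw [← hlm] at hz
    refine Or.inl (d₁ z ?_)
    rcases z with z | z
    · simp at hz
    · simp)
  refine ⟨_, Fin (n + 1) ⊕ Fin (n + 1), inferInstance, inferInstance, lab, _, c₂, l,
    ⟨hf4, hl, ?_, hr⟩, rfl⟩
  intro d hd
  have : d = Sum.inl 0 := by
    cases l with
    | nil => simp at hd
    | cons x l =>
      simp only [List.head?_cons, Option.mem_some_iff] at hd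
      rw [List.finRange_succ, List.map_cons, List.cons_append] at hlm
      rw [← hd]
      exact (List.cons.inj hlm).1.symm
  subst this
  simp

end Existence

end

section

section Words

variable {S : Type}

theorem not_reduced_linv {u v : Word S} {a : S × Bool} : ¬ Reduced (u ++ a :: linv a :: v) := by
  intro h
  have h1 := (List.isChain_append.1 h).2.1
  rw [List.isChain_cons_cons] at h1
  rcases h1.1 with h2 | h2
  · exact h2 rfl
  · simp [linv] at h2

theorem eq_nil_of_eq_wordInv {u : Word S} (hu : Reduced u) (h : u = wordInv u) : u = [] := by
  by_contra hne
  have hlen := List.length_pos_iff.2 hne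
  have key : ∀ j (hj : j < u.length), u[j] = linv (u[u.length - 1 - j]'(by omega)) := by
    intro j hj
    have h1 : u[j] = (wordInv u)[j]'(by simpa using hj) := by congr 1
    rw [h1]
    simp [wordInv_eq_reverse_map]
  rcases Nat.even_or_odd' u.length with ⟨k, hk | hk⟩
  · have h1 := key (k - 1) (by omega)
    have h2 := (List.isChain_iff_getElem.1 hu) (k - 1) (by omega)
    have h3 : u.length - 1 - (k - 1) = k - 1 + 1 := by omega
    simp only [h3] at h1
    rw [h1] at h2
    rcases h2 with h2 | h2
    · exact h2 rfl
    · simp [linv] at h2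
  · have h1 := key k (by omega)
    have h3 : u.length - 1 - k = k := by omega
    simp only [h3] at h1
    exact linv_ne _ h1.symm

theorem ne_wordInv_rotate {r : Word S} (hr : CyclicallyReduced r) (hne : r ≠ []) (i : ℕ) :
    r ≠ wordInv (r.rotate i) := by
  intro h
  rw [← List.rotate_mod] at h
  have hlt := Nat.mod_lt i (List.length_pos_iff.2 hne)
  set j := i % r.length with hj
  rw [List.rotate_eq_drop_append_take hlt.le, wordInv_append] at h
  have hr' : Reduced r := (List.isChain_append.1 hr).1
  have h1 : r.take j ++ r.drop j = wordInv (r.take j) ++ wordInv (r.drop j) := by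
    rw [List.take_append_drop]; exact h
  have h2 := List.append_inj h1 (by simp)
  have hr2 : Reduced (r.take j ++ r.drop j) := by rwa [List.take_append_drop]
  have h3 := eq_nil_of_eq_wordInv (List.isChain_append.1 hr2).1 h2.1
  have h4 := eq_nil_of_eq_wordInv (List.isChain_append.1 hr2).2.1 h2.2
  apply hne
  rw [← List.take_append_drop j r, h3, h4]
  rfl

end Words

section Merge

variable {S : Type} {P : C6Presentation S} {D : Type} [Fintype D] [DecidableEq D]
  {lab : D → S × Bool} {pos : D → P.Grp}

namespace Cfg

variable (c : Cfg P lab pos)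

/-- The vertex permutation. -/
def σ : Perm D := c.φ * c.e

theorem σ_apply (d : D) : c.σ d = c.φ (c.e d) := rfl

theorem pos_σ (d : D) : pos (c.σ d) = pos d := by
  rw [σ_apply, c.pos_φ, c.lab_e, ltr_linv, c.pos_e, mul_inv_cancel_right]

variable {c}

theorem pos_eq_of_sameCycle {x y : D} (h : c.σ.SameCycle x y) : pos x = pos y :=
  SameCycle.invariant (A := {z | pos x = pos z}) (fun z hz => by
    show pos x = pos (c.σ z)
    rw [c.pos_σ]; exact hz) h rfl

variable (c)

theorem chain_of_concat {φ ψ : Perm D} {l : List D} {a : D}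
    (h2 : (l ++ [a]).IsChain fun x y => φ x = y) (h3 : ∀ x ∈ l, ψ x = φ x) :
    (l ++ [a]).IsChain fun x y => ψ x = y := by
  rw [List.isChain_append] at h2 ⊢
  refine ⟨?_, by simp, ?_⟩
  · refine List.IsChain.imp_of_mem_imp ?_ h2.1
    intro x y hx _ hxy
    rw [h3 x hx, hxy]
  · intro x hx y hy
    rw [h3 x (List.mem_of_mem_getLast? hx), h2.2.2 x hx y hy]

/-- Two faces with a common vertex can be merged. -/
theorem exists_merge {l₁ l₂ : List D} (h₁ : IsFace c.φ l₁) (h₂ : IsFace c.φ l₂)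
    (hd : l₁.Disjoint l₂) {x y : D} (hx : x ∈ l₁.head?) (hy : y ∈ l₂.head?)
    (hxy : c.σ.SameCycle x y) : ∃ c' : Cfg P lab pos, c'.e = c.e ∧
      (∀ z ∉ l₁ ++ l₂, c'.φ z = c.φ z) ∧ IsFace c'.φ (l₁ ++ l₂) := by
  rcases List.eq_nil_or_concat' l₁ with rfl | ⟨l₁, a, rfl⟩
  · simp at hx
  rcases List.eq_nil_or_concat' l₂ with rfl | ⟨l₂, b, rfl⟩
  · simp at hy
  have ha : c.φ a = x := (List.isChain_append.1 h₁.2).2.2 a (by simp) x hx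
  have hb : c.φ b = y := (List.isChain_append.1 h₂.2).2.2 b (by simp) y hy
  have hab : a ≠ b := fun h => @hd a (by simp) (by simp [h])
  have hnd1 := List.nodup_append.1 h₁.1
  have hnd2 := List.nodup_append.1 h₂.1
  have hsc : (c.φ * c.e).SameCycle (c.e a) (c.e b) := by
    have k1 : c.σ.SameCycle (c.e a) x := by
      rw [← ha]
      have := Perm.sameCycle_apply_right.2 (Perm.SameCycle.refl c.σ (c.e a))
      rwa [σ_apply, c.e_e] at this
    have k2 : c.σ.SameCycle (c.e b) y := by
      rw [← hb]
      have := Perm.sameCycle_apply_right.2 (Perm.SameCycle.refl c.σ (c.e b))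
      rwa [σ_apply, c.e_e] at this
    exact (k1.trans hxy).trans k2.symm
  have key : ∀ z, z ≠ a → z ≠ b → (c.φ * swap a b) z = c.φ z := fun z h1 h2 => by
    rw [Perm.mul_apply, swap_apply_of_ne_of_ne h1 h2]
  refine ⟨c.swapMove a b hab ?_ (Or.inr hsc), rfl, ?_, ?_⟩
  · rw [ha, hb, pos_eq_of_sameCycle hxy]
  · intro z hz
    simp only [List.mem_append, List.mem_singleton, not_or] at hz
    exact key z hz.1.2 hz.2.2
  · change IsFace (c.φ * swap a b) _
    rw [← List.append_assoc]
    have c1 : (l₁ ++ [a]).IsChain fun x y => (c.φ * swap a b) x = y :=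
      chain_of_concat (List.isChain_append.1 h₁.2).1 fun z hz =>
        key z (hnd1.2.2 z hz a (by simp)) fun h => @hd z (by simp [hz]) (by simp [h])
    have c2 : (l₂ ++ [b]).IsChain fun x y => (c.φ * swap a b) x = y :=
      chain_of_concat (List.isChain_append.1 h₂.2).1 fun z hz =>
        key z (fun h => @hd z (by simp [h]) (by simp [hz])) (hnd2.2.2 z hz b (by simp))
    refine isFace_concat (φ := c.φ * swap a b) ?_ ?_ (fun _ _ => rfl) ?_
    · rw [List.append_assoc]
      exact List.nodup_append.2 ⟨h₁.1, h₂.1, fun u hu v hv huv => hd hu (huv ▸ hv)⟩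
    · rw [List.append_assoc]
      refine List.isChain_append.2 ⟨c1, c2, ?_⟩
      intro u hu v hv
      rw [List.getLast?_concat, Option.mem_some_iff] at hu
      rw [← hu, Perm.mul_apply, swap_apply_left, hb]
      exact Option.mem_unique hy hv
    · intro v hv
      rw [List.append_assoc, List.head?_append_of_ne_nil _ (by simp)] at hv
      rw [Perm.mul_apply, swap_apply_right, ha]
      exact Option.mem_unique hx hv

end Cfg

theorem Cfg.size_lt {c c' : Cfg P lab pos} {l₀ l₀' : List D}
    (h : ∀ z ∉ l₀', ¬ c'.Dead z → z ∉ l₀ ∧ ¬ c.Dead z) {x : D} (hx : x ∉ l₀ ∧ ¬ c.Dead x)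
    (hx' : x ∉ l₀' → c'.Dead x) : c'.size l₀' < c.size l₀ := by
  classical
  refine Finset.card_lt_card ⟨fun z hz => ?_, fun hs => ?_⟩
  · simp only [Finset.mem_filter, Finset.mem_univ, true_and] at hz ⊢
    exact h z hz.1 hz.2
  · have := @hs x (by simpa using hx)
    simp only [Finset.mem_filter, Finset.mem_univ, true_and] at this
    exact this.2 (hx' this.1)

/-- Two relator faces with a common vertex and inverse boundary words cancel. -/
theorem IsFilling.exists_cancel {c : Cfg P lab pos} {l₀ : List D} {w : Word S} {g : P.Grp}
    (hF : IsFilling c l₀ w g) {l₁ l₂ : List D} (h₁ : IsFace c.φ l₁) (h₂ : IsFace c.φ l₂)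
    (hd : l₁.Disjoint l₂) {x y : D} (hx : x ∈ l₁.head?) (hy : y ∈ l₂.head?)
    (hxy : c.σ.SameCycle x y) (hd₁ : l₀.Disjoint l₁) (hd₂ : l₀.Disjoint l₂)
    (hx' : ¬ c.Dead x)
    (hw : wordVal ((l₁ ++ l₂).map lab) = 1) : ∃ m < c.size l₀, FillSize P w g m := by
  obtain ⟨c₁, he, f₁, hf⟩ := c.exists_merge h₁ h₂ hd hx hy hxy
  obtain ⟨c₂, f₂, d₂, d₂', -⟩ := c₁.exists_collapse (l := []) (by simpa using hf) hw
  simp only [List.append_nil] at f₂ d₂'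
  have fr : ∀ z ∉ l₁ ++ l₂, c₂.φ z = c.φ z := fun z hz => by rw [f₂ z hz, f₁ z hz]
  have hdisj : ∀ z ∈ l₀, z ∉ l₁ ++ l₂ := fun z hz hz' => by
    rcases List.mem_append.1 hz' with h | h
    exacts [hd₁ hz h, hd₂ hz h]
  have hxm := List.mem_of_mem_head? hx
  have hdead : ∀ z ∉ l₁ ++ l₂, c.Dead z → c₂.Dead z := fun z hz hzd => by
    refine d₂' z hz (hzd.of_eq (f₁ z hz) (f₁ _ fun h => hz ?_) (by rw [he]))
    rcases List.mem_append.1 h with h | h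
    · exact List.mem_append_left _ ((hzd.e_mem h₁).1 h)
    · exact List.mem_append_right _ ((hzd.e_mem h₂).1 h)
  refine ⟨c₂.size l₀, ?_, D, inferInstance, inferInstance, lab, pos, c₂, l₀,
    ⟨hF.face.congr fun z hz => fr z (hdisj z hz), hF.word, hF.base, ?_⟩, rfl⟩
  · refine Cfg.size_lt ?_ ⟨fun h => hd₁ h hxm, hx'⟩
      fun _ => d₂ x (List.mem_append_left _ hxm)
    intro z hz hzd
    refine ⟨hz, fun hzd' => hzd ?_⟩
    by_cases hz1 : z ∈ l₁ ++ l₂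
    · exact d₂ z hz1
    · exact hdead z hz1 hzd'
  · intro z hz
    by_cases hz1 : z ∈ l₁ ++ l₂
    · exact Or.inl (d₂ z hz1)
    · rcases hF.rel z hz with h | ⟨m, m1, m2, m3⟩
      · exact Or.inl (hdead z hz1 h)
      · refine Or.inr ⟨m, m1.congr fun u hu => fr u fun hu' => hz1 ?_, m2, m3⟩
        rcases List.mem_append.1 hu' with h | h
        · exact List.mem_append_left _ ((h₁.sameCycle h).1 ((m1.sameCycle hu).2 m2))
        · exact List.mem_append_right _ ((h₂.sameCycle h).1 ((m1.sameCycle hu).2 m2))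

end Merge

end

section

section Indicator

open Classical in
/-- The indicator of a proposition. -/
noncomputable def ind (p : Prop) : ℚ := if p then 1 else 0

theorem ind_true {p : Prop} (h : p) : ind p = 1 := if_pos h

theorem ind_false {p : Prop} (h : ¬ p) : ind p = 0 := if_neg h

theorem ind_nonneg (p : Prop) : 0 ≤ ind p := by unfold ind; split <;> norm_num

theorem ind_le_one (p : Prop) : ind p ≤ 1 := by unfold ind; split <;> norm_num

theorem ind_congr {p q : Prop} (h : p ↔ q) : ind p = ind q := by rw [propext h]

theorem ind_mono {p q : Prop} (h : p → q) : ind p ≤ ind q := by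
  by_cases hp : p
  · rw [ind_true hp, ind_true (h hp)]
  · rw [ind_false hp]; exact ind_nonneg q

open Classical in
theorem sum_ind {D : Type*} (s : Finset D) (p : D → Prop) :
    ∑ d ∈ s, ind (p d) = ((s.filter p).card : ℚ) := by
  simp [ind]

theorem sum_ind_div_per {D : Type} [Fintype D] (φ : Perm D) (s : D → Prop) (f : D → ℚ)
    (hs : ∀ x, s x → s (φ x)) :
    ∑ d, ind (s d) * f d = ∑ d, ind (s d) * ((∑ x ∈ cycleOf φ d, f x) / per φ d) := by
  classical
  have h : ∀ g : D → ℚ, ∑ d, ind (s d) * g d = ∑ d with s d, g d := by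
    intro g
    rw [Finset.sum_filter]
    refine Finset.sum_congr rfl fun d _ => ?_
    by_cases hd : s d
    · rw [ind_true hd, if_pos hd, one_mul]
    · rw [ind_false hd, if_neg hd, zero_mul]
  rw [h, h, sum_div_per φ s f hs]

end Indicator

/-- A reduced diagram on the sphere: the outer face `O`, inner faces `I` satisfying the small
cancellation condition, and isolated edges. -/
structure Diagram (D : Type) [Fintype D] where
  φ : Perm D
  e : Perm D
  e_e : ∀ d, e (e d) = d
  e_ne : ∀ d, e d ≠ d
  planar : Planar φ e
  O : D → Prop
  I : D → Prop
  not_I : ∀ d, O d → ¬ I d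
  O_φ : ∀ d, O (φ d) ↔ O d
  I_φ : ∀ d, I (φ d) ↔ I d
  dead : ∀ d, ¬ O d → ¬ I d → φ d = e d ∧ φ (e d) = d
  O_cycle : ∀ x y, O x → O y → φ.SameCycle x y
  O_ne : ∃ x, O x
  two_le_deg : ∀ d, I d → 2 ≤ per (φ * e) d
  piece : ∀ d L, I d → I (e d) → 1 ≤ L → L ≤ per φ d →
    (∀ j, 1 ≤ j → j < L → per (φ * e) (φ^[j] d) = 2) → 6 * L < per φ d

namespace Diagram

variable {D : Type} [Fintype D] (M : Diagram D)

/-- The vertex permutation. -/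
def σ : Perm D := M.φ * M.e

/-- The degree of the initial vertex of a dart. -/
noncomputable def deg (d : D) : ℕ := per M.σ d

/-- The length of the face of a dart. -/
noncomputable def len (d : D) : ℕ := per M.φ d

theorem σ_apply (d : D) : M.σ d = M.φ (M.e d) := rfl

theorem σ_symm_apply (d : D) : M.σ.symm d = M.e (M.φ.symm d) := by
  rw [Equiv.symm_apply_eq, σ_apply, M.e_e, Equiv.apply_symm_apply]

theorem deg_pos (d : D) : 0 < M.deg d := per_pos _ _

theorem len_pos (d : D) : 0 < M.len d := per_pos _ _

theorem O_iter (d : D) (n : ℕ) : M.O (M.φ^[n] d) ↔ M.O d := by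
  induction n with
  | zero => rfl
  | succ n ih => rw [Function.iterate_succ_apply', M.O_φ, ih]

theorem I_iter (d : D) (n : ℕ) : M.I (M.φ^[n] d) ↔ M.I d := by
  induction n with
  | zero => rfl
  | succ n ih => rw [Function.iterate_succ_apply', M.I_φ, ih]

theorem live_e {d : D} (h : M.O d ∨ M.I d) : M.O (M.e d) ∨ M.I (M.e d) := by
  by_contra hc
  push Not at hc
  have h1 := (M.dead _ hc.1 hc.2).1
  rw [M.e_e] at h1
  have h2 := M.O_φ (M.e d)
  have h3 := M.I_φ (M.e d)
  rw [h1] at h2 h3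
  exact h.elim (fun h => hc.1 (h2.1 h)) fun h => hc.2 (h3.1 h)

theorem I_e_iff {d : D} (h : M.I d) : M.I (M.e d) ↔ ¬ M.O (M.e d) :=
  ⟨fun h1 h2 => M.not_I _ h2 h1, fun h1 => (M.live_e (Or.inr h)).resolve_left h1⟩

theorem φ_e_of_deg {d : D} (h : M.deg (M.φ d) = 2) : M.φ (M.e (M.φ d)) = M.e d := by
  have h1 := iterate_per M.σ (M.e d)
  have h2 : M.deg (M.e d) = 2 := by
    rw [← h]
    have := per_apply M.σ (M.e d)
    rw [σ_apply, M.e_e] at this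
    exact this.symm
  change M.σ^[M.deg (M.e d)] _ = _ at h1
  rw [h2] at h1
  simpa [σ_apply, M.e_e] using h1

theorem O_e_φ {d : D} (h : M.deg (M.φ d) = 2) : M.O (M.e (M.φ d)) ↔ M.O (M.e d) := by
  rw [← M.O_φ, M.φ_e_of_deg h]

theorem deg_dead {d : D} (h1 : ¬ M.O d) (h2 : ¬ M.I d) : M.deg d = 1 :=
  Function.minimalPeriod_eq_one_iff_isFixedPt.2 (M.dead d h1 h2).2

theorem len_dead {d : D} (h1 : ¬ M.O d) (h2 : ¬ M.I d) : M.len d = 2 := by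
  have h := M.dead d h1 h2
  have h3 : M.len d ∣ 2 := Function.IsPeriodicPt.minimalPeriod_dvd (f := M.φ) (x := d) (by
    change M.φ (M.φ d) = d
    rw [h.1, h.2])
  rcases (Nat.dvd_prime Nat.prime_two).1 h3 with h4 | h4
  · exfalso
    refine M.e_ne d ?_
    rw [← h.1]
    exact Function.minimalPeriod_eq_one_iff_isFixedPt.1 h4
  · exact h4

theorem numClasses_ge : 2 + ∑ d, ind (¬ M.O d ∧ ¬ M.I d) ≤ 2 * (numClasses (conn M.φ M.e) : ℚ) := by
  classical
  let X := {d : D // ¬ M.O d ∧ ¬ M.I d}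
  have hX : ∀ d : D, (¬ M.O d ∧ ¬ M.I d) ↔ (¬ M.O (M.e d) ∧ ¬ M.I (M.e d)) := by
    intro d
    have h1 := M.live_e (d := d)
    have h2 := M.live_e (d := M.e d)
    rw [M.e_e] at h2
    tauto
  let ε : Perm X := M.e.subtypePerm fun d => (hX d).symm
  have hε : ∀ x : X, (ε x : D) = M.e x := fun x => rfl
  have hcard : Fintype.card X = 2 * cyc ε := card_of_involution ε
    (fun x => Subtype.ext (by rw [hε, hε, M.e_e]))
    fun x h => M.e_ne x (by rw [← hε, h])
  have hsum : ∑ d, ind (¬ M.O d ∧ ¬ M.I d) = (Fintype.card X : ℚ) := by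
    rw [sum_ind, Fintype.card_subtype]
    congr!
  let f : D → Option (Quotient (Perm.SameCycle.setoid ε)) := fun d =>
    if h : ¬ M.O d ∧ ¬ M.I d then some ⟦⟨d, h⟩⟧ else none
  have hf : ∀ d, f d = f (M.e d) := by
    intro d
    by_cases h : ¬ M.O d ∧ ¬ M.I d
    · have h' := (hX d).1 h
      simp only [f, dif_pos h, dif_pos h', Option.some.injEq]
      refine Quotient.sound ?_
      have : (⟨M.e d, h'⟩ : X) = ε ⟨d, h⟩ := rfl
      rw [this]
      exact Perm.sameCycle_apply_right.2 (Perm.SameCycle.refl _ _)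
    · simp only [f, dif_neg h, dif_neg (mt (hX d).2 h)]
  have hf' : ∀ d, f d = f (M.φ d) := by
    intro d
    by_cases h : ¬ M.O d ∧ ¬ M.I d
    · rw [(M.dead d h.1 h.2).1, hf]
    · have h' : ¬ (¬ M.O (M.φ d) ∧ ¬ M.I (M.φ d)) := by rwa [M.O_φ, M.I_φ]
      simp only [f, dif_neg h, dif_neg h']
  have hle : conn M.φ M.e ≤ Setoid.ker f := conn_le hf' hf
  let F : Quotient (conn M.φ M.e) → Option (Quotient (Perm.SameCycle.setoid ε)) :=
    Quotient.lift f fun a b h => hle h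
  have hF : Function.Surjective F := by
    intro y
    cases y with
    | none =>
      obtain ⟨x, hx⟩ := M.O_ne
      exact ⟨⟦x⟧, by change f x = none; simp [f, hx]⟩
    | some y =>
      induction y using Quotient.inductionOn with
      | h x => exact ⟨⟦x.1⟧, by exact (dif_pos x.2).trans rfl⟩
  have key := Nat.card_le_card_of_surjective F hF
  rw [Finite.card_option] at key
  change cyc ε + 1 ≤ numClasses _ at key
  rw [hsum, hcard]
  have : (cyc ε : ℚ) + 1 ≤ numClasses (conn M.φ M.e) := by exact_mod_cast key
  push_cast
  linarith

theorem sum_outer : ∑ d, ind (M.O d) * (1 / M.len d : ℚ) = 1 := by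
  classical
  obtain ⟨x, hx⟩ := M.O_ne
  have h1 : ∀ d, M.O d ↔ d ∈ cycleOf M.φ x := by
    intro d
    rw [mem_cycleOf]
    refine ⟨M.O_cycle x d hx, fun h => ?_⟩
    exact SameCycle.invariant (A := {z | M.O z}) (fun z hz => (M.O_φ z).2 hz) h hx
  have h2 : ∀ d, ind (M.O d) * (1 / M.len d : ℚ) =
      if d ∈ cycleOf M.φ x then (1 / M.len x : ℚ) else 0 := by
    intro d
    by_cases h : M.O d
    · rw [ind_true h, if_pos ((h1 d).1 h), one_mul]
      unfold len
      rw [per_eq_of_sameCycle (M.O_cycle x d hx h)]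
    · rw [ind_false h, if_neg (mt (h1 d).2 h), zero_mul]
  rw [Finset.sum_congr rfl fun d _ => h2 d, ← Finset.sum_filter]
  simp only [Finset.filter_mem_eq_inter, Finset.univ_inter, Finset.sum_const, card_cycleOf,
    nsmul_eq_mul]
  have : (0 : ℚ) < per M.φ x := by exact_mod_cast per_pos M.φ x
  unfold len
  field_simp

/-- The angular excess at a corner. -/
noncomputable def ω (d : D) : ℚ := 3 - 6 / M.deg d

theorem curvature : 6 + ∑ d, ind (M.O d) * M.ω d ≤ ∑ d, ind (M.I d) * (6 / M.len d - M.ω d) := by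
  have h1 : (Fintype.card D : ℚ) + 4 * numClasses (conn M.φ M.e) ≤
      2 * (cyc M.φ + cyc (M.φ * M.e)) := by exact_mod_cast M.planar
  have h2 := M.numClasses_ge
  rw [← sum_inv_per, ← sum_inv_per] at h1
  have h3 : (Fintype.card D : ℚ) = ∑ _d : D, (1 : ℚ) := by simp
  have h4 := M.sum_outer
  have h5 : ∀ d, 3 * (2 * (1 / per M.φ d : ℚ) + 2 * (1 / per (M.φ * M.e) d) - 1) =
      ind (M.I d) * (6 / M.len d - M.ω d) - ind (M.O d) * M.ω d +
      6 * (ind (M.O d) * (1 / M.len d)) + 6 * ind (¬ M.O d ∧ ¬ M.I d) := by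
    intro d
    change 3 * (2 * (1 / M.len d : ℚ) + 2 * (1 / M.deg d) - 1) = _
    by_cases hO : M.O d
    · rw [ind_true hO, ind_false (M.not_I d hO), ind_false (p := _ ∧ _) (by tauto), ω]
      ring
    by_cases hI : M.I d
    · rw [ind_false hO, ind_true hI, ind_false (p := _ ∧ _) (by tauto), ω]
      ring
    · rw [ind_false hO, ind_false hI, ind_true (p := _ ∧ _) ⟨hO, hI⟩, M.deg_dead hO hI,
        M.len_dead hO hI]
      norm_num
  have h6 := Finset.sum_congr rfl fun d (_ : d ∈ Finset.univ) => h5 d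
  rw [← Finset.mul_sum, Finset.sum_sub_distrib, Finset.sum_add_distrib, ← Finset.mul_sum,
    ← Finset.mul_sum, Finset.sum_add_distrib, Finset.sum_add_distrib, Finset.sum_sub_distrib,
    ← Finset.mul_sum, ← Finset.mul_sum, h4, ← h3] at h6
  linarith

end Diagram

end

section

namespace Diagram

variable {D : Type} [Fintype D] (M : Diagram D)

/-- The portion of the excess of an outer corner transferred to each of its inner neighbours. -/
noncomputable def share (o : D) : ℚ := ind (M.O o) / (ind (M.I (M.σ o)) + ind (M.I (M.σ.symm o)))

/-- The excess of an inner corner after the transfer. -/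
noncomputable def τ (d : D) : ℚ := M.ω d * (1 + M.share (M.σ d) + M.share (M.σ.symm d))

/-- The curvature of the face of a dart after the transfer. -/
noncomputable def κ (d : D) : ℚ := 6 - ∑ x ∈ cycleOf M.φ d, M.τ x

theorem deg_σ (d : D) : M.deg (M.σ d) = M.deg d := per_apply _ _

theorem deg_σ_symm (d : D) : M.deg (M.σ.symm d) = M.deg d := by
  rw [← deg_σ, Equiv.apply_symm_apply]

theorem ω_σ (d : D) : M.ω (M.σ d) = M.ω d := by rw [ω, deg_σ, ω]

theorem ω_σ_symm (d : D) : M.ω (M.σ.symm d) = M.ω d := by rw [ω, deg_σ_symm, ω]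

theorem O_σ (d : D) : M.O (M.σ d) ↔ M.O (M.e d) := M.O_φ _

theorem O_σ_symm (d : D) : M.O (M.σ.symm d) ↔ M.O (M.e (M.φ.symm d)) := by rw [σ_symm_apply]

theorem ω_nonneg {d : D} (h : 2 ≤ M.deg d) : 0 ≤ M.ω d := by
  have : (2 : ℚ) ≤ M.deg d := by exact_mod_cast h
  have h2 : 6 / (M.deg d : ℚ) ≤ 3 := by rw [div_le_iff₀ (by linarith)]; linarith
  unfold ω
  linarith

theorem one_le_ω {d : D} (h : 3 ≤ M.deg d) : 1 ≤ M.ω d := by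
  have : (3 : ℚ) ≤ M.deg d := by exact_mod_cast h
  have h2 : 6 / (M.deg d : ℚ) ≤ 2 := by rw [div_le_iff₀ (by linarith)]; linarith
  unfold ω
  linarith

theorem three_halves_le_ω {d : D} (h : 4 ≤ M.deg d) : 3 / 2 ≤ M.ω d := by
  have : (4 : ℚ) ≤ M.deg d := by exact_mod_cast h
  have h2 : 6 / (M.deg d : ℚ) ≤ 3 / 2 := by rw [div_le_iff₀ (by linarith)]; linarith
  unfold ω
  linarith

theorem share_nonneg (d : D) : 0 ≤ M.share d :=
  div_nonneg (ind_nonneg _) (add_nonneg (ind_nonneg _) (ind_nonneg _))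

theorem half_le_share {o : D} (h : M.O o) (h' : M.I (M.σ o) ∨ M.I (M.σ.symm o)) :
    1 / 2 ≤ M.share o := by
  unfold share
  rw [ind_true h]
  have h1 := ind_le_one (M.I (M.σ o))
  have h2 := ind_le_one (M.I (M.σ.symm o))
  have h3 := ind_nonneg (M.I (M.σ o))
  have h4 := ind_nonneg (M.I (M.σ.symm o))
  have h5 : 0 < ind (M.I (M.σ o)) + ind (M.I (M.σ.symm o)) := by
    rcases h' with h' | h'
    · rw [ind_true h']; linarith
    · rw [ind_true h']; linarith
  rw [le_div_iff₀ h5]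
  linarith

theorem sum_τ_le : ∑ d, ind (M.I d) * M.τ d ≤ ∑ d, ind (M.I d) * M.ω d +
    ∑ d, ind (M.O d) * M.ω d + 3 * ∑ d, ind (M.O d ∧ M.deg d = 1) := by
  have h1 : ∑ d, ind (M.I d) * (M.ω d * M.share (M.σ d)) =
      ∑ d, ind (M.I (M.σ.symm d)) * (M.ω d * M.share d) := by
    rw [← Equiv.sum_comp M.σ fun d => ind (M.I (M.σ.symm d)) * (M.ω d * M.share d)]
    exact Finset.sum_congr rfl fun d _ => by rw [Equiv.symm_apply_apply, ω_σ]
  have h2 : ∑ d, ind (M.I d) * (M.ω d * M.share (M.σ.symm d)) =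
      ∑ d, ind (M.I (M.σ d)) * (M.ω d * M.share d) := by
    rw [← Equiv.sum_comp M.σ.symm fun d => ind (M.I (M.σ d)) * (M.ω d * M.share d)]
    exact Finset.sum_congr rfl fun d _ => by rw [Equiv.apply_symm_apply, ω_σ_symm]
  have h3 : ∀ d, ind (M.I (M.σ.symm d)) * (M.ω d * M.share d) +
      ind (M.I (M.σ d)) * (M.ω d * M.share d) ≤
      ind (M.O d) * M.ω d + 3 * ind (M.O d ∧ M.deg d = 1) := by
    intro d
    by_cases hO : M.O d
    · by_cases hd : M.deg d = 1
      · have hf : M.σ d = d := Function.minimalPeriod_eq_one_iff_isFixedPt.1 hd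
        have hf' : M.σ.symm d = d := by rw [Equiv.symm_apply_eq, hf]
        rw [hf, hf', ind_false (M.not_I d hO), ind_true hO, ind_true ⟨hO, hd⟩, ω, hd]
        norm_num
      · have hd2 : 2 ≤ M.deg d := by have := M.deg_pos d; omega
        have hω := M.ω_nonneg hd2
        rw [ind_false (p := _ ∧ _) (by tauto), share, ind_true hO]
        set s := ind (M.I (M.σ d)) + ind (M.I (M.σ.symm d)) with hs
        have : s * (1 / s) ≤ 1 := by
          rcases eq_or_ne s 0 with h | h
          · rw [h]; norm_num
          · rw [mul_one_div_cancel h]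
        calc _ = M.ω d * (s * (1 / s)) := by rw [hs]; ring
          _ ≤ M.ω d * 1 := mul_le_mul_of_nonneg_left this hω
          _ = _ := by ring
    · rw [share, ind_false hO, ind_false (p := _ ∧ _) (by tauto)]
      simp
  have h4 := Finset.sum_le_sum fun d (_ : d ∈ Finset.univ) => h3 d
  rw [Finset.sum_add_distrib, Finset.sum_add_distrib, ← h1, ← h2, ← Finset.mul_sum] at h4
  have h5 : ∑ d, ind (M.I d) * M.τ d = ∑ d, ind (M.I d) * M.ω d +
      ∑ d, ind (M.I d) * (M.ω d * M.share (M.σ d)) +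
      ∑ d, ind (M.I d) * (M.ω d * M.share (M.σ.symm d)) := by
    rw [← Finset.sum_add_distrib, ← Finset.sum_add_distrib]
    exact Finset.sum_congr rfl fun d _ => by rw [τ]; ring
  linarith

theorem sum_κ_ge : 6 - 3 * ∑ d, ind (M.O d ∧ M.deg d = 1) ≤
    ∑ d, ind (M.I d) * (M.κ d / M.len d) := by
  have h1 := M.curvature
  have h2 := M.sum_τ_le
  have h3 := sum_ind_div_per M.φ M.I M.τ fun x hx => (M.I_φ x).2 hx
  have h4 : ∑ d, ind (M.I d) * (M.κ d / M.len d) =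
      ∑ d, ind (M.I d) * (6 / M.len d - M.ω d) + ∑ d, ind (M.I d) * M.ω d -
      ∑ d, ind (M.I d) * M.τ d := by
    rw [h3, ← Finset.sum_add_distrib, ← Finset.sum_sub_distrib]
    exact Finset.sum_congr rfl fun d _ => by rw [κ, len]; ring
  linarith

theorem τ_nonneg {d : D} (h : M.I d) : 0 ≤ M.τ d := by
  have h1 := M.ω_nonneg (M.two_le_deg d h)
  have h2 := M.share_nonneg (M.σ d)
  have h3 := M.share_nonneg (M.σ.symm d)
  unfold τ
  positivity

theorem τ_ge_of_four_le {d : D} (h : M.I d) (hd : 4 ≤ M.deg d)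
    (ho : M.O (M.e d) ∨ M.O (M.e (M.φ.symm d))) : 9 / 4 ≤ M.τ d := by
  have h1 := M.three_halves_le_ω hd
  have h2 := M.share_nonneg (M.σ d)
  have h3 := M.share_nonneg (M.σ.symm d)
  unfold τ
  rcases ho with ho | ho
  · have := M.half_le_share ((M.O_σ d).2 ho) (Or.inr (by rwa [Equiv.symm_apply_apply]))
    nlinarith
  · have := M.half_le_share ((M.O_σ_symm d).2 ho) (Or.inl (by rwa [Equiv.apply_symm_apply]))
    nlinarith

theorem τ_ge {d : D} (h : M.I d) : ind (3 ≤ M.deg d) * (1 + ind (M.O (M.e d)) / 2 +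
    ind (M.O (M.e (M.φ.symm d))) / 2 + ind (M.O (M.e d) ∧ M.O (M.e (M.φ.symm d)))) ≤ M.τ d := by
  by_cases hd : 3 ≤ M.deg d
  swap
  · rw [ind_false hd, zero_mul]; exact M.τ_nonneg h
  rw [ind_true hd, one_mul, τ]
  have h1 := M.one_le_ω hd
  have h2 := M.share_nonneg (M.σ d)
  have h3 := M.share_nonneg (M.σ.symm d)
  have ha : M.O (M.e d) → 1 / 2 ≤ M.share (M.σ d) := fun ho =>
    M.half_le_share ((M.O_σ d).2 ho) (Or.inr (by rwa [Equiv.symm_apply_apply]))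
  have hb : M.O (M.e (M.φ.symm d)) → 1 / 2 ≤ M.share (M.σ.symm d) := fun ho =>
    M.half_le_share ((M.O_σ_symm d).2 ho) (Or.inl (by rwa [Equiv.apply_symm_apply]))
  by_cases a : M.O (M.e d) <;> by_cases b : M.O (M.e (M.φ.symm d))
  · rw [ind_true a, ind_true b, ind_true ⟨a, b⟩]
    rcases hd.eq_or_lt with hd | hd
    · have h4 : M.σ (M.σ d) = M.σ.symm d := by
        rw [Equiv.eq_symm_apply]
        have := iterate_per M.σ d
        change M.σ^[M.deg d] d = d at this
        rw [← hd] at this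
        exact this
      have a' := (M.O_σ d).2 a
      have b' := (M.O_σ_symm d).2 b
      have e1 : M.share (M.σ d) = 1 := by
        rw [share, ind_true a', h4, ind_false (M.not_I _ b'), Equiv.symm_apply_apply, ind_true h]
        norm_num
      have e2 : M.share (M.σ.symm d) = 1 := by
        rw [share, ind_true b', Equiv.apply_symm_apply, ← h4, Equiv.symm_apply_apply,
          ind_false (M.not_I _ a'), ind_true h]
        norm_num
      rw [e1, e2]
      linarith
    · have := M.three_halves_le_ω hd
      have a' := ha a
      have b' := hb b
      nlinarith
  · rw [ind_true a, ind_false b, ind_false (p := _ ∧ _) (by tauto)]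
    have := ha a
    nlinarith
  · rw [ind_false a, ind_true b, ind_false (p := _ ∧ _) (by tauto)]
    have := hb b
    nlinarith
  · rw [ind_false a, ind_false b, ind_false (p := _ ∧ _) (by tauto)]
    nlinarith

end Diagram

end

section

namespace Diagram

variable {D : Type} [Fintype D] (M : Diagram D)

/-- The set of darts of a face. -/
noncomputable def face (d : D) : Finset D := cycleOf M.φ d

theorem mem_face {d x : D} : x ∈ M.face d ↔ M.φ.SameCycle d x := mem_cycleOf

theorem card_face (d : D) : (M.face d).card = M.len d := card_cycleOf _ _

theorem self_mem_face (d : D) : d ∈ M.face d := M.mem_face.2 (Perm.SameCycle.refl _ _)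

theorem φ_mem_face {d x : D} : M.φ x ∈ M.face d ↔ x ∈ M.face d := by
  rw [mem_face, mem_face, Perm.sameCycle_apply_right]

theorem φ_symm_mem_face {d x : D} : M.φ.symm x ∈ M.face d ↔ x ∈ M.face d := by
  rw [← φ_mem_face, Equiv.apply_symm_apply]

theorem φ_iter_mem_face {d x : D} (n : ℕ) : M.φ^[n] x ∈ M.face d ↔ x ∈ M.face d := by
  induction n with
  | zero => rfl
  | succ n ih => rw [Function.iterate_succ_apply', φ_mem_face, ih]

theorem face_eq {d x : D} (h : x ∈ M.face d) : M.face x = M.face d :=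
  (cycleOf_eq (M.mem_face.1 h)).symm

theorem len_eq {d x : D} (h : x ∈ M.face d) : M.len x = M.len d :=
  (per_eq_of_sameCycle (M.mem_face.1 h)).symm

theorem κ_eq {d x : D} (h : x ∈ M.face d) : M.κ x = M.κ d := by
  rw [κ, κ, cycleOf_eq (M.mem_face.1 h)]

theorem I_of_mem_face {d x : D} (hd : M.I d) (h : x ∈ M.face d) : M.I x := by
  classical
  exact SameCycle.invariant (A := {z | M.I z}) (fun z hz => (M.I_φ z).2 hz) (M.mem_face.1 h) hd

theorem φ_iter_symm_iter (x : D) {i j : ℕ} (h : i ≤ j) :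
    M.φ^[i] (M.φ.symm^[j] x) = M.φ.symm^[j - i] x := by
  induction i with
  | zero => rfl
  | succ i ih =>
    rw [Function.iterate_succ_apply', ih (by omega), show j - i = (j - (i + 1)) + 1 by omega,
      Function.iterate_succ_apply', Equiv.apply_symm_apply]

theorem e_φ_symm_of_deg {x : D} (h : M.deg x = 2) : M.e (M.φ.symm x) = M.σ x := by
  have := M.φ_e_of_deg (d := M.φ.symm x) (by rwa [Equiv.apply_symm_apply])
  rw [Equiv.apply_symm_apply] at this
  exact this.symm

open Classical in
/-- The darts of a face opposite to `Z`. -/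
noncomputable def opp (Z : D → Prop) (d : D) : Finset D := (M.face d).filter fun x => Z (M.e x)

open Classical in
/-- The initial darts of the maximal arcs of a face opposite to `Z`, broken at `B`. -/
noncomputable def starts (Z B : D → Prop) (d : D) : Finset D :=
  (M.face d).filter fun x => Z (M.e x) ∧ (3 ≤ M.deg x ∨ B (M.σ x))

theorem mem_opp {Z : D → Prop} {d x : D} : x ∈ M.opp Z d ↔ x ∈ M.face d ∧ Z (M.e x) := by
  simp [opp]

theorem mem_starts {Z B : D → Prop} {d x : D} : x ∈ M.starts Z B d ↔
    x ∈ M.face d ∧ Z (M.e x) ∧ (3 ≤ M.deg x ∨ B (M.σ x)) := by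
  simp [starts]

/-- Following an arc backwards leads to its start. -/
theorem trace_back {Z B : D → Prop} {d x : D} (hZ : ∀ z, Z z → ¬ B (M.φ z) → Z (M.φ z))
    (hd : M.I d) (hx : x ∈ M.opp Z d) (N : ℕ) :
    (∃ j < N, M.φ.symm^[j] x ∈ M.starts Z B d ∧ (∀ i ≤ j, M.φ.symm^[i] x ∈ M.opp Z d) ∧
      ∀ i < j, M.deg (M.φ.symm^[i] x) = 2 ∧ ¬ B (M.σ (M.φ.symm^[i] x))) ∨
    ((∀ i ≤ N, M.φ.symm^[i] x ∈ M.opp Z d) ∧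
      ∀ i < N, M.deg (M.φ.symm^[i] x) = 2 ∧ ¬ B (M.σ (M.φ.symm^[i] x))) := by
  induction N with
  | zero =>
    refine Or.inr ⟨fun i hi => ?_, fun i hi => absurd hi (by omega)⟩
    rw [Nat.le_zero.1 hi]
    exact hx
  | succ N ih =>
    rcases ih with ⟨j, hj, h1, h2⟩ | ⟨h1, h2⟩
    · exact Or.inl ⟨j, by omega, h1, h2⟩
    · set y := M.φ.symm^[N] x with hy
      have hyo := h1 N le_rfl
      have hyo' := (M.mem_opp.1 hyo)
      by_cases hs : y ∈ M.starts Z B d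
      · exact Or.inl ⟨N, by omega, hs, h1, h2⟩
      · have h3 : ¬ (3 ≤ M.deg y ∨ B (M.σ y)) := fun h => hs (M.mem_starts.2 ⟨hyo'.1, hyo'.2, h⟩)
        push Not at h3
        have h4 := M.two_le_deg y (M.I_of_mem_face hd hyo'.1)
        have h5 : M.deg y = 2 := le_antisymm (by omega) h4
        right
        constructor
        · intro i hi
          rcases Nat.le_succ_iff.1 hi with hi | rfl
          · exact h1 i hi
          · rw [Function.iterate_succ_apply', ← hy, mem_opp, M.e_φ_symm_of_deg h5,
              φ_symm_mem_face]
            exact ⟨hyo'.1, hZ _ hyo'.2 h3.2⟩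
        · intro i hi
          rcases Nat.lt_succ_iff_lt_or_eq.1 hi with hi | rfl
          · exact h2 i hi
          · exact ⟨h5, h3.2⟩

theorem opp_eq_face_of_starts_eq_empty {Z B : D → Prop} {d x : D}
    (hZ : ∀ z, Z z → ¬ B (M.φ z) → Z (M.φ z)) (hd : M.I d)
    (hx : x ∈ M.opp Z d) (hs : M.starts Z B d = ∅) {y : D} (hy : y ∈ M.face d) :
    y ∈ M.opp Z d ∧ M.deg y = 2 := by
  rcases M.trace_back hZ hd hx (M.len d) with ⟨j, -, h, -⟩ | ⟨h1, h2⟩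
  · rw [hs] at h
    simp at h
  · rw [← M.face_eq (M.mem_opp.1 hx).1, mem_face, Perm.sameCycle_comm] at hy
    obtain ⟨i, hi, hi'⟩ := sameCycle_iff.1 hy
    have hlen : per M.φ y = M.len d := by
      rw [per_eq_of_sameCycle hy]
      exact M.len_eq (M.mem_opp.1 hx).1
    have : M.φ.symm^[i] x = y := by
      rw [← hi']
      exact (Function.LeftInverse.iterate M.φ.symm_apply_apply i) y
    rw [← this]
    exact ⟨h1 i (by omega), (h2 i (by omega)).1⟩

/-- If all arcs opposite to `Z` are short, their total length is controlled by their number. -/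
theorem card_opp_le {Z B : D → Prop} {d : D} (hZ : ∀ z, Z z → ¬ B (M.φ z) → Z (M.φ z)) (hd : M.I d)
    (h : ∀ y ∈ M.face d, ∀ L, 1 ≤ L → L ≤ M.len d → (∀ j < L, Z (M.e (M.φ^[j] y))) →
      (∀ j, 1 ≤ j → j < L → M.deg (M.φ^[j] y) = 2 ∧ ¬ B (M.σ (M.φ^[j] y))) →
        6 * L < M.len d) :
    6 * (M.opp Z d).card ≤ (M.len d - 1) * (M.starts Z B d).card := by
  classical
  set m := (M.len d - 1) / 6 with hm
  have hpos := M.len_pos d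
  have hsub : M.opp Z d ⊆ (M.starts Z B d ×ˢ Finset.range m).image fun p => M.φ^[p.2] p.1 := by
    intro x hx
    rcases M.trace_back hZ hd hx m with ⟨j, hj, hs, -, -⟩ | ⟨h1, h2⟩
    · refine Finset.mem_image.2 ⟨(M.φ.symm^[j] x, j),
        Finset.mem_product.2 ⟨hs, Finset.mem_range.2 hj⟩, ?_⟩
      change M.φ^[j] (M.φ.symm^[j] x) = x
      rw [M.φ_iter_symm_iter x le_rfl, Nat.sub_self]
      rfl
    · have := h (M.φ.symm^[m] x) (M.mem_opp.1 (h1 m le_rfl)).1 (m + 1) (by omega) (by omega)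
        (fun j hj => by
          rw [M.φ_iter_symm_iter x (by omega)]
          exact (M.mem_opp.1 (h1 (m - j) (by omega))).2)
        fun j hj1 hj2 => by
          rw [M.φ_iter_symm_iter x (by omega)]
          exact h2 _ (by omega)
      omega
  have h3 := (Finset.card_le_card hsub).trans Finset.card_image_le
  rw [Finset.card_product, Finset.card_range] at h3
  calc 6 * (M.opp Z d).card ≤ 6 * ((M.starts Z B d).card * m) := by omega
    _ = (6 * m) * (M.starts Z B d).card := by ring
    _ ≤ _ := Nat.mul_le_mul_right _ (by omega)

theorem card_opp_I_le {d : D} (hd : M.I d) :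
    6 * (M.opp M.I d).card ≤ (M.len d - 1) * (M.starts M.I (fun _ => False) d).card := by
  refine M.card_opp_le (fun z hz _ => (M.I_φ z).2 hz) hd fun y hy L h1 h2 h3 h4 => ?_
  rw [← M.len_eq hy] at h2 ⊢
  exact M.piece y L (M.I_of_mem_face hd hy) (h3 0 (by omega)) h1 h2
    fun j hj1 hj2 => (h4 j hj1 hj2).1

end Diagram

end

section

namespace Diagram

variable {D : Type} [Fintype D] (M : Diagram D)

theorem card_filter_eq_sum_ind (s : Finset D) (p : D → Prop) [DecidablePred p] :
    ((s.filter p).card : ℚ) = ∑ d ∈ s, ind (p d) := by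
  rw [sum_ind]
  congr!

/-- The number of maximal inner arcs of a face. -/
noncomputable def innerArcs (d : D) : ℕ := (M.starts M.I (fun _ => False) d).card

/-- The number of maximal outer arcs of a face. -/
noncomputable def outerArcs (d : D) : ℕ := (M.starts M.O (fun _ => False) d).card

open Classical in
/-- The number of corners of a face between two outer arcs. -/
noncomputable def outerCorners (d : D) : ℕ :=
  ((M.face d).filter fun x => 3 ≤ M.deg x ∧ M.O (M.e x) ∧ M.O (M.e (M.φ.symm x))).card

open Classical in
/-- The corners of a face at which an outer arc passes through a point of `B`. -/
noncomputable def breaks (B : D → Prop) (d : D) : Finset D :=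
  (M.face d).filter fun x => M.deg x = 2 ∧ M.O (M.e x) ∧ B (M.σ x)

theorem mem_breaks {B : D → Prop} {d x : D} : x ∈ M.breaks B d ↔
    x ∈ M.face d ∧ M.deg x = 2 ∧ M.O (M.e x) ∧ B (M.σ x) := by simp [breaks]

theorem innerArcs_eq (d : D) (hd : M.I d) :
    (M.innerArcs d : ℚ) = ∑ x ∈ M.face d, ind (3 ≤ M.deg x) * (1 - ind (M.O (M.e x))) := by
  unfold innerArcs starts
  rw [card_filter_eq_sum_ind]
  refine Finset.sum_congr rfl fun x hx => ?_
  have h1 := M.I_e_iff (M.I_of_mem_face hd hx)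
  rw [or_false, h1]
  by_cases h : 3 ≤ M.deg x <;> by_cases h' : M.O (M.e x)
  · rw [ind_false (by tauto), ind_true h, ind_true h']; norm_num
  · rw [ind_true (by tauto), ind_true h, ind_false h']; norm_num
  · rw [ind_false (by tauto), ind_false h]; norm_num
  · rw [ind_false (by tauto), ind_false h]; norm_num

theorem ind_and (p q : Prop) : ind (p ∧ q) = ind p * ind q := by
  by_cases h : p <;> by_cases h' : q
  · rw [ind_true ⟨h, h'⟩, ind_true h, ind_true h']; norm_num
  · rw [ind_false (by tauto), ind_false h']; norm_num
  · rw [ind_false (by tauto), ind_false h]; norm_num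
  · rw [ind_false (by tauto), ind_false h]; norm_num

theorem outerArcs_eq (d : D) :
    (M.outerArcs d : ℚ) = ∑ x ∈ M.face d, ind (3 ≤ M.deg x) * ind (M.O (M.e x)) := by
  unfold outerArcs starts
  rw [card_filter_eq_sum_ind]
  refine Finset.sum_congr rfl fun x _ => ?_
  rw [or_false, ind_and, mul_comm]

theorem outerCorners_eq (d : D) : (M.outerCorners d : ℚ) = ∑ x ∈ M.face d,
    ind (3 ≤ M.deg x) * ind (M.O (M.e x) ∧ M.O (M.e (M.φ.symm x))) := by
  unfold outerCorners
  rw [card_filter_eq_sum_ind]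
  exact Finset.sum_congr rfl fun x _ => ind_and _ _

theorem sum_face_φ_symm (d : D) (f : D → ℚ) :
    ∑ x ∈ M.face d, f (M.φ.symm x) = ∑ x ∈ M.face d, f x :=
  Finset.sum_equiv M.φ.symm (fun _ => (M.φ_symm_mem_face).symm) fun _ _ => rfl

theorem outerArcs_eq' (d : D) (hd : M.I d) : (M.outerArcs d : ℚ) =
    ∑ x ∈ M.face d, ind (3 ≤ M.deg x) * ind (M.O (M.e (M.φ.symm x))) := by
  rw [outerArcs_eq]
  have h1 := M.sum_face_φ_symm d fun x => ind (M.O (M.e x))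
  have h2 : ∀ x ∈ M.face d, ind (3 ≤ M.deg x) * ind (M.O (M.e x)) -
      ind (3 ≤ M.deg x) * ind (M.O (M.e (M.φ.symm x))) =
      ind (M.O (M.e x)) - ind (M.O (M.e (M.φ.symm x))) := by
    intro x hx
    by_cases h : 3 ≤ M.deg x
    · rw [ind_true h]; ring
    · have h3 := M.two_le_deg x (M.I_of_mem_face hd hx)
      have h4 : M.deg x = 2 := le_antisymm (by omega) h3
      have := M.O_e_φ (d := M.φ.symm x) (by rwa [Equiv.apply_symm_apply])
      rw [Equiv.apply_symm_apply] at this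
      rw [ind_congr this]
      ring
  have h3 := Finset.sum_congr rfl h2
  rw [Finset.sum_sub_distrib, Finset.sum_sub_distrib] at h3
  linarith

theorem sum_τ_ge_aux (d : D) (hd : M.I d) :
    ∑ x ∈ M.face d, ind (3 ≤ M.deg x) * (1 + ind (M.O (M.e x)) / 2 +
      ind (M.O (M.e (M.φ.symm x))) / 2 + ind (M.O (M.e x) ∧ M.O (M.e (M.φ.symm x)))) =
    M.innerArcs d + 2 * M.outerArcs d + M.outerCorners d := by
  have h1 := M.outerArcs_eq d
  have h2 := M.outerArcs_eq' d hd
  rw [M.innerArcs_eq d hd, M.outerCorners_eq]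
  have h3 : (2 * M.outerArcs d : ℚ) = 3 / 2 * M.outerArcs d + 1 / 2 * M.outerArcs d := by ring
  rw [h3]
  nth_rewrite 1 [h1]
  rw [h2, Finset.mul_sum, Finset.mul_sum, ← Finset.sum_add_distrib, ← Finset.sum_add_distrib,
    ← Finset.sum_add_distrib]
  exact Finset.sum_congr rfl fun x _ => by ring

theorem κ_le {d : D} (hd : M.I d) :
    M.κ d ≤ 6 - M.innerArcs d - 2 * M.outerArcs d - M.outerCorners d := by
  have h := Finset.sum_le_sum fun x hx => M.τ_ge (M.I_of_mem_face hd hx)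
  rw [M.sum_τ_ge_aux d hd] at h
  unfold κ
  unfold face at h
  linarith

theorem κ_le_of_four_le {d x : D} (hd : M.I d) (hx : x ∈ M.face d) (h4 : 4 ≤ M.deg x)
    (ho : M.O (M.e x) ↔ ¬ M.O (M.e (M.φ.symm x))) :
    M.κ d ≤ 6 - M.innerArcs d - 2 * M.outerArcs d - M.outerCorners d - 3 / 4 := by
  classical
  have h1 := M.sum_τ_ge_aux d hd
  have h2 := Finset.sum_le_sum fun y (hy : y ∈ (M.face d).erase x) =>
    M.τ_ge (M.I_of_mem_face hd (Finset.mem_of_mem_erase hy))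
  rw [← Finset.add_sum_erase _ _ hx] at h1
  have h3 := Finset.add_sum_erase (M.face d) M.τ hx
  have h5 := M.τ_ge_of_four_le (M.I_of_mem_face hd hx) h4 (by tauto)
  rw [ind_true (by omega), ind_false (p := _ ∧ _) (by tauto)] at h1
  have h6 : ind (M.O (M.e x)) + ind (M.O (M.e (M.φ.symm x))) = 1 := by
    by_cases h : M.O (M.e x)
    · rw [ind_true h, ind_false (ho.1 h)]; norm_num
    · rw [ind_false h, ind_true (by tauto)]; norm_num
  unfold κ
  change 6 - ∑ x ∈ M.face d, M.τ x ≤ _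
  linarith

theorem outerArcs_le {d : D} (hd : M.I d) :
    M.outerArcs d ≤ M.innerArcs d + M.outerCorners d := by
  have h1 := M.outerArcs_eq' d hd
  have h2 := M.innerArcs_eq d hd
  have h3 := M.outerCorners_eq d
  have : (M.outerArcs d : ℚ) ≤ M.innerArcs d + M.outerCorners d := by
    rw [h1, h2, h3, ← Finset.sum_add_distrib]
    refine Finset.sum_le_sum fun x _ => ?_
    rw [← mul_add]
    refine mul_le_mul_of_nonneg_left ?_ (ind_nonneg _)
    rw [ind_and]
    by_cases h : M.O (M.e x)
    · rw [ind_true h]; linarith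
    · rw [ind_false h]; linarith [ind_le_one (M.O (M.e (M.φ.symm x)))]
  exact_mod_cast this

theorem κ_le_outerArcs {d : D} (hd : M.I d) : M.κ d ≤ 6 - 3 * M.outerArcs d := by
  have h1 := M.κ_le hd
  have h2 : (M.outerArcs d : ℚ) ≤ M.innerArcs d + M.outerCorners d := by
    exact_mod_cast M.outerArcs_le hd
  linarith

theorem card_opp_add {d : D} (hd : M.I d) : (M.opp M.I d).card + (M.opp M.O d).card = M.len d := by
  classical
  rw [← card_face, ← Finset.card_union_of_disjoint]
  · congr 1
    ext x
    simp only [Finset.mem_union, mem_opp]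
    refine ⟨by tauto, fun hx => ?_⟩
    have := M.live_e (Or.inr (M.I_of_mem_face hd hx))
    tauto
  · rw [Finset.disjoint_left]
    intro x h1 h2
    exact M.not_I _ (M.mem_opp.1 h2).2 (M.mem_opp.1 h1).2

theorem O_step (z : D) (h : M.O z) (_ : ¬ False) : M.O (M.φ z) := (M.O_φ z).2 h

theorem opp_eq_face_of_outerArcs {d x : D} (hd : M.I d) (hx : x ∈ M.opp M.O d)
    (h : M.outerArcs d = 0) {y : D} (hy : y ∈ M.face d) : y ∈ M.opp M.O d ∧ M.deg y = 2 :=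
  M.opp_eq_face_of_starts_eq_empty (B := fun _ => False) M.O_step hd hx (Finset.card_eq_zero.1 h) hy

theorem seven_le_innerArcs {d : D} (hd : M.I d) (h : M.opp M.O d = ∅) : 7 ≤ M.innerArcs d := by
  have h1 := M.card_opp_I_le hd
  have h2 := M.card_opp_add hd
  rw [h, Finset.card_empty, add_zero] at h2
  have h3 := M.len_pos d
  rw [h2] at h1
  change _ ≤ _ * M.innerArcs d at h1
  by_contra hc
  have h4 : (M.len d - 1) * M.innerArcs d ≤ (M.len d - 1) * 6 := Nat.mul_le_mul_left _ (by omega)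
  omega

theorem starts_subset {Z B : D → Prop} (hZ : ∀ z, Z z → M.O z) {d : D} (hd : M.I d) {x : D}
    (hx : x ∈ M.starts Z B d) : (x ∈ M.starts M.O (fun _ => False) d ∧ Z (M.e x)) ∨
      (x ∈ M.breaks B d ∧ Z (M.e x)) := by
  rw [mem_starts] at hx
  by_cases h : 3 ≤ M.deg x
  · exact Or.inl ⟨M.mem_starts.2 ⟨hx.1, hZ _ hx.2.1, Or.inl h⟩, hx.2.1⟩
  · have h3 := M.two_le_deg x (M.I_of_mem_face hd hx.1)
    exact Or.inr ⟨M.mem_breaks.2 ⟨hx.1, le_antisymm (by omega) h3, hZ _ hx.2.1,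
      hx.2.2.resolve_left h⟩, hx.2.1⟩

/-- A predicate on outer darts that changes only at `B`. -/
def IsSide (Z B : D → Prop) : Prop :=
  (∀ z, Z z → M.O z) ∧ ∀ z, M.O z → ¬ B (M.φ z) → (Z (M.φ z) ↔ Z z)

theorem IsSide.step {M : Diagram D} {Z B : D → Prop} (h : M.IsSide Z B) (z : D) (hz : Z z)
    (hb : ¬ B (M.φ z)) : Z (M.φ z) := (h.2 z (h.1 z hz) hb).2 hz

theorem side_iff {Z B : D → Prop} (h : M.IsSide Z B) {d x : D} (hb : M.breaks B d = ∅) {j : ℕ}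
    (h1 : ∀ i ≤ j, M.φ.symm^[i] x ∈ M.opp M.O d) (h2 : ∀ i < j, M.deg (M.φ.symm^[i] x) = 2) :
    Z (M.e (M.φ.symm^[j] x)) ↔ Z (M.e x) := by
  induction j with
  | zero => rfl
  | succ j ih =>
    rw [← ih (fun i hi => h1 i (by omega)) fun i hi => h2 i (by omega)]
    have h3 := M.mem_opp.1 (h1 j (by omega))
    have h4 := h2 j (by omega)
    rw [Function.iterate_succ_apply', M.e_φ_symm_of_deg h4]
    refine h.2 _ h3.2 fun h5 => ?_
    have : M.φ.symm^[j] x ∈ M.breaks B d := M.mem_breaks.2 ⟨h3.1, h4, h3.2, h5⟩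
    rw [hb] at this
    simp at this

theorem exists_start {d x : D} (hd : M.I d) (h : M.outerArcs d ≠ 0) (hx : x ∈ M.opp M.O d) :
    ∃ j, M.φ.symm^[j] x ∈ M.starts M.O (fun _ => False) d ∧
      (∀ i ≤ j, M.φ.symm^[i] x ∈ M.opp M.O d) ∧ ∀ i < j, M.deg (M.φ.symm^[i] x) = 2 := by
  rcases M.trace_back (B := fun _ => False) M.O_step hd hx (M.len d) with ⟨j, -, h⟩ | ⟨-, h2⟩
  · exact ⟨j, h.1, h.2.1, fun i hi => (h.2.2 i hi).1⟩
  · exfalso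
    obtain ⟨y, hy⟩ := Finset.card_ne_zero.1 h
    rw [mem_starts, or_false] at hy
    have hy' := hy.1
    rw [← M.face_eq (M.mem_opp.1 hx).1, mem_face, Perm.sameCycle_comm] at hy'
    obtain ⟨i, hi, hi'⟩ := sameCycle_iff.1 hy'
    have hlen : per M.φ y = M.len d := M.len_eq hy.1
    have h3 : M.φ.symm^[i] x = y := by
      rw [← hi']
      exact (Function.LeftInverse.iterate M.φ.symm_apply_apply i) y
    have := h2 i (by omega)
    rw [h3] at this
    omega

theorem opp_eq_of_outerArcs_eq_one {Z B : D → Prop} (h : M.IsSide Z B) {d x : D} (hd : M.I d)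
    (hb : M.breaks B d = ∅) (h1 : M.outerArcs d = 1) (hx : x ∈ M.opp Z d) :
    M.opp Z d = M.opp M.O d := by
  have hxo : x ∈ M.opp M.O d := M.mem_opp.2 ⟨(M.mem_opp.1 hx).1, h.1 _ (M.mem_opp.1 hx).2⟩
  obtain ⟨s, hs⟩ := Finset.card_eq_one.1 h1
  have key : ∀ y ∈ M.opp M.O d, (Z (M.e s) ↔ Z (M.e y)) := by
    intro y hy
    obtain ⟨j, h2, h3, h4⟩ := M.exists_start hd (by omega) hy
    have h5 := M.side_iff h hb h3 h4
    rw [hs, Finset.mem_singleton] at h2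
    rwa [h2] at h5
  have hsZ := (key x hxo).2 (M.mem_opp.1 hx).2
  ext y
  refine ⟨fun hy => M.mem_opp.2 ⟨(M.mem_opp.1 hy).1, h.1 _ (M.mem_opp.1 hy).2⟩, fun hy => ?_⟩
  exact M.mem_opp.2 ⟨(M.mem_opp.1 hy).1, (key y hy).1 hsZ⟩

theorem four_le_innerArcs {d : D} (hd : M.I d) (h : 2 * (M.opp M.O d).card ≤ M.len d) :
    4 ≤ M.innerArcs d := by
  have h1 := M.card_opp_I_le hd
  have h2 := M.card_opp_add hd
  have h3 := M.len_pos d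
  change _ ≤ _ * M.innerArcs d at h1
  by_contra hc
  have h4 : (M.len d - 1) * M.innerArcs d ≤ (M.len d - 1) * 3 := Nat.mul_le_mul_left _ (by omega)
  omega

end Diagram

end

section

theorem C6Presentation.six_mul_lt {S : Type} (P : C6Presentation S) {u v : Word S}
    (hu : u ∈ P.rels) (hv : v ∈ P.rels) (hne : u ≠ v) {L : ℕ} (hL : L ≤ u.length)
    (h : ∀ i < L, u[i]? = v[i]?) : 6 * L < u.length ∧ 6 * L < v.length := by
  have key : u.take L = v.take L := by
    refine List.ext_getElem? fun i => ?_
    rw [List.getElem?_take, List.getElem?_take]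
    split
    · exact h i ‹_›
    · rfl
  have hp : IsPiece P.rels (u.take L) :=
    ⟨u, hu, v, hv, hne, List.take_prefix _ _, key ▸ List.take_prefix _ _⟩
  have h1 := P.small_cancellation u hu _ (List.take_prefix _ _) hp
  have h2 := P.small_cancellation v hv _ (key ▸ List.take_prefix _ _) hp
  rw [List.length_take, min_eq_left hL] at h1 h2
  exact ⟨h1, h2⟩

theorem getElem?_wordInv {S : Type} (w : Word S) {i : ℕ} (hi : i < w.length) :
    (wordInv w)[i]? = (w[w.length - 1 - i]?).map linv := by
  rw [wordInv_eq_reverse_map, List.getElem?_reverse (by simpa using hi), List.getElem?_map]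
  simp

theorem getElem?_map_faceList {D A : Type} [Fintype D] [DecidableEq D] {φ : Perm D} {d : D}
    (f : D → A) {i : ℕ} (hi : i < per φ d) :
    ((faceList φ d).map f)[i]? = some (f (φ^[i] d)) := by
  unfold faceList
  rw [List.getElem?_map, List.getElem?_map, List.getElem?_range hi]
  rfl

theorem map_faceList_iterate {D A : Type} [Fintype D] [DecidableEq D] {φ : Perm D} {d : D}
    (f : D → A) (n : ℕ) : (faceList φ (φ^[n] d)).map f = ((faceList φ d).map f).rotate n := by
  have hp : per φ (φ^[n] d) = per φ d := (per_eq_of_sameCycle (sameCycle_iterate _ _ _)).symm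
  refine List.ext_getElem? fun i => ?_
  by_cases hi : i < per φ d
  · rw [getElem?_map_faceList f (hp ▸ hi), List.getElem?_rotate (by simpa using hi),
      getElem?_map_faceList f (by simpa using Nat.mod_lt _ (per_pos φ d)), List.length_map,
      length_faceList, iterate_mod_per, Function.iterate_add_apply]
  · rw [List.getElem?_eq_none (by simp [hp]; omega), List.getElem?_eq_none (by simp; omega)]

section

variable {S : Type} {P : C6Presentation S} {D : Type} [Fintype D] [DecidableEq D]
  {lab : D → S × Bool} {pos : D → P.Grp}

namespace Cfg

variable (c : Cfg P lab pos)

theorem φ_e_of_deg {d : D} (h : per c.σ (c.φ d) = 2) : c.φ (c.e (c.φ d)) = c.e d := by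
  have h1 := iterate_per c.σ (c.e d)
  have h2 : per c.σ (c.e d) = 2 := by
    rw [← h]
    have := per_apply c.σ (c.e d)
    rw [σ_apply, c.e_e] at this
    exact this.symm
  rw [h2] at h1
  simpa [σ_apply, c.e_e] using h1

/-- Along an arc through vertices of degree two, the opposite face is traversed backwards. -/
theorem mirror {d : D} {L : ℕ} (h : ∀ j, 1 ≤ j → j < L → per c.σ (c.φ^[j] d) = 2) {j : ℕ}
    (hj : j < L) : c.φ^[j] (c.e (c.φ^[j] d)) = c.e d := by
  induction j with
  | zero => rfl
  | succ j ih =>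
    have h1 := h (j + 1) (by omega) hj
    rw [Function.iterate_succ_apply'] at h1
    rw [Function.iterate_succ_apply, Function.iterate_succ_apply' c.φ j d, c.φ_e_of_deg h1,
      ih (by omega)]

variable {c}

theorem dead_φ {d : D} : c.Dead (c.φ d) ↔ c.Dead d := by
  constructor
  · intro h
    have h1 : c.e (c.φ d) = d := c.φ.injective h.2
    have h2 : c.φ d = c.e d := by rw [← h1, c.e_e, h1]
    exact ⟨h2, by rw [← h2, h.1, h1]⟩
  · intro h
    rw [h.1]
    exact h.e

end Cfg

namespace IsFilling

variable {c : Cfg P lab pos} {l₀ : List D} {w : Word S} {g : P.Grp}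

theorem faceWord_mem (hF : IsFilling c l₀ w g) {d : D} (h1 : d ∉ l₀) (h2 : ¬ c.Dead d) :
    (faceList c.φ d).map lab ∈ P.rels := by
  obtain ⟨l, hl, hd, hr⟩ := (hF.rel d h1).resolve_left h2
  obtain ⟨u, v, rfl⟩ := List.append_of_mem hd
  have h3 := isFace_append_comm hl
  rw [List.cons_append] at h3
  rw [← h3.eq_faceList]
  have := P.rotate_mem _ hr u.length
  rw [List.map_append, ← List.length_map (f := lab), List.rotate_append_length_eq] at this
  simpa using this

theorem two_le_deg (hF : IsFilling c l₀ w g) {d : D} (h1 : d ∉ l₀) (h2 : ¬ c.Dead d) :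
    2 ≤ per c.σ d := by
  by_contra hlt
  have hp := per_pos c.σ d
  have h3 : c.φ (c.e d) = d := by
    have := iterate_per c.σ d
    rw [show per c.σ d = 1 by omega] at this
    exact this
  have hr := P.cyclically_reduced _ (hF.faceWord_mem h1 h2)
  have hch := (isFace_faceList c.φ d).2
  have hed : c.e d ∈ faceList c.φ d := by
    rw [← (isFace_faceList c.φ d).apply_mem, h3, mem_faceList]
  obtain ⟨u, v, huv⟩ := List.append_of_mem hed
  unfold CyclicallyReduced at hr
  obtain ⟨m, hm⟩ : ∃ m, faceList c.φ d = d :: m := by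
    cases h : faceList c.φ d with
    | nil => rw [h] at hed; simp at hed
    | cons a m =>
      refine ⟨m, ?_⟩
      have h4 : (faceList c.φ d)[0]? = some d := by
        have := getElem?_map_faceList (φ := c.φ) (d := d) id (i := 0) (per_pos _ _)
        simpa using this
      rw [h] at h4
      simpa using h4
  have key : ∃ a b, faceList c.φ d ++ faceList c.φ d = a ++ c.e d :: d :: b := by
    rw [huv, List.append_assoc, List.cons_append, List.isChain_append, List.isChain_cons] at hch
    cases v with
    | nil => exact ⟨u, m, by nth_rewrite 1 [huv]; rw [hm]; simp⟩
    | cons x v =>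
      have := hch.2.1.1 x (by simp)
      rw [h3] at this
      exact ⟨u, v ++ faceList c.φ d, by nth_rewrite 1 [huv]; rw [← this]; simp⟩
  obtain ⟨a, b, hab⟩ := key
  rw [← List.map_append, hab, List.map_append, List.map_cons, List.map_cons, c.lab_e] at hr
  have h5 := not_reduced_linv (u := a.map lab) (v := b.map lab) (a := linv (lab d))
  rw [linv_linv] at h5
  exact h5 hr

theorem mem_l₀_iff (hF : IsFilling c l₀ w g) {x y : D} (h : c.φ.SameCycle x y) :
    x ∈ l₀ ↔ y ∈ l₀ :=
  ⟨fun hx => (hF.face.sameCycle hx).1 h, fun hy => (hF.face.sameCycle hy).1 h.symm⟩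

/-- In a filling of minimal size, arcs between inner faces are pieces. -/
theorem piece (hF : IsFilling c l₀ w g) (hmin : ∀ m, FillSize P w g m → c.size l₀ ≤ m) {d : D}
    (h1 : d ∉ l₀) (h2 : ¬ c.Dead d) (h3 : c.e d ∉ l₀) (h4 : ¬ c.Dead (c.e d)) {L : ℕ}
    (hL : L ≤ per c.φ d) (h : ∀ j, 1 ≤ j → j < L → per c.σ (c.φ^[j] d) = 2) :
    6 * L < per c.φ d := by
  have h3' : c.σ d ∉ l₀ := by rwa [c.σ_apply, hF.face.apply_mem]
  have h4' : ¬ c.Dead (c.σ d) := by rwa [c.σ_apply, Cfg.dead_φ]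
  set u := (faceList c.φ d).map lab with hu
  set v := (faceList c.φ (c.σ d)).map lab with hv
  have hur : u ∈ P.rels := hF.faceWord_mem h1 h2
  have hvr : v ∈ P.rels := hF.faceWord_mem h3' h4'
  have hlu : u.length = per c.φ d := by simp [hu]
  have hlv : v.length = per c.φ (c.σ d) := by simp [hv]
  have hup : u ≠ [] := List.length_pos_iff.1 (by rw [hlu]; exact per_pos _ _)
  have hscd : c.σ.SameCycle d (c.σ d) := Perm.sameCycle_apply_right.2 (Perm.SameCycle.refl _ _)
  have hhead : ∀ x : D, x ∈ (faceList c.φ x).head? := fun x => by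
    have := getElem?_map_faceList (φ := c.φ) (d := x) id (i := 0) (per_pos _ _)
    rw [List.head?_eq_getElem?]
    simpa using this
  by_cases huv : u = wordInv v
  · exfalso
    by_cases hs : c.φ.SameCycle d (c.σ d)
    · obtain ⟨i, -, hi⟩ := sameCycle_iff.1 hs
      rw [hv, ← hi, map_faceList_iterate] at huv
      exact ne_wordInv_rotate (P.cyclically_reduced _ hur) hup i huv
    · obtain ⟨m, hm, hm'⟩ := hF.exists_cancel (isFace_faceList c.φ d) (isFace_faceList c.φ (c.σ d))
        (x := d) (y := c.σ d)
        (fun z hz hz' => hs ((mem_faceList.1 hz).trans (mem_faceList.1 hz').symm)) (hhead _) (hhead _)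
        hscd (fun z hz hz' => h1 ((hF.mem_l₀_iff (mem_faceList.1 hz')).2 hz))
        (fun z hz hz' => h3' ((hF.mem_l₀_iff (mem_faceList.1 hz')).2 hz)) h2
        (by rw [List.map_append, ← hu, ← hv, huv, wordVal_append, wordVal_wordInv,
          inv_mul_cancel])
      exact absurd (hmin m hm') (by omega)
  · have hlet : ∀ i < min L v.length, u[i]? = (wordInv v)[i]? := by
      intro i hi
      have hi1 : i < L := by omega
      have hi2 : i < v.length := by omega
      have hu' := getElem?_map_faceList (φ := c.φ) (d := d) lab (i := i) (by omega)
      have hv' := getElem?_map_faceList (φ := c.φ) (d := c.σ d) lab (i := v.length - 1 - i)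
        (by omega)
      rw [getElem?_wordInv v hi2, hu', hv', Option.map_some]
      have h5 := c.mirror h hi1
      have h6 : c.φ^[i] (c.φ^[v.length - 1 - i] (c.σ d)) = c.e d := by
        rw [← Function.iterate_add_apply, show i + (v.length - 1 - i) = v.length - 1 by omega]
        have h7 := iterate_per c.φ (c.σ d)
        rw [← hlv, show v.length = v.length - 1 + 1 by omega, Function.iterate_succ_apply'] at h7
        exact c.φ.injective h7
      have h8 := (c.φ.injective.iterate i) (h6.trans h5.symm)
      rw [h8, c.lab_e, linv_linv]
    have := P.six_mul_lt hur (P.inv_mem _ hvr) huv (L := min L v.length) (by omega) hlet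
    rw [length_wordInv, hlu] at this
    omega

/-- The diagram underlying a filling of minimal size. -/
def diagram (hF : IsFilling c l₀ w g) (hmin : ∀ m, FillSize P w g m → c.size l₀ ≤ m)
    (hne : l₀ ≠ []) : Diagram D where
  φ := c.φ
  e := c.e
  e_e := c.e_e
  e_ne := c.e_ne
  planar := c.planar
  O d := d ∈ l₀
  I d := d ∉ l₀ ∧ ¬ c.Dead d
  not_I d h1 h2 := h2.1 h1
  O_φ _ := hF.face.apply_mem
  I_φ d := by rw [hF.face.apply_mem, Cfg.dead_φ]
  dead d h1 h2 := by
    by_contra hc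
    exact h2 ⟨h1, hc⟩
  O_cycle x y hx hy := (hF.face.sameCycle hx).2 hy
  O_ne := List.exists_mem_of_ne_nil _ hne
  two_le_deg d hd := hF.two_le_deg hd.1 hd.2
  piece d L hd hd' _ h2 h3 := hF.piece hmin hd.1 hd.2 hd'.1 hd'.2 h2 h3

end IsFilling

end

end

section

namespace Diagram

variable {D : Type} [Fintype D] (M : Diagram D)

theorem opp_eq_face_of_breaks {Z B : D → Prop} (hZ : M.IsSide Z B) {d x : D} (hd : M.I d)
    (hb : M.breaks B d = ∅) (hx : x ∈ M.opp Z d) (h0 : M.outerArcs d = 0) :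
    M.opp Z d = M.face d := by
  have hxo : x ∈ M.opp M.O d := M.mem_opp.2 ⟨(M.mem_opp.1 hx).1, hZ.1 _ (M.mem_opp.1 hx).2⟩
  have hs : M.starts Z B d = ∅ := by
    refine Finset.eq_empty_of_forall_notMem fun y hy => ?_
    rcases M.starts_subset hZ.1 hd hy with h | h
    · rw [Finset.card_eq_zero.1 h0] at h
      simp at h
    · rw [hb] at h
      simp at h
  ext y
  exact ⟨fun h => (M.mem_opp.1 h).1, fun h =>
    (M.opp_eq_face_of_starts_eq_empty hZ.step hd hx hs h).1⟩

theorem four_le_of_geodesic {Z B : D → Prop} (hZ : M.IsSide Z B) {d x : D} (hd : M.I d)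
    (hb : M.breaks B d = ∅) (hx : x ∈ M.opp Z d) (h1 : M.outerArcs d ≤ 1)
    (hg : 2 * (M.opp Z d).card ≤ M.len d) : 4 ≤ M.innerArcs d ∧ M.outerArcs d = 1 ∧
      M.opp Z d = M.opp M.O d := by
  have h2 : M.outerArcs d = 1 := by
    by_contra h
    have h3 := M.opp_eq_face_of_breaks hZ hd hb hx (by omega)
    rw [h3, card_face] at hg
    have := M.len_pos d
    omega
  have h3 := M.opp_eq_of_outerArcs_eq_one hZ hd hb h2 hx
  exact ⟨M.four_le_innerArcs hd (h3 ▸ hg), h2, h3⟩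

theorem outerArcs_eq_zero {d : D} (h : M.opp M.O d = ∅) : M.outerArcs d = 0 := by
  refine Finset.card_eq_zero.2 (Finset.eq_empty_of_forall_notMem fun y hy => ?_)
  have hy := M.mem_starts.1 hy
  have : y ∈ M.opp M.O d := M.mem_opp.2 ⟨hy.1, hy.2.1⟩
  rw [h] at this
  simp at this

theorem innerArcs_eq_zero {d x : D} (hd : M.I d) (hx : x ∈ M.opp M.O d) (h : M.outerArcs d = 0) :
    M.innerArcs d = 0 := by
  refine Finset.card_eq_zero.2 (Finset.eq_empty_of_forall_notMem fun y hy => ?_)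
  have hy := M.mem_starts.1 hy
  have h1 := M.opp_eq_face_of_outerArcs hd hx h hy.1
  exact M.not_I _ (M.mem_opp.1 h1.1).2 hy.2.1

/-- A face without breaks has nonpositive curvature when all sides are geodesic. -/
theorem κ_nonpos {ι : Type} {Z : ι → D → Prop} {B : D → Prop} (hZ : ∀ i, M.IsSide (Z i) B)
    (hO : ∀ x, M.O x → ∃ i, Z i x) {d : D} (hd : M.I d) (hb : M.breaks B d = ∅)
    (hg : ∀ i, 2 * (M.opp (Z i) d).card ≤ M.len d) : M.κ d ≤ 0 := by
  have h1 := M.κ_le hd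
  have h2 := M.κ_le_outerArcs hd
  have h3 : (0 : ℚ) ≤ M.outerCorners d := Nat.cast_nonneg _
  rcases le_or_gt 2 (M.outerArcs d) with h | h
  · have : (2 : ℚ) ≤ M.outerArcs d := by exact_mod_cast h
    linarith
  rcases (M.opp M.O d).eq_empty_or_nonempty with h4 | ⟨x, hx⟩
  · have : (7 : ℚ) ≤ M.innerArcs d := by exact_mod_cast M.seven_le_innerArcs hd h4
    have h5 : (0 : ℚ) ≤ M.outerArcs d := Nat.cast_nonneg _
    linarith
  · obtain ⟨i, hi⟩ := hO _ (M.mem_opp.1 hx).2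
    obtain ⟨h5, h6, -⟩ := M.four_le_of_geodesic (hZ i) hd hb
      (M.mem_opp.2 ⟨(M.mem_opp.1 hx).1, hi⟩) (by omega) (hg i)
    have : (4 : ℚ) ≤ M.innerArcs d := by exact_mod_cast h5
    rw [h6] at h1
    push_cast at h1
    linarith

/-- The curvature of a face in a bigon whose first side is part of a relator and whose second
side is geodesic. -/
theorem κ_le_two_mul_breaks {Z Z' B : D → Prop} (hZ : M.IsSide Z B) (hZ' : M.IsSide Z' B)
    (hO : ∀ x, M.O x → Z x ∨ Z' x) (hZZ : ∀ x, Z x → ¬ Z' x) {d : D} (hd : M.I d)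
    (hp : ∀ y ∈ M.face d, ∀ L, 1 ≤ L → L ≤ M.len d → (∀ j < L, Z (M.e (M.φ^[j] y))) →
      (∀ j, 1 ≤ j → j < L → M.deg (M.φ^[j] y) = 2 ∧ ¬ B (M.σ (M.φ^[j] y))) →
        6 * L < M.len d)
    (hg : 2 * (M.opp Z' d).card ≤ M.len d)
    (hB : ∀ x ∈ M.breaks B d, ∀ y ∈ M.breaks B d, Z (M.e x) → Z (M.e y) → x = y) :
    M.κ d ≤ 2 * (M.breaks B d).card := by
  classical
  have hlen := M.len_pos d
  have hZc := M.card_opp_le hZ.step hd hp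
  have hIc := M.card_opp_I_le hd
  change _ ≤ _ * M.innerArcs d at hIc
  have hsum : (M.opp M.O d).card = (M.opp Z d).card + (M.opp Z' d).card := by
    rw [← Finset.card_union_of_disjoint]
    · congr 1
      ext x
      simp only [Finset.mem_union, mem_opp]
      have := hO (M.e x)
      have := hZ.1 (M.e x)
      have := hZ'.1 (M.e x)
      tauto
    · rw [Finset.disjoint_left]
      intro x h1 h2
      exact hZZ _ (M.mem_opp.1 h1).2 (M.mem_opp.1 h2).2
  have hadd := M.card_opp_add hd
  set cs := ((M.breaks B d).filter fun x => Z (M.e x)).card with hcs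
  have hcs1 : cs ≤ 1 := by
    refine Finset.card_le_one.2 fun x hx y hy => ?_
    rw [Finset.mem_filter] at hx hy
    exact hB x hx.1 y hy.1 hx.2 hy.2
  have hcsc : cs ≤ (M.breaks B d).card := Finset.card_filter_le _ _
  have hsst : (M.starts Z B d).card ≤ M.outerArcs d + cs := by
    unfold outerArcs
    refine le_trans (Finset.card_le_card fun x hx => ?_) (Finset.card_union_le _ _)
    rw [Finset.mem_union, Finset.mem_filter]
    exact (M.starts_subset hZ.1 hd hx).imp And.left id
  have h4 : 4 ≤ M.innerArcs d + (M.starts Z B d).card := by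
    by_contra hlt
    have := Nat.mul_le_mul_left (M.len d - 1)
      (show M.innerArcs d + (M.starts Z B d).card ≤ 3 by omega)
    rw [mul_add] at this
    omega
  have hκ := M.κ_le hd
  have hee : (0 : ℚ) ≤ M.outerCorners d := Nat.cast_nonneg _
  have hκ2 : M.κ d ≤ 2 + cs - M.outerArcs d := by
    have h5 : 4 ≤ M.innerArcs d + (M.outerArcs d + cs) := by omega
    have h6 : (4 : ℚ) ≤ M.innerArcs d + (M.outerArcs d + cs) := by exact_mod_cast h5
    linarith
  rcases Nat.lt_or_ge 1 (M.breaks B d).card with hc | hc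
  · have h5 : (2 : ℚ) ≤ (M.breaks B d).card := by exact_mod_cast hc
    have h6 : (cs : ℚ) ≤ 1 := by exact_mod_cast hcs1
    have h7 : (0 : ℚ) ≤ M.outerArcs d := Nat.cast_nonneg _
    linarith
  rcases Nat.eq_zero_or_pos (M.outerArcs d) with he | he
  · rcases (M.opp M.O d).eq_empty_or_nonempty with h5 | ⟨x, hx⟩
    · have h6 : (7 : ℚ) ≤ M.innerArcs d := by exact_mod_cast M.seven_le_innerArcs hd h5
      have h7 : (0 : ℚ) ≤ M.outerArcs d := Nat.cast_nonneg _
      have h8 : (0 : ℚ) ≤ (M.breaks B d).card := Nat.cast_nonneg _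
      linarith
    · have := M.innerArcs_eq_zero hd hx he
      omega
  rcases Nat.eq_zero_or_pos (M.breaks B d).card with hc0 | hc0
  swap
  · have h5 : (1 : ℚ) ≤ (M.breaks B d).card := by exact_mod_cast hc0
    have h6 : (cs : ℚ) ≤ 1 := by exact_mod_cast hcs1
    have h7 : (1 : ℚ) ≤ M.outerArcs d := by exact_mod_cast he
    linarith
  have hcs0 : cs = 0 := by omega
  have hb := Finset.card_eq_zero.1 hc0
  rw [hc0, Nat.cast_zero, mul_zero]
  rcases le_or_gt 2 (M.outerArcs d) with h | h
  · have : (2 : ℚ) ≤ M.outerArcs d := by exact_mod_cast h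
    rw [hcs0] at hκ2
    push_cast at hκ2
    linarith
  have he1 : M.outerArcs d = 1 := by omega
  rw [he1] at hκ
  push_cast at hκ
  obtain ⟨x, hx⟩ : (M.opp M.O d).Nonempty := by
    rw [Finset.nonempty_iff_ne_empty]
    intro h5
    have := M.outerArcs_eq_zero h5
    omega
  have hxf := (M.mem_opp.1 hx).1
  rcases hO _ (M.mem_opp.1 hx).2 with hx' | hx'
  · have h5 := M.opp_eq_of_outerArcs_eq_one hZ hd hb he1 (M.mem_opp.2 ⟨hxf, hx'⟩)
    have h6 : 6 ≤ M.innerArcs d := by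
      by_contra hlt
      have := Nat.mul_le_mul_left (M.len d - 1)
        (show M.innerArcs d + (M.starts Z B d).card ≤ 6 by omega)
      rw [mul_add] at this
      rw [h5] at hsum hZc
      omega
    have : (6 : ℚ) ≤ M.innerArcs d := by exact_mod_cast h6
    linarith
  · obtain ⟨h5, -, -⟩ := M.four_le_of_geodesic hZ' hd hb (M.mem_opp.2 ⟨hxf, hx'⟩) (by omega) hg
    have : (4 : ℚ) ≤ M.innerArcs d := by exact_mod_cast h5
    linarith

/-- The total curvature is bounded by charges placed on darts. -/
theorem sum_κ_le {h : D → ℚ} (hκ : ∀ d, M.I d → M.κ d ≤ ∑ x ∈ M.face d, h x) :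
    ∑ d, ind (M.I d) * (M.κ d / M.len d) ≤ ∑ d, ind (M.I d) * h d := by
  rw [sum_ind_div_per M.φ M.I h fun x hx => (M.I_φ x).2 hx]
  refine Finset.sum_le_sum fun d _ => ?_
  by_cases hd : M.I d
  · rw [ind_true hd, one_mul, one_mul]
    exact div_le_div_of_nonneg_right (hκ d hd) (Nat.cast_nonneg _)
  · rw [ind_false hd, zero_mul, zero_mul]

theorem sum_breaks_le (B : Finset D) :
    ∑ d, ind (M.I d) * ind (M.deg d = 2 ∧ M.O (M.e d) ∧ M.σ d ∈ B) ≤ B.card := by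
  classical
  have h1 : ∀ d, ind (M.I d) * ind (M.deg d = 2 ∧ M.O (M.e d) ∧ M.σ d ∈ B) ≤ ind (M.σ d ∈ B) := by
    intro d
    rw [← ind_and]
    exact ind_mono fun h => h.2.2.2
  refine (Finset.sum_le_sum fun d _ => h1 d).trans ?_
  rw [Equiv.sum_comp M.σ fun d => ind (d ∈ B), sum_ind]
  simp

theorem card_breaks_eq (B : D → Prop) (d : D) : ((M.breaks B d).card : ℚ) =
    ∑ x ∈ M.face d, ind (M.deg x = 2 ∧ M.O (M.e x) ∧ B (M.σ x)) := by
  unfold breaks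
  rw [card_filter_eq_sum_ind]

end Diagram

end

section

section Metric

variable {S : Type} (P : C6Presentation S)

/-- The word metric with natural values. -/
noncomputable def C6Presentation.dist (x y : P.Grp) : ℕ := wordLength P.gens (x⁻¹ * y)

variable {P}

theorem wdist_eq (x y : P.Grp) : wdist P.gens x y = P.dist x y := rfl

theorem exists_word_of_list (l : List P.Grp) (h : ∀ x ∈ l, x ∈ P.gens ∨ x⁻¹ ∈ P.gens) :
    ∃ w : Word S, w.length = l.length ∧ P.elt w = l.prod := by
  induction l with
  | nil => exact ⟨[], rfl, rfl⟩
  | cons x l ih =>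
    obtain ⟨w, h1, h2⟩ := ih fun y hy => h y (by simp [hy])
    obtain ⟨a, ha⟩ : ∃ a, P.ltr a = x := by
      rcases h x (by simp) with ⟨s, hs⟩ | ⟨s, hs⟩
      · exact ⟨(s, true), by simpa [C6Presentation.ltr] using hs⟩
      · refine ⟨(s, false), ?_⟩
        have hs : (PresentedGroup.of s : P.Grp) = x⁻¹ := hs
        simp [C6Presentation.ltr, hs]
    exact ⟨a :: w, by simp [h1], by simp [ha, h2]⟩

theorem wordLength_elt_le (w : Word S) : wordLength P.gens (P.elt w) ≤ w.length := by
  refine Nat.sInf_le ⟨w.map P.ltr, by simp, ?_, ?_⟩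
  · intro x hx
    obtain ⟨⟨a, b⟩, -, rfl⟩ := List.mem_map.1 hx
    cases b
    · exact Or.inr ⟨a, by simp [C6Presentation.ltr]⟩
    · exact Or.inl ⟨a, by simp [C6Presentation.ltr]⟩
  · induction w with
    | nil => rfl
    | cons a w ih => simp [ih]

theorem exists_word (g : P.Grp) : ∃ w : Word S, P.elt w = g := by
  classical
  obtain ⟨u, rfl⟩ := QuotientGroup.mk_surjective g
  exact ⟨u.toWord, by rw [elt_eq_mk, wordVal_eq_mk, FreeGroup.mk_toWord]; rfl⟩

theorem exists_geodesic_word (g : P.Grp) :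
    ∃ w : Word S, P.elt w = g ∧ w.length = wordLength P.gens g := by
  obtain ⟨u, hu⟩ := exists_word g
  have hne : {n : ℕ | ∃ l : List P.Grp, l.length = n ∧
      (∀ x ∈ l, x ∈ P.gens ∨ x⁻¹ ∈ P.gens) ∧ l.prod = g}.Nonempty := by
    refine ⟨_, u.map P.ltr, rfl, ?_, ?_⟩
    · intro x hx
      obtain ⟨⟨a, b⟩, -, rfl⟩ := List.mem_map.1 hx
      cases b
      · exact Or.inr ⟨a, by simp [C6Presentation.ltr]⟩
      · exact Or.inl ⟨a, by simp [C6Presentation.ltr]⟩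
    · rw [← hu]
      clear hu
      induction u with
      | nil => rfl
      | cons a w ih => simp [ih]
  obtain ⟨l, h1, h2, h3⟩ := Nat.sInf_mem hne
  obtain ⟨w, h4, h5⟩ := exists_word_of_list l h2
  exact ⟨w, h5.trans h3, h4.trans h1⟩

theorem dist_self (x : P.Grp) : P.dist x x = 0 := by
  have := wordLength_elt_le (P := P) ([] : Word S)
  simp only [elt_nil, List.length_nil, nonpos_iff_eq_zero] at this
  rw [C6Presentation.dist, inv_mul_cancel, this]

theorem dist_comm (x y : P.Grp) : P.dist x y = P.dist y x := by
  have key : ∀ g : P.Grp, wordLength P.gens g⁻¹ ≤ wordLength P.gens g := by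
    intro g
    obtain ⟨w, h1, h2⟩ := exists_geodesic_word g
    rw [← h2, ← length_wordInv, ← h1, ← elt_wordInv]
    exact wordLength_elt_le _
  have h1 := key (x⁻¹ * y)
  have h2 := key (y⁻¹ * x)
  simp only [mul_inv_rev, inv_inv] at h1 h2
  exact le_antisymm h2 h1

theorem dist_triangle (x y z : P.Grp) : P.dist x z ≤ P.dist x y + P.dist y z := by
  obtain ⟨u, h1, h2⟩ := exists_geodesic_word (x⁻¹ * y)
  obtain ⟨v, h3, h4⟩ := exists_geodesic_word (y⁻¹ * z)
  unfold C6Presentation.dist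
  rw [← h2, ← h4, ← List.length_append]
  have : x⁻¹ * z = P.elt (u ++ v) := by rw [elt_append, h1, h3]; group
  rw [this]
  exact wordLength_elt_le _

theorem dist_mul_left (g x y : P.Grp) : P.dist (g * x) (g * y) = P.dist x y := by
  unfold C6Presentation.dist
  congr 1
  group

theorem dist_mul_elt_le (x : P.Grp) (w : Word S) : P.dist x (x * P.elt w) ≤ w.length := by
  unfold C6Presentation.dist
  rw [inv_mul_cancel_left]
  exact wordLength_elt_le w

theorem eq_of_dist_eq_zero {x y : P.Grp} (h : P.dist x y = 0) : x = y := by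
  obtain ⟨w, h1, h2⟩ := exists_geodesic_word (x⁻¹ * y)
  have : w = [] := List.eq_nil_of_length_eq_zero (h2.trans h)
  rw [this, elt_nil] at h1
  exact (inv_mul_eq_one.1 h1.symm)

end Metric

section

variable {S : Type} {P : C6Presentation S} {D : Type} [Fintype D] [DecidableEq D]
  {lab : D → S × Bool} {pos : D → P.Grp}

namespace Cfg

variable (c : Cfg P lab pos)

theorem dist_pos_iterate_le (d : D) (n : ℕ) : P.dist (pos d) (pos (c.φ^[n] d)) ≤ n := by
  rw [c.pos_chain]
  refine (dist_mul_elt_le _ _).trans ?_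
  simp only [List.length_map, List.length_range, le_refl]

theorem two_mul_dist_le {x y : D} (h : c.φ.SameCycle x y) :
    2 * P.dist (pos x) (pos y) ≤ per c.φ x := by
  obtain ⟨k, hk, rfl⟩ := sameCycle_iff.1 h
  have h1 := c.dist_pos_iterate_le x k
  have h2 := c.dist_pos_iterate_le (c.φ^[k] x) (per c.φ x - k)
  rw [← Function.iterate_add_apply, Nat.sub_add_cancel hk.le, iterate_per, dist_comm] at h2
  omega

theorem pos_e' (d : D) : pos (c.e d) = pos (c.φ d) := by rw [c.pos_e, c.pos_φ]

theorem pos_φ_e (d : D) : pos (c.φ (c.e d)) = pos d := c.pos_σ d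

/-- A set of consecutive darts of the face of `x₀`. -/
def Arc (x₀ : D) (lo hi : ℕ) (d : D) : Prop := ∃ i, lo ≤ i ∧ i < hi ∧ c.φ^[i] x₀ = d

/-- The boundary of the face of `x₀` is geodesic between two indices. -/
def GeodArc (x₀ : D) (lo hi : ℕ) : Prop := ∀ i j, lo ≤ i → i ≤ j → j ≤ hi →
  P.dist (pos (c.φ^[i] x₀)) (pos (c.φ^[j] x₀)) = j - i

theorem two_mul_card_arc_le {x₀ : D} {lo hi : ℕ} (hg : c.GeodArc x₀ lo hi) {d : D}
    {T : Finset D} (hT : ∀ x ∈ T, c.φ.SameCycle d x ∧ c.Arc x₀ lo hi (c.e x)) :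
    2 * T.card ≤ per c.φ d := by
  classical
  rcases T.eq_empty_or_nonempty with rfl | hne
  · simp
  have h1 : ∀ x ∈ T, ∃ i, lo ≤ i ∧ i < hi ∧ c.φ^[i] x₀ = c.e x := fun x hx => (hT x hx).2
  choose! f hf using h1
  obtain ⟨a, ha, ha'⟩ := Finset.exists_min_image T f hne
  obtain ⟨b, hb, hb'⟩ := Finset.exists_max_image T f hne
  have hcard : T.card ≤ f b + 1 - f a := by
    rw [← Nat.card_Icc, ← Finset.card_image_of_injOn (f := f)]
    · refine Finset.card_le_card fun i hi => ?_
      obtain ⟨x, hx, rfl⟩ := Finset.mem_image.1 hi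
      exact Finset.mem_Icc.2 ⟨ha' x hx, hb' x hx⟩
    · intro x hx y hy hxy
      have h2 := (hf x hx).2.2
      have hxy : f x = f y := hxy
      rw [hxy, (hf y hy).2.2] at h2
      exact c.e.injective h2.symm
  have h3 := hg (f a) (f b + 1) (hf a ha).1 ((ha' b hb).trans (Nat.le_succ _)) (hf b hb).2.1
  rw [Function.iterate_succ_apply', (hf a ha).2.2, (hf b hb).2.2, c.pos_φ_e, c.pos_e'] at h3
  have h4 : c.φ.SameCycle (c.φ a) b :=
    Perm.sameCycle_apply_left.2 ((hT a ha).1.symm.trans (hT b hb).1)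
  have h5 := c.two_mul_dist_le h4
  rw [per_apply, ← per_eq_of_sameCycle (hT a ha).1] at h5
  omega

theorem e_eq_of_deg_one {y : D} (h : per c.σ (c.φ y) = 1) : c.e (c.φ y) = y := by
  have h1 := iterate_per c.σ (c.φ y)
  rw [h] at h1
  exact c.φ.injective h1

theorem not_spur_of_geodArc {x₀ : D} {lo hi i : ℕ} (hg : c.GeodArc x₀ lo hi) (h1 : lo ≤ i)
    (h2 : i + 2 ≤ hi) : per c.σ (c.φ^[i + 1] x₀) ≠ 1 := by
  intro h
  rw [Function.iterate_succ_apply'] at h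
  have h3 := hg i (i + 2) h1 (by omega) h2
  have h4 := c.e_eq_of_deg_one h
  rw [Function.iterate_succ_apply', Function.iterate_succ_apply', ← c.pos_e', h4, dist_self] at h3
  omega

end Cfg

namespace IsFilling

variable {c : Cfg P lab pos} {l₀ : List D} {w : Word S} {g : P.Grp}

theorem exists_base (hF : IsFilling c l₀ w g) (hw : w ≠ []) : ∃ x₀, l₀ = faceList c.φ x₀ ∧
    per c.φ x₀ = w.length ∧ (∀ i < w.length, w[i]? = some (lab (c.φ^[i] x₀))) ∧
    ∀ i ≤ w.length, pos (c.φ^[i] x₀) = g * P.elt (w.take i) := by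
  obtain ⟨x₀, t, rfl⟩ : ∃ x t, l₀ = x :: t := by
    cases l₀ with
    | nil => exact absurd hF.word.symm hw
    | cons x t => exact ⟨x, t, rfl⟩
  have h1 := hF.face.eq_faceList
  have h2 : per c.φ x₀ = w.length := by
    rw [← hF.word, List.length_map, h1, length_faceList]
  have h3 : ∀ i < w.length, w[i]? = some (lab (c.φ^[i] x₀)) := by
    intro i hi
    rw [← hF.word, h1, getElem?_map_faceList lab (h2 ▸ hi)]
  refine ⟨x₀, h1, h2, h3, fun i hi => ?_⟩
  rw [c.pos_chain, hF.base x₀ rfl]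
  congr 2
  refine List.ext_getElem? fun j => ?_
  rw [List.getElem?_take]
  split
  · rename_i hj
    rw [h3 j (by omega), List.getElem?_map, List.getElem?_map, List.getElem?_range hj]
    rfl
  · rw [List.getElem?_eq_none]
    simp only [List.length_map, List.length_range]
    omega

theorem isSide (hF : IsFilling c l₀ w g) (hmin : ∀ m, FillSize P w g m → c.size l₀ ≤ m)
    (hne : l₀ ≠ []) {x₀ : D} (hl : l₀ = faceList c.φ x₀) {B : D → Prop} {lo hi : ℕ}
    (h0 : B x₀) (h1 : B (c.φ^[lo] x₀)) (h2 : B (c.φ^[hi] x₀)) (hhi : hi ≤ per c.φ x₀) :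
    (hF.diagram hmin hne).IsSide (c.Arc x₀ lo hi) B := by
  have hO : ∀ z, z ∈ l₀ ↔ ∃ i < per c.φ x₀, c.φ^[i] x₀ = z := fun z => by
    rw [hl, mem_faceList, sameCycle_iff]
  refine ⟨fun z hz => ?_, fun z hz hb => ?_⟩
  · obtain ⟨i, -, h4, h5⟩ := hz
    exact (hO z).2 ⟨i, by omega, h5⟩
  · change ¬ B (c.φ z) at hb
    change c.Arc x₀ lo hi (c.φ z) ↔ _
    obtain ⟨i, hi', rfl⟩ := (hO z).1 hz
    rw [← Function.iterate_succ_apply' c.φ i x₀] at hb ⊢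
    have hne1 : i + 1 ≠ lo := fun h => hb (by rw [Nat.succ_eq_add_one, h]; exact h1)
    have hne2 : i + 1 ≠ hi := fun h => hb (by rw [Nat.succ_eq_add_one, h]; exact h2)
    have hne3 : i + 1 < per c.φ x₀ := by
      refine lt_of_le_of_ne hi' fun h => hb ?_
      rw [Nat.succ_eq_add_one, h, iterate_per]
      exact h0
    constructor
    · rintro ⟨j, h3, h4, h5⟩
      have := iterate_inj_lt (by omega) hne3 h5
      exact ⟨i, by omega, by omega, rfl⟩
    · rintro ⟨j, h3, h4, h5⟩
      have := iterate_inj_lt (by omega) hi' h5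
      exact ⟨i + 1, by omega, by omega, rfl⟩

theorem two_mul_card_opp_le (hF : IsFilling c l₀ w g)
    (hmin : ∀ m, FillSize P w g m → c.size l₀ ≤ m) (hne : l₀ ≠ []) {x₀ : D} {lo hi : ℕ}
    (hg : c.GeodArc x₀ lo hi) (d : D) :
    2 * ((hF.diagram hmin hne).opp (c.Arc x₀ lo hi) d).card ≤ (hF.diagram hmin hne).len d := by
  have key := c.two_mul_card_arc_le hg (d := d) (T := (hF.diagram hmin hne).opp (c.Arc x₀ lo hi) d)
    fun x hx => ⟨(hF.diagram hmin hne).mem_face.1 ((hF.diagram hmin hne).mem_opp.1 hx).1,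
      ((hF.diagram hmin hne).mem_opp.1 hx).2⟩
  exact key

end IsFilling

end

end

section

section

variable {S : Type} {P : C6Presentation S}

theorem exists_length_lt_of_wordLength_ne {w : Word S} (h : wordLength P.gens (P.elt w) ≠ w.length) :
    ∃ v : Word S, P.elt v = P.elt w ∧ v.length < w.length := by
  obtain ⟨v, h1, h2⟩ := exists_geodesic_word (P.elt w)
  exact ⟨v, h1, by have := wordLength_elt_le (P := P) w; omega⟩

/-- Subwords of geodesic words are geodesic. -/
theorem dist_elt_take {w : Word S} (hw : wordLength P.gens (P.elt w) = w.length) (g : P.Grp)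
    {i j : ℕ} (hij : i ≤ j) (hj : j ≤ w.length) :
    P.dist (g * P.elt (w.take i)) (g * P.elt (w.take j)) = j - i := by
  have key : ∀ i j, i ≤ j → j ≤ w.length →
      P.dist (P.elt (w.take i)) (P.elt (w.take j)) ≤ j - i := by
    intro i j hij hj
    have h1 : w.take j = w.take i ++ (w.drop i).take (j - i) := by
      rw [← List.take_add, Nat.add_sub_cancel' hij]
    rw [h1, elt_append]
    refine (dist_mul_elt_le _ _).trans ?_
    simp only [List.length_take]
    omega
  rw [dist_mul_left]
  have h1 := key 0 i (by omega) (by omega)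
  have h2 := key i j hij hj
  have h3 := key j w.length hj le_rfl
  have h4 := dist_triangle (P.elt (w.take 0)) (P.elt (w.take i)) (P.elt (w.take w.length))
  have h5 := dist_triangle (P.elt (w.take i)) (P.elt (w.take j)) (P.elt (w.take w.length))
  have h6 : P.dist (P.elt (w.take 0)) (P.elt (w.take w.length)) = w.length := by
    rw [List.take_zero, List.take_length, elt_nil, C6Presentation.dist, inv_one, one_mul, hw]
  omega

theorem wordLength_inv (g : P.Grp) : wordLength P.gens g⁻¹ = wordLength P.gens g := by
  have := dist_comm g 1
  simpa [C6Presentation.dist] using this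

variable {D : Type} [Fintype D] [DecidableEq D]
  {lab : D → S × Bool} {pos : D → P.Grp}

theorem Cfg.geodArc {c : Cfg P lab pos} {x₀ : D} {u v w : Word S} {g : P.Grp}
    (h : ∀ i ≤ (u ++ v ++ w).length, pos (c.φ^[i] x₀) = g * P.elt ((u ++ v ++ w).take i))
    (hv : wordLength P.gens (P.elt v) = v.length) :
    c.GeodArc x₀ u.length (u.length + v.length) := by
  have key : ∀ i, u.length ≤ i → i ≤ u.length + v.length →
      pos (c.φ^[i] x₀) = g * P.elt u * P.elt (v.take (i - u.length)) := by
    intro i h1 h2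
    rw [h i (by simp only [List.length_append]; omega), List.append_assoc, List.take_append,
      List.take_of_length_le h1, elt_append, List.take_append_of_le_length (by omega), mul_assoc]
  intro i j h1 h2 h3
  rw [key i h1 (by omega), key j (by omega) h3, dist_elt_take hv _ (by omega) (by omega)]
  omega

theorem IsFilling.exists_absorb {c : Cfg P lab pos} {l₀ : List D} {w : Word S} {g : P.Grp}
    (hF : IsFilling c l₀ w g) {p₁ p₂ p₃ q₁ q₂ q₃ : List D} (hp : IsFace c.φ (p₁ ++ p₂ ++ p₃))
    (hq : IsFace c.φ (q₁ ++ q₂ ++ q₃)) (hq' : ∀ z, z ∈ q₁ ++ q₂ ++ q₃ ↔ z ∈ l₀)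
    (hd : (p₁ ++ p₂ ++ p₃).Disjoint (q₁ ++ q₂ ++ q₃)) {x y : D}
    (hx : x ∈ (p₁ ++ p₂ ++ p₃).head?) (hy : y ∈ (q₁ ++ q₂ ++ q₃).head?)
    (hxy : c.σ.SameCycle x y) (hx' : ¬ c.Dead x) (h₁ : wordVal ((p₃ ++ q₁).map lab) = 1)
    (h₂ : wordVal ((q₃ ++ p₁).map lab) = 1) :
    ∃ m < c.size l₀, ∃ g', FillSize P ((p₂ ++ q₂).map lab) g' m := by
  obtain ⟨c₁, he, f₁, hf⟩ := c.exists_merge hp hq hd hx hy hxy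
  have hm : ∀ z, z ∈ p₁ ++ p₂ ++ p₃ ++ (q₁ ++ q₂ ++ q₃) ↔
      z ∈ (p₃ ++ q₁) ++ (q₂ ++ q₃ ++ p₁ ++ p₂) := fun z => by
    simp only [List.mem_append]
    tauto
  have hf' : IsFace c₁.φ ((p₃ ++ q₁) ++ (q₂ ++ q₃ ++ p₁ ++ p₂)) := by
    have := isFace_append_comm (a := p₁ ++ p₂) (b := p₃ ++ q₁ ++ q₂ ++ q₃) (by simpa using hf)
    simpa using this
  obtain ⟨c₂, f₂, d₂, d₂', hf₂⟩ := c₁.exists_collapse hf' h₁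
  have hf₂' : IsFace c₂.φ ((q₃ ++ p₁) ++ (p₂ ++ q₂)) := by
    have := isFace_append_comm (a := q₂) (b := q₃ ++ p₁ ++ p₂) (by simpa using hf₂)
    simpa using this
  obtain ⟨c₃, f₃, d₃, d₃', hf₃⟩ := c₂.exists_collapse hf₂' h₂
  have hout : ∀ z, z ∉ p₁ ++ p₂ ++ p₃ → z ∉ l₀ → z ∉ p₁ ++ p₂ ++ p₃ ++ (q₁ ++ q₂ ++ q₃) :=
    fun z h1 h2 h3 => (List.mem_append.1 h3).elim h1 fun h => h2 ((hq' z).1 h)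
  have hout₂ : ∀ z, z ∉ p₁ ++ p₂ ++ p₃ → z ∉ l₀ → z ∉ (q₃ ++ p₁) ++ (p₂ ++ q₂) := by
    intro z h1 h2 h3
    rw [← hq'] at h2
    simp only [List.mem_append] at h1 h2 h3
    tauto
  have fr : ∀ z, z ∉ p₁ ++ p₂ ++ p₃ → z ∉ l₀ → c₃.φ z = c.φ z := by
    intro z h1 h2
    have h3 := hout z h1 h2
    rw [f₃ z (hout₂ z h1 h2), f₂ z fun h => h3 ((hm z).2 h), f₁ z h3]
  have hdead : ∀ z, z ∉ p₁ ++ p₂ ++ p₃ → z ∉ l₀ → c.Dead z → c₃.Dead z := by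
    intro z h1 h2 h3
    have h4 := hout z h1 h2
    refine d₃' z (hout₂ z h1 h2) (d₂' z (fun h => h4 ((hm z).2 h)) ?_)
    refine h3.of_eq (f₁ z h4) (f₁ _ fun h => h4 ?_) (by rw [he])
    rcases List.mem_append.1 h with h | h
    · exact List.mem_append_left _ ((h3.e_mem hp).1 h)
    · exact List.mem_append_right _ ((h3.e_mem hq).1 h)
  have hin : ∀ z, z ∉ p₂ ++ q₂ → (z ∈ p₁ ++ p₂ ++ p₃ ∨ z ∈ l₀) → c₃.Dead z := by
    intro z h1 h2
    by_cases h3 : z ∈ q₃ ++ p₁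
    · exact d₃ z h3
    · refine d₃' z ?_ (d₂ z ?_)
      · rw [List.mem_append]
        tauto
      · rw [← hq'] at h2
        simp only [List.mem_append] at h1 h2 h3 ⊢
        tauto
  have hxm := List.mem_of_mem_head? hx
  have hxl : x ∉ l₀ := fun h => hd hxm ((hq' x).2 h)
  obtain ⟨g', hg'⟩ : ∃ g', ∀ d ∈ (p₂ ++ q₂).head?, pos d = g' := by
    cases h : (p₂ ++ q₂).head? with
    | none => exact ⟨1, by simp⟩
    | some a => exact ⟨pos a, by simp⟩
  refine ⟨c₃.size (p₂ ++ q₂), ?_, g', D, inferInstance, inferInstance, lab, pos, c₃, p₂ ++ q₂,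
    ⟨hf₃, rfl, hg', ?_⟩, rfl⟩
  · refine Cfg.size_lt ?_ ⟨hxl, hx'⟩ fun h => hin x h (Or.inl hxm)
    intro z hz hzd
    have h1 : z ∉ p₁ ++ p₂ ++ p₃ := fun h => hzd (hin z hz (Or.inl h))
    have h2 : z ∉ l₀ := fun h => hzd (hin z hz (Or.inr h))
    exact ⟨h2, fun h => hzd (hdead z h1 h2 h)⟩
  · intro z hz
    by_cases h1 : z ∈ p₁ ++ p₂ ++ p₃
    · exact Or.inl (hin z hz (Or.inl h1))
    by_cases h2 : z ∈ l₀
    · exact Or.inl (hin z hz (Or.inr h2))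
    rcases hF.rel z h2 with h | ⟨m, m1, m2, m3⟩
    · exact Or.inl (hdead z h1 h2 h)
    · refine Or.inr ⟨m, m1.congr fun u hu => ?_, m2, m3⟩
      have hzu := (m1.sameCycle hu).2 m2
      exact fr u (fun h => h1 ((hp.sameCycle h).1 hzu)) fun h => h2 ((hF.mem_l₀_iff hzu).1 h)

end

end

section

section

variable {S : Type} {P : C6Presentation S} {D : Type} [Fintype D] [DecidableEq D]
  {lab : D → S × Bool} {pos : D → P.Grp}

theorem faceList_head (φ : Perm D) (d : D) : d ∈ (faceList φ d).head? := by
  have := getElem?_map_faceList (φ := φ) (d := d) id (i := 0) (per_pos _ _)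
  rw [List.head?_eq_getElem?]
  simpa using this

namespace IsFilling

variable {c : Cfg P lab pos} {l₀ : List D} {g : P.Grp} {s t v : Word S}

/-- Absorbing a relator face into the outer face along a boundary arc of the same relator. -/
theorem exists_absorb_relator (hF : IsFilling c l₀ (s ++ v) g)
    {x₀ y : D} (hl : l₀ = faceList c.φ x₀) {j : ℕ} (hj : j < s.length)
    (hy : y ∉ l₀) (hyd : ¬ c.Dead y) (hyj : c.e y = c.φ^[j] x₀)
    (hu : (faceList c.φ y).map lab = wordInv ((s ++ t).rotate (j + 1))) :
    ∃ m < c.size l₀, ∃ g', FillSize P (wordInv t ++ v) g' m := by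
  have hrot : ∀ z : Word S, (s ++ z).rotate (j + 1) = s.drop (j + 1) ++ z ++ s.take (j + 1) := by
    intro z
    rw [List.rotate_eq_drop_append_take (by simp only [List.length_append]; omega),
      List.drop_append_of_le_length (by omega), List.take_append_of_le_length (by omega)]
  have hx₁ : c.φ (c.e y) = c.φ^[j + 1] x₀ := by rw [hyj, ← Function.iterate_succ_apply' c.φ]
  rw [hrot, wordInv_append, wordInv_append, ← List.append_assoc] at hu
  obtain ⟨p₁₂, p₃, hp, hp₁₂, hp₃⟩ := List.map_eq_append_iff.1 hu
  obtain ⟨p₁, p₂, rfl, hp₁, hp₂⟩ := List.map_eq_append_iff.1 hp₁₂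
  have hv : (faceList c.φ (c.φ^[j + 1] x₀)).map lab =
      s.drop (j + 1) ++ v ++ s.take (j + 1) := by
    rw [map_faceList_iterate, ← hl, hF.word, hrot]
  obtain ⟨q₁₂, q₃, hq, hq₁₂, hq₃⟩ := List.map_eq_append_iff.1 hv
  obtain ⟨q₁, q₂, rfl, hq₁, hq₂⟩ := List.map_eq_append_iff.1 hq₁₂
  have hmem : ∀ z, z ∈ faceList c.φ (c.φ^[j + 1] x₀) ↔ z ∈ l₀ := by
    intro z
    rw [hl, mem_faceList, mem_faceList]
    have := sameCycle_iterate c.φ x₀ (j + 1)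
    exact ⟨fun h => this.trans h, fun h => this.symm.trans h⟩
  have := hF.exists_absorb (p₁ := p₁) (p₂ := p₂) (p₃ := p₃) (q₁ := q₁) (q₂ := q₂) (q₃ := q₃)
    (hp ▸ isFace_faceList _ _) (hq ▸ isFace_faceList _ _) (by rw [← hq]; exact hmem)
    (x := y) (y := c.φ^[j + 1] x₀) ?_ (hp ▸ faceList_head _ _) (hq ▸ faceList_head _ _) ?_ hyd
    (by rw [List.map_append, hp₃, hq₁, wordVal_append, wordVal_wordInv, inv_mul_cancel])
    (by rw [List.map_append, hq₃, hp₁, wordVal_append, wordVal_wordInv, mul_inv_cancel])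
  · rwa [List.map_append, hp₂, hq₂] at this
  · rw [← hp, ← hq]
    intro z h1 h2
    exact hy ((hF.mem_l₀_iff (mem_faceList.1 h1)).2 ((hmem z).1 h2))
  · rw [← hx₁]
    exact Perm.sameCycle_apply_right.2 (Perm.SameCycle.refl _ _)

end IsFilling

/-- A minimal relator bigon has no short relator arcs along its first side. -/
theorem relator_piece {c : Cfg P lab pos} {l₀ : List D} {g : P.Grp} {s t v : Word S}
    (hF : IsFilling c l₀ (s ++ v) g) (hr : s ++ t ∈ P.rels)
    (hno : ∀ m g', FillSize P (wordInv t ++ v) g' m → c.size l₀ ≤ m)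
    {x₀ y : D} (hl : l₀ = faceList c.φ x₀) (hper : per c.φ x₀ = (s ++ v).length)
    (hw : ∀ i < (s ++ v).length, (s ++ v)[i]? = some (lab (c.φ^[i] x₀)))
    (hy : y ∉ l₀) (hyd : ¬ c.Dead y) {L : ℕ} (h1 : 1 ≤ L) (hL : L ≤ per c.φ y)
    (hZ : ∀ i < L, c.Arc x₀ 0 s.length (c.e (c.φ^[i] y)))
    (hdeg : ∀ i, 1 ≤ i → i < L → per c.σ (c.φ^[i] y) = 2 ∧ c.σ (c.φ^[i] y) ≠ x₀ ∧
      c.σ (c.φ^[i] y) ≠ c.φ^[s.length] x₀) : 6 * L < per c.φ y := by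
  obtain ⟨j, -, hj, hyj⟩ := hZ 0 (by omega)
  have hn : s.length ≤ per c.φ x₀ := by rw [hper, List.length_append]; omega
  have key : ∀ i < L, i ≤ j ∧ c.e (c.φ^[i] y) = c.φ^[j - i] x₀ := by
    intro i
    induction i with
    | zero => exact fun _ => ⟨by omega, hyj.symm⟩
    | succ i ih =>
      intro hi
      obtain ⟨h2, h3⟩ := ih (by omega)
      obtain ⟨k, -, h4, h5⟩ := hZ (i + 1) hi
      obtain ⟨h6, h7, h8⟩ := hdeg (i + 1) (by omega) hi
      rw [c.σ_apply, ← h5, ← Function.iterate_succ_apply' c.φ] at h7 h8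
      have h9 : c.φ (c.e (c.φ^[i + 1] y)) = c.e (c.φ^[i] y) := by
        rw [Function.iterate_succ_apply'] at h6 ⊢
        exact c.φ_e_of_deg h6
      rw [h3, ← h5, ← Function.iterate_succ_apply' c.φ] at h9
      have h10 : k.succ ≠ s.length := fun h => h8 (by rw [h])
      have h11 : k.succ ≠ per c.φ x₀ := fun h => h7 (by rw [h, iterate_per])
      have h12 := iterate_inj_lt (by omega) (by omega) h9
      refine ⟨by omega, ?_⟩
      rw [← h5]
      congr 1
      omega
  have hur := hF.faceWord_mem hy hyd
  have hvr := P.inv_mem _ (P.rotate_mem _ hr (j + 1))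
  by_cases huv : (faceList c.φ y).map lab = wordInv ((s ++ t).rotate (j + 1))
  · exfalso
    obtain ⟨m, hm, g', hm'⟩ := hF.exists_absorb_relator hl hj hy hyd hyj.symm huv
    exact absurd (hno m g' hm') (by omega)
  · have := (P.six_mul_lt hur hvr huv (L := L) (by simpa using hL) fun i hi => ?_).1
    · simpa using this
    · obtain ⟨h2, h3⟩ := key i hi
      have hlen : ((s ++ t).rotate (j + 1)).length = s.length + t.length := by simp
      rw [getElem?_map_faceList lab (by omega), getElem?_wordInv _ (by omega), hlen,
        List.getElem?_rotate (by simp only [List.length_append]; omega), List.length_append,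
        show (s.length + t.length - 1 - i + (j + 1)) = (j - i) + (s.length + t.length) by omega,
        Nat.add_mod_right, Nat.mod_eq_of_lt (by omega), List.getElem?_append_left (by omega)]
      have h4 := hw (j - i) (by simp only [List.length_append]; omega)
      rw [List.getElem?_append_left (by omega)] at h4
      rw [h4, ← h3, Option.map_some, c.lab_e, linv_linv]

end

end

section

section

variable {S : Type} {P : C6Presentation S}

/-- A relator whose subdivision is short-cut by the word `h`, with a filling of the resulting
bigon. -/
structure BadBigon (P : C6Presentation S) (s t h : Word S) (m : ℕ) : Prop where
  rel : s ++ t ∈ P.rels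
  elt_eq : P.elt h = P.elt s
  lt_left : h.length < s.length
  lt_right : h.length < t.length
  filling : ∃ g, FillSize P (s ++ wordInv h) g m

theorem BadBigon.exists_of {s t h : Word S} (h1 : s ++ t ∈ P.rels) (h2 : P.elt h = P.elt s)
    (h3 : h.length < s.length) (h4 : h.length < t.length) : ∃ m, BadBigon P s t h m := by
  obtain ⟨m, hm⟩ := exists_filling (P := P) (w := s ++ wordInv h)
    (fun h => by simp only [List.append_eq_nil_iff] at h; simp [h.1] at h3)
    (by rw [elt_append, elt_wordInv, h2, mul_inv_cancel]) 1
  exact ⟨m, h1, h2, h3, h4, 1, hm⟩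

theorem BadBigon.flip {s t h : Word S} {m m' : ℕ} (hb : BadBigon P s t h m)
    (hf : ∃ g, FillSize P (wordInv t ++ wordInv h) g m') :
    BadBigon P (wordInv t) (wordInv s) h m' := by
  refine ⟨?_, ?_, by simpa using hb.lt_right, by simpa using hb.lt_left, hf⟩
  · rw [← wordInv_append]
    exact P.inv_mem _ hb.rel
  · have := elt_rel P hb.rel
    rw [elt_append] at this
    rw [hb.elt_eq, elt_wordInv, eq_inv_of_mul_eq_one_left this]

theorem BadBigon.dropLast {s t h : Word S} {m : ℕ} {a : S × Bool}
    (hb : BadBigon P (s ++ [a]) t (h ++ [a]) m) : ∃ m', BadBigon P s (a :: t) h m' := by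
  refine BadBigon.exists_of (by simpa using hb.rel) ?_ ?_ ?_
  · have := hb.elt_eq
    rwa [elt_append, elt_append, mul_left_inj] at this
  · simpa using hb.lt_left
  · have := hb.lt_right
    simp only [List.length_append, List.length_cons] at this ⊢
    omega

theorem BadBigon.tail {s t h : Word S} {m : ℕ} {a : S × Bool}
    (hb : BadBigon P (a :: s) t (a :: h) m) : ∃ m', BadBigon P s (t ++ [a]) h m' := by
  refine BadBigon.exists_of ?_ ?_ ?_ ?_
  · simpa using P.rotate_mem _ hb.rel 1
  · have := hb.elt_eq
    rwa [elt_cons, elt_cons, mul_right_inj] at this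
  · simpa using hb.lt_left
  · have := hb.lt_right
    simp only [List.length_append, List.length_cons] at this ⊢
    omega

theorem BadBigon.false_of_min {s t h : Word S} {m : ℕ} (hb : BadBigon P s t h m)
    (hk : ∀ s' t' h' m', BadBigon P s' t' h' m' → h.length ≤ h'.length)
    (hm : ∀ s' t' h' m', BadBigon P s' t' h' m' → h'.length = h.length → m ≤ m') : False := by
  classical
  have hgeo : wordLength P.gens (P.elt h) = h.length := by
    by_contra hne
    obtain ⟨v, h1, h2⟩ := exists_length_lt_of_wordLength_ne hne
    obtain ⟨m', h3⟩ := BadBigon.exists_of hb.rel (h1.trans hb.elt_eq) (h2.trans hb.lt_left)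
      (h2.trans hb.lt_right)
    have := hk _ _ _ _ h3
    omega
  have hgeo' : wordLength P.gens (P.elt (wordInv h)) = (wordInv h).length := by
    rw [elt_wordInv, wordLength_inv, length_wordInv, hgeo]
  have hred : Reduced (s ++ t) :=
    (List.isChain_append.1 (P.cyclically_reduced _ hb.rel)).1
  obtain ⟨g, D, _, _, lab, pos, c, l₀, hF, hsize⟩ := hb.filling
  have hwne : s ++ wordInv h ≠ [] := fun h => by
    have := hb.lt_left
    simp [(List.append_eq_nil_iff.1 h).1] at this
  obtain ⟨x₀, hl, hper, hlab, hpos⟩ := hF.exists_base hwne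
  have hne : l₀ ≠ [] := by
    rintro rfl
    exact hwne hF.word.symm
  have hmin : ∀ m', FillSize P (s ++ wordInv h) g m' → c.size l₀ ≤ m' := fun m' hm' =>
    hsize ▸ hm _ _ _ _ ⟨hb.rel, hb.elt_eq, hb.lt_left, hb.lt_right, g, hm'⟩ rfl
  have hno : ∀ m' g', FillSize P (wordInv t ++ wordInv h) g' m' → c.size l₀ ≤ m' :=
    fun m' g' hm' => hsize ▸ hm _ _ _ _ (hb.flip ⟨g', hm'⟩) rfl
  set n := (s ++ wordInv h).length with hn
  have hnl : n = s.length + h.length := by rw [hn, List.length_append, length_wordInv]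
  have hslt := hb.lt_left
  have harc : c.GeodArc x₀ s.length n := by
    have := Cfg.geodArc (c := c) (u := s) (v := wordInv h) (w := []) (g := g) (x₀ := x₀)
      (by simpa [hn] using hpos) hgeo'
    rwa [length_wordInv, ← hnl] at this
  set M := hF.diagram hmin hne with hM
  set B : Finset D := {x₀, c.φ^[s.length] x₀} with hB
  have hB0 : x₀ ∈ B := by simp [hB]
  have hB1 : c.φ^[s.length] x₀ ∈ B := by simp [hB]
  have hper0 : c.φ^[n] x₀ = x₀ := by rw [← hper, iterate_per]
  have hOi : ∀ x, M.O x ↔ ∃ i, i < n ∧ c.φ^[i] x₀ = x := fun x => by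
    change x ∈ l₀ ↔ _
    rw [hl, mem_faceList, sameCycle_iff, hper]
  have hZ : M.IsSide (c.Arc x₀ 0 s.length) (· ∈ B) :=
    hF.isSide hmin hne hl hB0 hB0 hB1 (by omega)
  have hZ' : M.IsSide (c.Arc x₀ s.length n) (· ∈ B) :=
    hF.isSide hmin hne hl hB0 hB1 (by rw [hper0]; exact hB0) hper.ge
  have hκ : ∀ d, M.I d → M.κ d ≤
      ∑ x ∈ M.face d, 2 * ind (M.deg x = 2 ∧ M.O (M.e x) ∧ M.σ x ∈ B) := by
    intro d hd
    rw [← Finset.mul_sum, ← M.card_breaks_eq (· ∈ B)]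
    refine M.κ_le_two_mul_breaks hZ hZ' ?_ ?_ hd ?_ (hF.two_mul_card_opp_le hmin hne harc d) ?_
    · intro x hx
      obtain ⟨i, hi, hi'⟩ := (hOi x).1 hx
      rcases lt_or_ge i s.length with h1 | h1
      · exact Or.inl ⟨i, by omega, h1, hi'⟩
      · exact Or.inr ⟨i, h1, hi, hi'⟩
    · rintro x ⟨i, -, hi, hi'⟩ ⟨j, hj, hj', hj''⟩
      have := iterate_inj_lt (by omega) (by omega) (hi'.trans hj''.symm)
      omega
    · intro y hy L h1 h2 h3 h4
      have hIy := M.I_of_mem_face hd hy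
      have hleny := M.len_eq hy
      have := relator_piece hF hb.rel hno hl hper hlab hIy.1 hIy.2 h1
        (show L ≤ M.len y by rw [hleny]; exact h2) h3
        fun i hi hi' => by
          obtain ⟨h5, h6⟩ := h4 i hi hi'
          rw [hB, Finset.mem_insert, Finset.mem_singleton, not_or] at h6
          exact ⟨h5, h6⟩
      rw [← hleny]
      exact this
    · have key : ∀ x ∈ M.breaks (· ∈ B) d, c.Arc x₀ 0 s.length (M.e x) →
          M.e x = c.φ^[s.length - 1] x₀ := by
        rintro x hx ⟨i, -, hi, hi'⟩
        have h1 := (M.mem_breaks.1 hx).2.2.2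
        rw [M.σ_apply, ← hi'] at h1
        change c.φ (c.φ^[i] x₀) ∈ B at h1
        rw [← Function.iterate_succ_apply' c.φ, hB, Finset.mem_insert, Finset.mem_singleton] at h1
        have h2 : i + 1 = s.length := by
          by_contra hne'
          rcases h1 with h1 | h1
          · have := iterate_inj_lt (φ := c.φ) (d := x₀) (i := i.succ) (j := 0) (by omega)
              (by omega) h1
            omega
          · rcases Nat.lt_or_ge s.length n with h3 | h3
            · have := iterate_inj_lt (by omega) (by omega) h1
              omega
            · rw [show s.length = n by omega, hper0] at h1
              have := iterate_inj_lt (φ := c.φ) (d := x₀) (i := i.succ) (j := 0) (by omega)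
                (by omega) h1
              omega
        rw [← hi']
        congr 1
        omega
      intro x hx y hy hxZ hyZ
      exact M.e.injective ((key x hx hxZ).trans (key y hy hyZ).symm)
  have htot := (M.sum_κ_ge).trans (M.sum_κ_le hκ)
  have hbr := M.sum_breaks_le B
  have hmul : ∑ d, ind (M.I d) * (2 * ind (M.deg d = 2 ∧ M.O (M.e d) ∧ M.σ d ∈ B)) =
      2 * ∑ d, ind (M.I d) * ind (M.deg d = 2 ∧ M.O (M.e d) ∧ M.σ d ∈ B) := by
    rw [Finset.mul_sum]
    exact Finset.sum_congr rfl fun d _ => by ring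
  rw [hmul] at htot
  have hspur : ∀ i, 1 ≤ i → i < n → i ≠ s.length → M.deg (c.φ^[i] x₀) ≠ 1 := by
    intro i hi hin his hdeg
    rcases lt_or_ge i s.length with h1 | h1
    · obtain ⟨k, rfl⟩ : ∃ k, i = k + 1 := ⟨i - 1, by omega⟩
      rw [Function.iterate_succ_apply'] at hdeg
      have h2 := c.e_eq_of_deg_one hdeg
      rw [← Function.iterate_succ_apply' c.φ] at h2
      have h3 := hlab k (by omega)
      have h4 := hlab (k + 1) (by omega)
      rw [← h2, c.lab_e, List.getElem?_append_left (by omega),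
        List.getElem?_eq_getElem (by omega), Option.some_inj] at h3
      rw [List.getElem?_append_left (by omega), List.getElem?_eq_getElem (by omega),
        Option.some_inj] at h4
      have h5 := List.isChain_iff_getElem.1 (List.isChain_append.1 hred).1 k (by omega)
      rw [h3, h4] at h5
      rcases h5 with h5 | h5
      · exact h5 rfl
      · simp [linv] at h5
    · obtain ⟨k, rfl⟩ : ∃ k, i = k + 1 := ⟨i - 1, by omega⟩
      exact Cfg.not_spur_of_geodArc c harc (by omega) (by omega) hdeg
  have hspB : ∀ d, M.O d ∧ M.deg d = 1 → d ∈ B := by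
    rintro d ⟨hd, hd'⟩
    obtain ⟨i, hi, rfl⟩ := (hOi d).1 hd
    by_contra hB'
    refine hspur i ?_ hi ?_ hd'
    · rcases Nat.eq_zero_or_pos i with rfl | h1
      · exact absurd hB0 hB'
      · exact h1
    · rintro rfl
      exact hB' hB1
  by_cases hh : h = []
  · have hs : s.length = n := by simp [hnl, hh]
    have hBc : B = {x₀} := by rw [hB, hs, hper0]; simp
    have h1 : ∑ d, ind (M.O d ∧ M.deg d = 1) ≤ 1 := by
      refine (Finset.sum_le_sum fun d _ => ind_mono (hspB d)).trans ?_
      rw [sum_ind]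
      refine le_trans (Nat.cast_le.2 (Finset.card_le_card (t := {x₀}) fun z hz => ?_)) (by simp)
      rw [← hBc]
      simpa using hz
    rw [hBc] at hbr htot
    simp only [Finset.card_singleton, Nat.cast_one] at hbr
    linarith
  · have h1 : ∑ d, ind (M.O d ∧ M.deg d = 1) = 0 := by
      refine Finset.sum_eq_zero fun d _ => ind_false ?_
      intro hd
      have hhl : 0 < h.length := List.length_pos_iff.2 hh
      rcases Finset.mem_insert.1 (hspB d hd) with rfl | hd1
      · have h2 : c.e (c.φ (c.φ^[n - 1] d)) = c.φ^[n - 1] d := by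
          refine c.e_eq_of_deg_one ?_
          rw [← Function.iterate_succ_apply' c.φ, show (n - 1).succ = n by omega, hper0]
          exact hd.2
        rw [← Function.iterate_succ_apply' c.φ, show (n - 1).succ = n by omega, hper0] at h2
        have h3 := hlab 0 (by omega)
        have h4 := hlab (n - 1) (by omega)
        rw [← h2, c.lab_e] at h4
        obtain ⟨a, s', rfl⟩ := List.exists_cons_of_length_pos (l := s) (by omega)
        obtain ⟨b, h', rfl⟩ := List.exists_cons_of_length_pos hhl
        have h5 : n - 1 = (a :: s' ++ wordInv h').length := by
          simp only [List.length_append, length_wordInv, List.length_cons] at hnl ⊢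
          omega
        rw [wordInv_cons, ← List.append_assoc, h5, List.getElem?_concat_length] at h4
        simp only [Function.iterate_zero, id_eq, List.cons_append, List.getElem?_cons_zero,
          Option.some_inj] at h3 h4
        rw [← h3] at h4
        have h6 : b = a := by rw [← linv_linv b, h4, linv_linv]
        subst h6
        obtain ⟨m', h7⟩ := hb.tail
        have := hk _ _ _ _ h7
        simp at this
      · rw [Finset.mem_singleton] at hd1
        have hd2 := hd.2
        have h2 : c.e (c.φ (c.φ^[s.length - 1] x₀)) = c.φ^[s.length - 1] x₀ := by
          refine c.e_eq_of_deg_one ?_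
          rw [← Function.iterate_succ_apply' c.φ, show (s.length - 1).succ = s.length by omega,
            ← hd1]
          exact hd.2
        rw [← Function.iterate_succ_apply' c.φ,
          show (s.length - 1).succ = s.length by omega] at h2
        have h3 := hlab (s.length - 1) (by omega)
        have h4 := hlab s.length (by omega)
        rw [← h2, c.lab_e] at h3
        rcases List.eq_nil_or_concat' s with rfl | ⟨s', a, rfl⟩
        · simp at hslt
        rcases List.eq_nil_or_concat' h with rfl | ⟨h', b, rfl⟩
        · exact hh rfl
        rw [List.getElem?_append_right le_rfl, Nat.sub_self, wordInv_append] at h4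
        rw [List.getElem?_append_left (by omega)] at h3
        simp [wordInv_cons] at h3 h4
        rw [← h4, linv_linv] at h3
        subst h3
        obtain ⟨m', h7⟩ := hb.dropLast
        have := hk _ _ _ _ h7
        simp at this
    rw [h1] at htot
    have h2 : (B.card : ℚ) ≤ 2 := by exact_mod_cast Finset.card_le_two
    linarith

/-- Relator cycles are isometrically embedded. -/
theorem min_le_wordLength {s t : Word S} (h : s ++ t ∈ P.rels) :
    min s.length t.length ≤ wordLength P.gens (P.elt s) := by
  classical
  by_contra hlt
  push Not at hlt
  obtain ⟨v, h1, h2⟩ := exists_geodesic_word (P.elt s)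
  obtain ⟨m, hb⟩ := BadBigon.exists_of (P := P) (h := v) h h1 (by omega) (by omega)
  have hex : ∃ k, ∃ s t h m, BadBigon P s t h m ∧ h.length = k := ⟨_, s, t, v, m, hb, rfl⟩
  have hk := Nat.find_spec hex
  have hk' : ∀ s' t' h' m', BadBigon P s' t' h' m' → Nat.find hex ≤ h'.length :=
    fun s' t' h' m' h => Nat.find_min' hex ⟨s', t', h', m', h, rfl⟩
  have hex2 : ∃ m s t h, BadBigon P s t h m ∧ h.length = Nat.find hex := by
    obtain ⟨s, t, h, m, h1⟩ := hk
    exact ⟨m, s, t, h, h1⟩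
  obtain ⟨s, t, h, h1, h2⟩ := Nat.find_spec hex2
  exact h1.false_of_min (h2 ▸ hk') fun s' t' h' m' h3 h4 =>
    Nat.find_min' hex2 ⟨s', t', h', h3, h4.trans h2⟩

end

end

section

section Projection

variable {S : Type} (P : C6Presentation S)

/-- `y` is a closest point of `α` to `x`. -/
def C6Presentation.IsProj (α : Set P.Grp) (x y : P.Grp) : Prop :=
  y ∈ α ∧ ∀ z ∈ α, P.dist x y ≤ P.dist x z

/-- Closest points of `α` to adjacent points are at distance at most `K`. -/
def C6Presentation.StepBound (α : Set P.Grp) (K : ℕ) : Prop :=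
  ∀ x x' y y', P.IsProj α x y → P.IsProj α x' y' → P.dist x x' ≤ 1 → P.dist y y' ≤ K

/-- An arc length coordinate on a geodesic. -/
structure C6Presentation.Coord (α : Set P.Grp) (κ : P.Grp → ℤ) : Prop where
  dist_eq : ∀ x ∈ α, ∀ y ∈ α, (P.dist x y : ℤ) = |κ x - κ y|
  surj : ∀ x ∈ α, ∀ y ∈ α, ∀ m, κ x ≤ m → m ≤ κ y → ∃ z ∈ α, κ z = m

variable {P} {α : Set P.Grp}

theorem C6Presentation.exists_isProj (h : α.Nonempty) (x : P.Grp) : ∃ y, P.IsProj α x y := by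
  obtain ⟨y, hy, h1⟩ := WellFounded.has_min (measure (P.dist x)).wf α h
  exact ⟨y, hy, fun z hz => not_lt.1 (h1 z hz)⟩

theorem C6Presentation.IsProj.setDist_eq {x y : P.Grp} (h : P.IsProj α x y) :
    setDist P.gens x α = P.dist x y := by
  refine IsLeast.csInf_eq ⟨⟨y, h.1, rfl⟩, ?_⟩
  rintro _ ⟨z, hz, rfl⟩
  rw [wdist_eq]
  exact_mod_cast h.2 z hz

theorem mem_proj_iff {x y : P.Grp} : y ∈ proj P.gens α x ↔ P.IsProj α x y := by
  constructor
  · rintro ⟨h1, h2⟩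
    refine ⟨h1, fun z hz => ?_⟩
    have h3 : setDist P.gens x α ≤ wdist P.gens x z :=
      csInf_le ⟨0, by rintro _ ⟨u, -, rfl⟩; exact Nat.cast_nonneg _⟩ ⟨z, hz, rfl⟩
    rw [← h2, wdist_eq, wdist_eq] at h3
    exact_mod_cast h3
  · exact fun h => ⟨h.1, h.setDist_eq ▸ rfl⟩

theorem exists_stepBound {ρ₁ ρ₂ : ℝ → ℝ} (h : ContractingWith P.gens ρ₁ ρ₂ α)
    (hbdd : BddAbove (Set.range ρ₂)) : ∃ K, P.StepBound α K := by
  obtain ⟨B, hB⟩ := hbdd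
  obtain ⟨⟨h1, -, -, -, -, h2, -⟩, h3⟩ := h
  obtain ⟨R, hR⟩ := h2 1
  refine ⟨⌈max B (2 * R + 2)⌉₊, fun x x' y y' hy hy' hx => ?_⟩
  refine Nat.cast_le.1 (le_trans ?_ (Nat.le_ceil (max B (2 * R + 2))))
  rcases le_total R (P.dist x y) with h4 | h4
  · refine le_trans ?_ (le_max_left _ _)
    refine (h3 x trivial x' trivial ?_ y (Or.inl (mem_proj_iff.2 hy)) y'
      (Or.inr (mem_proj_iff.2 hy'))).trans (hB ⟨_, rfl⟩)
    rw [hy.setDist_eq, wdist_eq]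
    exact le_trans (by exact_mod_cast hx) (hR.trans (h1 h4))
  · refine le_trans ?_ (le_max_right _ _)
    have h5 := dist_triangle y x y'
    have h6 := dist_triangle x x' y'
    have h7 := hy'.2 y hy.1
    have h8 := dist_triangle x' x y
    rw [dist_comm y x] at h5
    rw [dist_comm x' x] at h8
    have h9 : P.dist y y' ≤ 2 * P.dist x y + 2 := by omega
    have h10 : (P.dist y y' : ℝ) ≤ 2 * P.dist x y + 2 := by exact_mod_cast h9
    linarith

theorem C6Presentation.Coord.neg {κ : P.Grp → ℤ} (h : P.Coord α κ) :
    P.Coord α fun x => -κ x where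
  dist_eq x hx y hy := by
    rw [h.dist_eq x hx y hy, ← abs_neg]
    congr 1
    ring
  surj x hx y hy m h1 h2 := by
    obtain ⟨z, hz, h3⟩ := h.surj y hy x hx (-m) (by omega) (by omega)
    exact ⟨z, hz, by omega⟩

theorem C6Presentation.Coord.eq_of {κ : P.Grp → ℤ} (h : P.Coord α κ) {x y : P.Grp}
    (hx : x ∈ α) (hy : y ∈ α) (hxy : κ x = κ y) : x = y := by
  refine eq_of_dist_eq_zero ?_
  have := h.dist_eq x hx y hy
  rw [hxy, sub_self, abs_zero] at this
  exact_mod_cast this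

theorem exists_coord (hα : IsGeodesic P.gens α) : ∃ κ, P.Coord α κ := by
  obtain ⟨I, γ, hI, hd, rfl⟩ := hα
  have hd' : ∀ m ∈ I, ∀ n ∈ I, (P.dist (γ m) (γ n) : ℤ) = |m - n| := by
    intro m hm n hn
    have := hd m hm n hn
    rw [wdist_eq] at this
    exact_mod_cast this
  have h1 : ∀ x ∈ γ '' I, Function.invFunOn γ I x ∈ I ∧ γ (Function.invFunOn γ I x) = x :=
    fun x hx => ⟨Function.invFunOn_mem hx, Function.invFunOn_eq hx⟩
  refine ⟨Function.invFunOn γ I, ?_, ?_⟩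
  · intro x hx y hy
    have := hd' _ (h1 x hx).1 _ (h1 y hy).1
    rwa [(h1 x hx).2, (h1 y hy).2] at this
  · intro x hx y hy m h2 h3
    have hm : m ∈ I := hI.out (h1 x hx).1 (h1 y hy).1 ⟨h2, h3⟩
    have hm' : γ m ∈ γ '' I := ⟨m, hm, rfl⟩
    refine ⟨γ m, hm', ?_⟩
    have := hd' _ (h1 _ hm').1 m hm
    rw [(h1 _ hm').2, dist_self, Nat.cast_zero, eq_comm, abs_eq_zero] at this
    omega

theorem min_le_dist_elt_take {r : Word S} (hr : r ∈ P.rels) (g : P.Grp) {i j : ℕ} (hij : i ≤ j)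
    (hj : j ≤ r.length) :
    min (j - i) (r.length - (j - i)) ≤ P.dist (g * P.elt (r.take i)) (g * P.elt (r.take j)) := by
  have h1 : r.rotate i = (r.drop i).take (j - i) ++ (r.drop j ++ r.take i) := by
    rw [List.rotate_eq_drop_append_take (by omega), ← List.append_assoc]
    congr 1
    conv_lhs => rw [← List.take_append_drop (j - i) (r.drop i), List.drop_drop]
    rw [show i + (j - i) = j by omega]
  have h2 := P.rotate_mem r hr i
  rw [h1] at h2
  have h3 := min_le_wordLength h2
  have h4 : r.take j = r.take i ++ (r.drop i).take (j - i) := by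
    rw [← List.take_add, show i + (j - i) = j by omega]
  rw [dist_mul_left, C6Presentation.dist, h4, elt_append, inv_mul_cancel_left]
  refine le_trans (le_of_eq ?_) h3
  simp only [List.length_append, List.length_take, List.length_drop]
  omega

theorem dist_elt_take_le (r : Word S) (g : P.Grp) {i j : ℕ} (hij : i ≤ j) :
    P.dist (g * P.elt (r.take i)) (g * P.elt (r.take j)) ≤ j - i := by
  have h4 : r.take j = r.take i ++ (r.drop i).take (j - i) := by
    rw [← List.take_add, show i + (j - i) = j by omega]
  rw [h4, elt_append, ← mul_assoc]
  refine (dist_mul_elt_le _ _).trans ?_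
  simp

/-- The intersection of a relator cycle with the geodesic is short if it covers at most half
of the cycle. -/
theorem C6Presentation.StepBound.length_le {κ : P.Grp → ℤ} (hκ : P.Coord α κ) {K : ℕ}
    (hK : P.StepBound α K) {s t : Word S} (h : s ++ t ∈ P.rels) (hst : s.length ≤ t.length)
    (g : P.Grp) (hα : ∀ i ≤ s.length, g * P.elt (s.take i) ∈ α) : s.length ≤ K := by
  set z : ℕ → P.Grp := fun i => g * P.elt ((s ++ t).take i) with hz
  have hzα : ∀ i ≤ s.length, z i ∈ α := by
    intro i hi
    simpa only [hz, List.take_append_of_le_length hi] using hα i hi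
  have hlow : ∀ i j, i ≤ j → j ≤ s.length + t.length →
      min (j - i) (s.length + t.length - (j - i)) ≤ P.dist (z i) (z j) := by
    intro i j hij hj
    have := min_le_dist_elt_take h g hij (by simpa using hj)
    rwa [List.length_append] at this
  have hup : ∀ i j, i ≤ j → P.dist (z i) (z j) ≤ j - i := fun i j hij =>
    dist_elt_take_le _ _ hij
  have hend : z (s.length + t.length) = z 0 := by
    simp only [hz]
    rw [← List.length_append, List.take_length, elt_rel P h]
    simp
  have hd : ∀ i j, i ≤ j → j ≤ s.length → |κ (z i) - κ (z j)| = (j : ℤ) - i := by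
    intro i j hij hj
    rw [← hκ.dist_eq _ (hzα i (by omega)) _ (hzα j hj)]
    have h1 := hlow i j hij (by omega)
    have h2 := hup i j hij
    omega
  clear hα
  wlog hpos : κ (z 0) ≤ κ (z s.length) generalizing κ
  · refine this hκ.neg ?_ (by omega)
    intro i j hij hj
    rw [← hd i j hij hj, ← abs_neg]
    congr 1
    ring
  have hcoord : ∀ i ≤ s.length, κ (z i) = κ (z 0) + i := by
    intro i hi
    have h1 := hd 0 i (by omega) hi
    have h2 := hd i s.length hi le_rfl
    have h3 := hd 0 s.length (by omega) le_rfl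
    push_cast at h1 h3
    rw [abs_eq (by omega)] at h1 h2 h3
    omega
  have hne : α.Nonempty := ⟨_, hzα 0 (by omega)⟩
  choose q hq using fun j => exists_isProj hne (z j)
  have hself : ∀ j, z j ∈ α → q j = z j := by
    intro j hj
    have h1 := (hq j).2 _ hj
    rw [dist_self] at h1
    exact (eq_of_dist_eq_zero (by omega)).symm
  have hout : ∀ j, s.length ≤ j → j ≤ s.length + t.length →
      κ (q j) ≤ κ (z 0) ∨ κ (z 0) + s.length ≤ κ (q j) := by
    intro j hj1 hj2
    by_contra hcon
    push Not at hcon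
    obtain ⟨i, hi⟩ : ∃ i : ℕ, κ (q j) = κ (z 0) + i := ⟨(κ (q j) - κ (z 0)).toNat, by omega⟩
    have hi1 : q j = z i :=
      hκ.eq_of (hq j).1 (hzα i (by omega)) (by rw [hi, hcoord i (by omega)])
    have h1 := hlow i j (by omega) hj2
    have h2 := (hq j).2 _ (hzα s.length le_rfl)
    have h3 := (hq j).2 _ (hzα 0 (by omega))
    have h4 := hup _ _ hj1
    have h5 := hup _ _ hj2
    rw [hend] at h5
    rw [hi1, dist_comm] at h2 h3
    rw [dist_comm] at h4
    omega
  by_contra hcon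
  push Not at hcon
  have key : ∀ k ≤ t.length, κ (z 0) + s.length ≤ κ (q (s.length + k)) := by
    intro k hk
    induction k with
    | zero => rw [add_zero, hself _ (hzα _ le_rfl), hcoord _ le_rfl]
    | succ k ih =>
      have h1 := ih (by omega)
      rcases hout (s.length + (k + 1)) (by omega) (by omega) with h2 | h2
      · have h3 := hK _ _ _ _ (hq (s.length + k)) (hq (s.length + (k + 1)))
          ((hup _ _ (by omega)).trans (by omega))
        have h4 := hκ.dist_eq _ (hq (s.length + k)).1 _ (hq (s.length + (k + 1))).1
        have h5 := le_abs_self (κ (q (s.length + k)) - κ (q (s.length + (k + 1))))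
        omega
      · exact h2
  have h1 := key t.length le_rfl
  rw [hself _ (hend ▸ hzα 0 (by omega)), hend] at h1
  omega

end Projection

end

section

namespace Diagram

variable {D : Type} [Fintype D] (M : Diagram D)

theorem deg_eq_two_or {d : D} (hd : M.I d) : M.deg d = 2 ∨ 3 ≤ M.deg d := by
  have : 2 ≤ M.deg d := M.two_le_deg d hd
  omega

theorem exists_iter_of_mem_face {x y : D} (h : y ∈ M.face x) : ∃ j < M.len x, M.φ^[j] x = y := by
  classical
  exact sameCycle_iff.1 (M.mem_face.1 h)

theorem iter_inj {x : D} {i j : ℕ} (hi : i < M.len x) (hj : j < M.len x)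
    (h : M.φ^[i] x = M.φ^[j] x) : i = j := by
  classical
  exact iterate_inj_lt hi hj h

theorem symm_iter_iter (x : D) {i j : ℕ} (h : i ≤ j) :
    M.φ.symm^[i] (M.φ^[j] x) = M.φ^[j - i] x := by
  obtain ⟨k, rfl⟩ := Nat.exists_eq_add_of_le h
  rw [Function.iterate_add_apply, Nat.add_sub_cancel_left]
  exact (Function.LeftInverse.iterate M.φ.symm_apply_apply i) _

/-- The face of `x` has a single outer arc, with initial dart `x` and length `a`; its ends have
degree three and the rest of the face consists of four inner arcs. -/
structure GoodArc (x : D) (a : ℕ) : Prop where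
  I : M.I x
  pos : 1 ≤ a
  lt : a < M.len x
  outer : ∀ j < a, M.O (M.e (M.φ^[j] x))
  deg_two : ∀ j, 1 ≤ j → j < a → M.deg (M.φ^[j] x) = 2
  deg_left : M.deg x = 3
  deg_right : M.deg (M.φ^[a] x) = 3
  inner : ∀ j, a ≤ j → j < M.len x → M.I (M.e (M.φ^[j] x))
  innerArcs : M.innerArcs x = 4

theorem exists_goodArc {d : D} (hd : M.I d) (h1 : M.outerArcs d = 1) (h4 : 4 ≤ M.innerArcs d)
    (hκ : -(1 / 2) < M.κ d) : ∃ x ∈ M.face d, ∃ a, M.GoodArc x a := by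
  classical
  have hle := M.κ_le hd
  have h4' : (4 : ℚ) ≤ M.innerArcs d := by exact_mod_cast h4
  rw [h1] at hle
  have hoc : M.outerCorners d = 0 := by
    by_contra h
    have : (1 : ℚ) ≤ M.outerCorners d := by exact_mod_cast Nat.one_le_iff_ne_zero.2 h
    push_cast at hle
    linarith
  have hia : M.innerArcs d = 4 := by
    by_contra h
    have : (5 : ℚ) ≤ M.innerArcs d := by exact_mod_cast (by omega : 5 ≤ M.innerArcs d)
    rw [hoc] at hle
    push_cast at hle
    linarith
  have hdeg : ∀ y ∈ M.face d, (M.O (M.e y) ↔ ¬ M.O (M.e (M.φ.symm y))) → M.deg y < 4 := by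
    intro y hy ho
    by_contra h
    have := M.κ_le_of_four_le hd hy (by omega) ho
    rw [h1, hoc] at this
    push_cast at this
    linarith
  obtain ⟨x, hx⟩ := Finset.card_eq_one.1 h1
  have hxs : x ∈ M.starts M.O (fun _ => False) d := by rw [hx]; simp
  obtain ⟨hxf, hxo, hxd⟩ := M.mem_starts.1 hxs
  replace hxd : 3 ≤ M.deg x := by simpa using hxd
  have hxI := M.I_of_mem_face hd hxf
  have hface := M.face_eq hxf
  have huniq : ∀ y ∈ M.face d, M.O (M.e y) → 3 ≤ M.deg y → y = x := by
    intro y hy h2 h3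
    have : y ∈ M.starts M.O (fun _ => False) d := M.mem_starts.2 ⟨hy, h2, Or.inl h3⟩
    rw [hx] at this
    simpa using this
  have hmem : ∀ j, M.φ^[j] x ∈ M.face d := fun j => (M.φ_iter_mem_face j).2 hxf
  have hex : ∃ j, ¬ M.O (M.e (M.φ^[j] x)) := by
    obtain ⟨z, hz⟩ : (M.starts M.I (fun _ => False) d).Nonempty := by
      rw [← Finset.card_pos]
      exact lt_of_lt_of_le (by omega) h4
    obtain ⟨hz1, hz2, -⟩ := M.mem_starts.1 hz
    rw [← hface] at hz1
    obtain ⟨j, -, rfl⟩ := M.exists_iter_of_mem_face hz1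
    exact ⟨j, fun h => M.not_I _ h hz2⟩
  set a := Nat.find hex with ha
  have ha1 : ¬ M.O (M.e (M.φ^[a] x)) := Nat.find_spec hex
  have ha2 : ∀ j < a, M.O (M.e (M.φ^[j] x)) := fun j hj => not_not.1 (Nat.find_min hex hj)
  have hapos : 1 ≤ a := by
    by_contra h
    rw [show a = 0 by omega] at ha1
    exact ha1 hxo
  have hper : M.φ^[M.len x] x = x := iterate_per M.φ x
  have halt : a < M.len x := by
    by_contra h
    apply ha1
    rw [show a = (a - M.len x) + M.len x by omega, Function.iterate_add_apply, hper]
    exact ha2 _ (by have := M.len_pos x; omega)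
  have hlenx := M.len_pos x
  have hsymm : M.φ.symm (M.φ^[a] x) = M.φ^[a - 1] x := by
    rw [Equiv.symm_apply_eq, ← Function.iterate_succ_apply' M.φ]
    congr 2
    omega
  refine ⟨x, hxf, a, hxI, hapos, halt, ha2, ?_, ?_, ?_, ?_, ?_⟩
  · intro j hj1 hj2
    refine (M.deg_eq_two_or (M.I_of_mem_face hd (hmem j))).resolve_right fun h => ?_
    have h5 := huniq _ (hmem j) (ha2 j hj2) h
    have := M.iter_inj (i := j) (j := 0) (by omega) hlenx h5
    omega
  · have h5 : ¬ M.O (M.e (M.φ.symm x)) := by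
      intro h
      have : x ∈ (M.face d).filter fun x => 3 ≤ M.deg x ∧ M.O (M.e x) ∧ M.O (M.e (M.φ.symm x)) :=
        Finset.mem_filter.2 ⟨hxf, hxd, hxo, h⟩
      rw [outerCorners, Finset.card_eq_zero] at hoc
      rw [hoc] at this
      simp at this
    have := hdeg x hxf (by tauto)
    omega
  · have h6 : M.O (M.e (M.φ.symm (M.φ^[a] x))) := hsymm ▸ ha2 _ (by omega)
    have h5 := hdeg (M.φ^[a] x) (hmem a) (by tauto)
    rcases M.deg_eq_two_or (M.I_of_mem_face hd (hmem a)) with h | h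
    · exfalso
      rw [← Equiv.apply_symm_apply M.φ (M.φ^[a] x)] at h
      have h7 := M.O_e_φ h
      rw [Equiv.apply_symm_apply] at h7
      exact ha1 (h7.2 h6)
    · omega
  · intro j hj1 hj2
    refine (M.I_e_iff (M.I_of_mem_face hd (hmem j))).2 fun h => ?_
    obtain ⟨i, h5, h6, -⟩ := M.exists_start hd (by omega) (M.mem_opp.2 ⟨hmem j, h⟩)
    rw [hx, Finset.mem_singleton] at h5
    have hi : j - a ≤ i := by
      by_contra hlt
      rw [M.symm_iter_iter x (by omega)] at h5
      have := M.iter_inj (i := j - i) (j := 0) (by omega) hlenx h5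
      omega
    have := (M.mem_opp.1 (h6 _ hi)).2
    rw [M.symm_iter_iter x (by omega), show j - (j - a) = a by omega] at this
    exact ha1 this
  · rw [← hia, Diagram.innerArcs, Diagram.innerArcs]
    congr 1
    ext y
    rw [mem_starts, mem_starts, hface]

/-- The number of steps along a face to the next vertex of degree at least three. -/
noncomputable def run (t : D) : ℕ := sInf {k | 1 ≤ k ∧ 3 ≤ M.deg (M.φ^[k] t)}

theorem run_spec {t : D} (h : 3 ≤ M.deg t) : 1 ≤ M.run t ∧ 3 ≤ M.deg (M.φ^[M.run t] t) := by
  classical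
  refine Nat.sInf_mem (s := {k | 1 ≤ k ∧ 3 ≤ M.deg (M.φ^[k] t)}) ⟨M.len t, M.len_pos t, ?_⟩
  rwa [show M.φ^[M.len t] t = t from iterate_per M.φ t]

theorem run_le {t : D} {k : ℕ} (h1 : 1 ≤ k) (h : 3 ≤ M.deg (M.φ^[k] t)) : M.run t ≤ k :=
  Nat.sInf_le (s := {k | 1 ≤ k ∧ 3 ≤ M.deg (M.φ^[k] t)}) ⟨h1, h⟩

theorem deg_of_lt_run {t : D} (ht : M.I t) {j : ℕ} (h1 : 1 ≤ j) (h2 : j < M.run t) :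
    M.deg (M.φ^[j] t) = 2 :=
  (M.deg_eq_two_or ((M.I_iter t j).2 ht)).resolve_right fun h => by
    have := M.run_le h1 h
    omega

theorem six_mul_run_lt {t : D} (ht : M.I t) (ht' : M.I (M.e t)) (h : 3 ≤ M.deg t) :
    6 * M.run t < M.len t := by
  classical
  refine M.piece t _ ht ht' (M.run_spec h).1 (M.run_le (M.len_pos t) ?_)
    fun j h1 h2 => M.deg_of_lt_run ht h1 h2
  rwa [iterate_per]

theorem e_iter_mirror {d : D} {L : ℕ} (h : ∀ j, 1 ≤ j → j < L → M.deg (M.φ^[j] d) = 2) {j : ℕ}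
    (hj : j < L) : M.φ^[j] (M.e (M.φ^[j] d)) = M.e d := by
  induction j with
  | zero => rfl
  | succ j ih =>
    have h1 := h (j + 1) (by omega) hj
    rw [Function.iterate_succ_apply' M.φ j d] at h1 ⊢
    rw [Function.iterate_succ_apply, M.φ_e_of_deg h1]
    exact ih (by omega)

namespace GoodArc

variable {M} {x : D} {a : ℕ}

theorem six_mul_le (h : M.GoodArc x a) : 6 * (M.len x - a) ≤ 4 * (M.len x - 1) := by
  classical
  have h1 := M.card_opp_I_le h.I
  have h2 : M.len x - a ≤ (M.opp M.I x).card := by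
    have h3 : (Finset.Ico a (M.len x)).image (fun j => M.φ^[j] x) ⊆ M.opp M.I x := by
      intro y hy
      obtain ⟨j, hj, rfl⟩ := Finset.mem_image.1 hy
      rw [Finset.mem_Ico] at hj
      exact M.mem_opp.2 ⟨(M.φ_iter_mem_face j).2 (M.self_mem_face x), h.inner j hj.1 hj.2⟩
    refine le_trans (le_of_eq ?_) (Finset.card_le_card h3)
    rw [Finset.card_image_of_injOn, Nat.card_Ico]
    intro i hi j hj hij
    simp only [Finset.coe_Ico, Set.mem_Ico] at hi hj
    exact M.iter_inj hi.2 hj.2 hij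
  have h4 : (M.starts M.I (fun _ => False) x).card = 4 := h.innerArcs
  rw [h4] at h1
  omega

theorem exists_iter (h : M.GoodArc x a) {y : D} (hy : y ∈ M.face x) (ho : M.O (M.e y)) :
    ∃ j < a, M.φ^[j] x = y := by
  obtain ⟨j, hj, rfl⟩ := M.exists_iter_of_mem_face hy
  exact ⟨j, not_le.1 fun hja => M.not_I _ ho (h.inner j hja hj), rfl⟩

/-- The boundary path between the outermost inner arcs of a good face is shorter than its
outer arc. -/
theorem exists_shortcut (h : M.GoodArc x a) {t : D} (ht : M.I t) (hdt : 3 ≤ M.deg t)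
    (htx : M.φ (M.e t) = x) : ∃ p, M.run (M.φ^[a] x) ≤ p ∧ p < M.run (M.φ^[a] x) + a ∧
      M.φ^[p] (M.φ^[a] x) = M.e (M.φ^[M.run t - 1] t) := by
  classical
  have hper : M.φ^[M.len x] x = x := iterate_per M.φ x
  obtain ⟨hk1, hk2⟩ := M.run_spec hdt
  set k' := M.run t with hk'
  have hmir : ∀ j < k', M.φ^[j] (M.e (M.φ^[j] t)) = M.e t := fun j hj =>
    M.e_iter_mirror (fun i h1 h2 => M.deg_of_lt_run ht h1 h2) hj
  set y := M.e (M.φ^[k' - 1] t) with hy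
  have hyx : M.φ^[k'] y = x := by
    rw [show k' = (k' - 1) + 1 by omega, Function.iterate_succ_apply', hy, hmir _ (by omega), htx]
  have hey : ∀ j < k', M.e (M.φ^[j] y) = M.φ^[k' - 1 - j] t := by
    intro j hj
    have h1 : M.φ^[k' - 1 - j] (M.e (M.φ^[k' - 1 - j] t)) = M.φ^[k' - 1 - j] (M.φ^[j] y) := by
      rw [hmir _ (by omega), ← Function.iterate_add_apply,
        show k' - 1 - j + j = k' - 1 by omega, hy, hmir _ (by omega)]
    rw [← (M.φ.injective.iterate _) h1, M.e_e]
  have hIey : ∀ j < k', M.I (M.e (M.φ^[j] y)) := fun j hj => by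
    rw [hey j hj]
    exact (M.I_iter _ _).2 ht
  have hdegy : ∀ j < k', M.deg (M.φ^[j] y) = M.deg (M.φ^[k' - j] t) := by
    intro j hj
    rw [← M.deg_σ, M.σ_apply, hey j hj, ← Function.iterate_succ_apply' M.φ]
    congr 3
    omega
  set b := M.len x - a with hb
  have hblt := h.lt
  have hapos := h.pos
  set t₀ := M.φ^[a] x with ht₀
  have hit : ∀ j, M.φ^[j] t₀ = M.φ^[j + a] x := fun j => by
    rw [ht₀, Function.iterate_add_apply]
  have htb : M.φ^[b] t₀ = x := by rw [hit, hb, Nat.sub_add_cancel hblt.le, hper]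
  have hk'b : k' ≤ b := by
    by_contra hlt
    have h1 : M.φ^[b + 1] (M.φ^[k' - (b + 1)] y) = M.φ^[b + 1] (M.φ^[a - 1] x) := by
      rw [← Function.iterate_add_apply, ← Function.iterate_add_apply,
        show b + 1 + (k' - (b + 1)) = k' by omega, hyx,
        show b + 1 + (a - 1) = M.len x by omega, hper]
    have h2 := M.φ.injective.iterate _ h1
    have h3 := hIey (k' - (b + 1)) (by omega)
    rw [h2] at h3
    exact M.not_I _ (h.outer _ (by omega)) h3
  have hty : M.φ^[b - k'] t₀ = y := by
    apply M.φ.injective.iterate k'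
    rw [← Function.iterate_add_apply, show k' + (b - k') = b by omega, htb, hyx]
  have hI₀ : M.I t₀ := (M.I_iter _ _).2 h.I
  have hstart : ∀ z, z ∈ M.starts M.I (fun _ => False) x ↔
      ∃ i < b, M.φ^[i] t₀ = z ∧ 3 ≤ M.deg z := by
    intro z
    rw [M.mem_starts]
    constructor
    · rintro ⟨h1, h2, h3⟩
      obtain ⟨j, hj, rfl⟩ := M.exists_iter_of_mem_face h1
      have hja : a ≤ j := by
        by_contra hlt
        exact M.not_I _ (h.outer j (by omega)) h2
      refine ⟨j - a, by omega, ?_, by simpa using h3⟩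
      rw [hit, Nat.sub_add_cancel hja]
    · rintro ⟨i, hi, rfl, h3⟩
      rw [hit] at h3 ⊢
      exact ⟨(M.φ_iter_mem_face _).2 (M.self_mem_face x), h.inner _ (by omega) (by omega),
        Or.inl h3⟩
  have hinj : ∀ i j, i < b → j < b → M.φ^[i] t₀ = M.φ^[j] t₀ → i = j := by
    intro i j hi hj hij
    rw [hit, hit] at hij
    have := M.iter_inj (by omega) (by omega) hij
    omega
  have hp0 : b - k' ≠ 0 := by
    intro h0
    rw [h0] at hty
    have hsub : M.starts M.I (fun _ => False) x ⊆ {t₀} := by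
      intro z hz
      obtain ⟨i, hi, rfl, h3⟩ := (hstart z).1 hz
      rw [Finset.mem_singleton]
      by_contra hne
      have hi0 : i ≠ 0 := by rintro rfl; exact hne rfl
      have h2 := hdegy i (by omega)
      rw [← hty, M.deg_of_lt_run ht (by omega) (by omega)] at h2
      simp only [Function.iterate_zero, id_eq] at h2
      omega
    have h1 := Finset.card_le_card hsub
    have h2 : (M.starts M.I (fun _ => False) x).card = 4 := h.innerArcs
    rw [h2, Finset.card_singleton] at h1
    omega
  have hdy : 3 ≤ M.deg (M.φ^[b - k'] t₀) := by
    rw [hty]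
    have := hdegy 0 (by omega)
    simp only [Function.iterate_zero, id_eq, Nat.sub_zero] at this
    rwa [this]
  set k := M.run t₀ with hk
  have hkp : k ≤ b - k' := M.run_le (by omega) hdy
  refine ⟨b - k', hkp, ?_, hty⟩
  set m := (M.len x - 1) / 6 with hm
  set T := (Finset.Ico k (b - k')).filter fun i => 3 ≤ M.deg (M.φ^[i] t₀) with hT
  have hkpos : 1 ≤ k := (M.run_spec (by rw [h.deg_right])).1
  have hTcard : T.card ≤ 2 := by
    have h1 : insert 0 (insert (b - k') T) ⊆ (Finset.range b).filter fun i =>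
        3 ≤ M.deg (M.φ^[i] t₀) := by
      intro i hi
      rw [Finset.mem_insert, Finset.mem_insert] at hi
      rw [Finset.mem_filter, Finset.mem_range]
      rcases hi with rfl | rfl | hi
      · exact ⟨by omega, by simp only [Function.iterate_zero, id_eq]; exact h.deg_right.ge⟩
      · exact ⟨by omega, hdy⟩
      · rw [hT, Finset.mem_filter, Finset.mem_Ico] at hi
        exact ⟨by omega, hi.2⟩
    have h2 : ((Finset.range b).filter fun i => 3 ≤ M.deg (M.φ^[i] t₀)).card ≤ 4 := by
      have h3 : (M.starts M.I (fun _ => False) x).card = 4 := h.innerArcs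
      rw [← h3]
      refine Finset.card_le_card_of_injOn (fun i => M.φ^[i] t₀) ?_ ?_
      · intro i hi
        simp only [Finset.coe_filter, Finset.mem_range] at hi
        exact (hstart _).2 ⟨i, hi.1, rfl, hi.2⟩
      · intro i hi j hj hij
        simp only [Finset.coe_filter, Finset.mem_range] at hi hj
        exact hinj i j hi.1 hj.1 hij
    have h3 := (Finset.card_le_card h1).trans h2
    rw [Finset.card_insert_of_notMem, Finset.card_insert_of_notMem] at h3
    · omega
    · simp [hT]
    · simp only [hT, Finset.mem_insert, Finset.mem_filter, Finset.mem_Ico]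
      omega
  have hcover : Finset.Ico k (b - k') ⊆ (T ×ˢ Finset.range m).image fun p => p.1 + p.2 := by
    intro q hq
    rw [Finset.mem_Ico] at hq
    have hex : ∃ r, k ≤ q - r ∧ r ≤ q ∧ 3 ≤ M.deg (M.φ^[q - r] t₀) := by
      refine ⟨q - k, by omega, by omega, ?_⟩
      rw [show q - (q - k) = k by omega]
      exact (M.run_spec (by rw [h.deg_right])).2
    obtain ⟨h1, h2, h3⟩ := Nat.find_spec hex
    set r := Nat.find hex with hr
    have hlt : 6 * (r + 1) < M.len x := by
      have hlen : M.len (M.φ^[q - r] t₀) = M.len x := by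
        rw [hit]
        exact M.len_eq ((M.φ_iter_mem_face _).2 (M.self_mem_face x))
      have := M.piece (M.φ^[q - r] t₀) (r + 1) ((M.I_iter _ _).2 hI₀)
        (by rw [hit]; exact h.inner _ (by omega) (by omega)) (by omega)
        (by change r + 1 ≤ M.len _; rw [hlen]; omega) (fun j hj1 hj2 => ?_)
      · change 6 * (r + 1) < M.len _ at this
        rwa [hlen] at this
      · rw [← Function.iterate_add_apply]
        refine (M.deg_eq_two_or ((M.I_iter _ _).2 hI₀)).resolve_right fun h5 => ?_
        refine Nat.find_min hex (m := r - j) (by omega) ⟨by omega, by omega, ?_⟩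
        rwa [show q - (r - j) = j + (q - r) by omega]
    refine Finset.mem_image.2 ⟨(q - r, r), Finset.mem_product.2 ⟨?_, ?_⟩, by simp; omega⟩
    · exact Finset.mem_filter.2 ⟨Finset.mem_Ico.2 ⟨h1, by omega⟩, h3⟩
    · rw [Finset.mem_range]
      omega
  have h1 := (Finset.card_le_card hcover).trans Finset.card_image_le
  rw [Nat.card_Ico, Finset.card_product, Finset.card_range] at h1
  have h2 : T.card * m ≤ 2 * m := Nat.mul_le_mul_right _ hTcard
  have h3 := h.six_mul_le
  omega

end GoodArc

end Diagram

end

section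

namespace Diagram

variable {D : Type} [Fintype D] (M : Diagram D)

theorem card_opp_le_mul_starts {Z B : D → Prop} {d : D} {K : ℕ}
    (hZ : ∀ z, Z z → ¬ B (M.φ z) → Z (M.φ z)) (hd : M.I d)
    (h : ∀ y ∈ M.face d, ∀ L, (∀ j < L, Z (M.e (M.φ^[j] y))) → L ≤ K) :
    (M.opp Z d).card ≤ K * (M.starts Z B d).card := by
  classical
  have hsub : M.opp Z d ⊆ (M.starts Z B d ×ˢ Finset.range K).image fun p => M.φ^[p.2] p.1 := by
    intro x hx
    rcases M.trace_back hZ hd hx K with ⟨j, hj, hs, -, -⟩ | ⟨h1, -⟩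
    · refine Finset.mem_image.2 ⟨(M.φ.symm^[j] x, j),
        Finset.mem_product.2 ⟨hs, Finset.mem_range.2 hj⟩, ?_⟩
      change M.φ^[j] (M.φ.symm^[j] x) = x
      rw [M.φ_iter_symm_iter x le_rfl, Nat.sub_self]
      rfl
    · have := h (M.φ.symm^[K] x) (M.mem_opp.1 (h1 K le_rfl)).1 (K + 1) fun j hj => by
          rw [M.φ_iter_symm_iter x (by omega)]
          exact (M.mem_opp.1 (h1 (K - j) (by omega))).2
      omega
  have h3 := (Finset.card_le_card hsub).trans Finset.card_image_le
  rw [Finset.card_product, Finset.card_range] at h3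
  rwa [mul_comm]

theorem card_starts_le {Z B : D → Prop} (hZ : M.IsSide Z B) {d : D} (hd : M.I d) :
    (M.starts Z B d).card ≤ M.outerArcs d + (M.breaks B d).card := by
  classical
  refine (Finset.card_le_card (fun x hx => ?_)).trans (Finset.card_union_le _ _)
  rw [Finset.mem_union]
  exact (M.starts_subset hZ.1 hd hx).imp And.left And.left

theorem κ_le_six_breaks {ι : Type} {Z : ι → D → Prop} {B : D → Prop} (hZ : ∀ i, M.IsSide (Z i) B)
    (hO : ∀ x, M.O x → ∃ i, Z i x) {d : D} (hd : M.I d)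
    (hg : ∀ i, 2 * (M.opp (Z i) d).card ≤ M.len d) : M.κ d ≤ 6 * (M.breaks B d).card := by
  by_cases hb : M.breaks B d = ∅
  · rw [hb]
    simpa using M.κ_nonpos hZ hO hd hb hg
  · have h1 : (1 : ℚ) ≤ (M.breaks B d).card := by
      exact_mod_cast Finset.card_pos.2 (Finset.nonempty_iff_ne_empty.2 hb)
    have h2 := M.κ_le_outerArcs hd
    have h3 : (0 : ℚ) ≤ M.outerArcs d := Nat.cast_nonneg _
    linarith

/-- Faces without corners, with little negative curvature and a single outer arc. -/
def Good (B : D → Prop) (d : D) : Prop :=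
  M.breaks B d = ∅ ∧ -(1 / 2) < M.κ d ∧ M.outerArcs d = 1

theorem good_iff {B : D → Prop} {d x : D} (h : x ∈ M.face d) : M.Good B x ↔ M.Good B d := by
  unfold Good outerArcs breaks starts
  rw [M.κ_eq h, M.face_eq h]

/-- A flat face with two outer arcs, one of them on a short side, is small. -/
theorem exists_opp_of_two {ι : Type} {Z : ι → D → Prop} {B : D → Prop}
    (hZ : ∀ i, M.IsSide (Z i) B) (hO : ∀ x, M.O x → ∃ i, Z i x) {d z : D} (hd : M.I d)
    (hg : ∀ i, 2 * (M.opp (Z i) d).card ≤ M.len d) (i₀ : ι) (hb : M.breaks B d = ∅)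
    (hκ : -(1 / 2) < M.κ d) (h2 : M.outerArcs d = 2) (hz : z ∈ M.opp (Z i₀) d) :
    ∃ y ∈ M.opp M.O d, y ∉ M.opp (Z i₀) d ∧ M.len d ≤ 6 * (M.opp (Z i₀) d).card := by
  classical
  have hia : M.innerArcs d ≤ 2 := by
    have h3 := M.κ_le hd
    rw [h2] at h3
    by_contra h
    have h4 : (3 : ℚ) ≤ M.innerArcs d := by exact_mod_cast (by omega : 3 ≤ M.innerArcs d)
    have h5 : (0 : ℚ) ≤ M.outerCorners d := Nat.cast_nonneg _
    push_cast at h3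
    linarith
  have hoI : 6 * (M.opp M.I d).card ≤ 2 * (M.len d - 1) := by
    refine (M.card_opp_I_le hd).trans ?_
    rw [mul_comm]
    exact Nat.mul_le_mul_right _ hia
  have hadd := M.card_opp_add hd
  have hlen := M.len_pos d
  have hgz := hg i₀
  have hOZ : ∀ i x, x ∈ M.opp (Z i) d → x ∈ M.opp M.O d := fun i x hx =>
    M.mem_opp.2 ⟨(M.mem_opp.1 hx).1, (hZ i).1 _ (M.mem_opp.1 hx).2⟩
  obtain ⟨y, hy, hyZ⟩ : ∃ y ∈ M.opp M.O d, y ∉ M.opp (Z i₀) d := by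
    by_contra hcon
    push Not at hcon
    have := Finset.card_le_card (show M.opp M.O d ⊆ M.opp (Z i₀) d from hcon)
    omega
  refine ⟨y, hy, hyZ, ?_⟩
  have hstart : ∀ u ∈ M.opp M.O d, ∃ s ∈ M.starts M.O (fun _ => False) d,
      ∀ i, Z i (M.e s) ↔ Z i (M.e u) := by
    intro u hu
    obtain ⟨j, h3, h4, h5⟩ := M.exists_start hd (by omega) hu
    exact ⟨_, h3, fun i => M.side_iff (hZ i) hb h4 h5⟩
  obtain ⟨sz, hsz, hsz'⟩ := hstart z (hOZ _ _ hz)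
  obtain ⟨sy, hsy, hsy'⟩ := hstart y hy
  have hsz1 : Z i₀ (M.e sz) := (hsz' i₀).2 (M.mem_opp.1 hz).2
  have hsy1 : ¬ Z i₀ (M.e sy) := fun h => hyZ (M.mem_opp.2 ⟨(M.mem_opp.1 hy).1, (hsy' i₀).1 h⟩)
  obtain ⟨i, hi⟩ := hO _ (M.mem_starts.1 hsy).2.1
  have hne : sz ≠ sy := by
    rintro rfl
    exact hsy1 hsz1
  have hpair : M.starts M.O (fun _ => False) d = {sz, sy} := by
    refine (Finset.eq_of_subset_of_card_le ?_ ?_).symm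
    · intro u hu
      rw [Finset.mem_insert, Finset.mem_singleton] at hu
      rcases hu with rfl | rfl <;> assumption
    · rw [Finset.card_pair hne]
      exact h2.le
  have hsub : M.opp M.O d ⊆ M.opp (Z i₀) d ∪ M.opp (Z i) d := by
    intro u hu
    obtain ⟨s, hs, hs'⟩ := hstart u hu
    have huf := (M.mem_opp.1 hu).1
    rw [hpair, Finset.mem_insert, Finset.mem_singleton] at hs
    rw [Finset.mem_union, M.mem_opp, M.mem_opp]
    rcases hs with rfl | rfl
    · exact Or.inl ⟨huf, (hs' i₀).1 hsz1⟩
    · exact Or.inr ⟨huf, (hs' i).1 hi⟩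
  have h3 := (Finset.card_le_card hsub).trans (Finset.card_union_le _ _)
  have h4 := hg i
  omega

open Classical in
/-- A bad face meets a side in a set controlled by its curvature, its corners, and its darts
opposite to darts of other sides. -/
theorem card_opp_le_of_not_good {ι : Type} {Z : ι → D → Prop} {B : D → Prop}
    (hZ : ∀ i, M.IsSide (Z i) B) (hO : ∀ x, M.O x → ∃ i, Z i x) {d : D} (hd : M.I d)
    (hg : ∀ i, 2 * (M.opp (Z i) d).card ≤ M.len d) (i₀ : ι) {K : ℕ}
    (hK : ∀ y ∈ M.face d, ∀ L, (∀ j < L, Z i₀ (M.e (M.φ^[j] y))) → L ≤ K)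
    (hbad : ¬ M.Good B d) {near : D → Prop} (hnear : ∀ x ∈ M.face d, ∀ z ∈ M.face d,
      M.O (M.e x) → ¬ Z i₀ (M.e x) → Z i₀ (M.e z) → M.len d ≤ 12 * K → near (M.e x)) :
    ((M.opp (Z i₀) d).card : ℚ) ≤ 5 * K * (7 * (M.breaks B d).card - M.κ d +
      ((M.face d).filter fun x => near (M.e x)).card) := by
  have hκ := M.κ_le_six_breaks hZ hO hd hg
  have hs := M.card_starts_le (hZ i₀) hd
  have hs' : (M.opp (Z i₀) d).card ≤ K * (M.outerArcs d + (M.breaks B d).card) :=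
    (M.card_opp_le_mul_starts (hZ i₀).step hd hK).trans (Nat.mul_le_mul_left _ hs)
  have hs'' : ((M.opp (Z i₀) d).card : ℚ) ≤ K * (M.outerArcs d + (M.breaks B d).card) := by
    exact_mod_cast hs'
  have hoa := M.κ_le_outerArcs hd
  have hK0 : (0 : ℚ) ≤ K := Nat.cast_nonneg _
  have hν0 : (0 : ℚ) ≤ ((M.face d).filter fun x => near (M.e x)).card := Nat.cast_nonneg _
  set ν : ℚ := (((M.face d).filter fun x => near (M.e x)).card : ℚ) with hν
  set β : ℚ := ((M.breaks B d).card : ℚ) with hβ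
  have hβ0 : 0 ≤ β := Nat.cast_nonneg _
  have hfin : ∀ t : ℚ, t ≤ 5 * (7 * β - M.κ d + ν) → ((M.opp (Z i₀) d).card : ℚ) ≤ K * t →
      ((M.opp (Z i₀) d).card : ℚ) ≤ 5 * K * (7 * β - M.κ d + ν) := by
    intro t h1 h2
    have := mul_le_mul_of_nonneg_left h1 hK0
    linarith
  by_cases hb : M.breaks B d = ∅
  · have hβ1 : β = 0 := by rw [hβ, hb]; simp
    rw [hβ1] at hs'' hκ
    by_cases hκ' : M.κ d ≤ -(1 / 2)
    · refine hfin _ ?_ hs''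
      linarith
    push Not at hκ'
    rcases Finset.eq_empty_or_nonempty (M.opp (Z i₀) d) with h0 | ⟨z, hz⟩
    · refine hfin 0 (by linarith) ?_
      rw [h0]
      simp
    have h2 : M.outerArcs d = 2 := by
      have h1 : M.outerArcs d ≠ 1 := fun h => hbad ⟨hb, hκ', h⟩
      have h3 : M.outerArcs d ≠ 0 := by
        intro h
        have h4 := M.opp_eq_face_of_breaks (hZ i₀) hd hb hz h
        have h5 := hg i₀
        rw [h4, M.card_face] at h5
        have := M.len_pos d
        omega
      by_contra h4
      have h5 : (3 : ℚ) ≤ M.outerArcs d := by exact_mod_cast (by omega : 3 ≤ M.outerArcs d)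
      linarith
    obtain ⟨y, hy, hyZ, hlen⟩ := M.exists_opp_of_two hZ hO hd hg i₀ hb hκ' h2 hz
    rw [hb, h2] at hs'
    simp only [Finset.card_empty, add_zero] at hs'
    have hyf := (M.mem_opp.1 hy).1
    have h3 : near (M.e y) := hnear y hyf z (M.mem_opp.1 hz).1 (M.mem_opp.1 hy).2
      (fun h => hyZ (M.mem_opp.2 ⟨hyf, h⟩)) (M.mem_opp.1 hz).2 (by omega)
    have h4 : (1 : ℚ) ≤ ν := by
      rw [hν]
      exact_mod_cast Finset.card_pos.2 ⟨y, Finset.mem_filter.2 ⟨hyf, h3⟩⟩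
    refine hfin 2 (by linarith) ?_
    rw [mul_comm]
    exact_mod_cast (by omega : (M.opp (Z i₀) d).card ≤ 2 * K)
  · have hβ1 : 1 ≤ β := by
      rw [hβ]
      exact_mod_cast Finset.card_pos.2 (Finset.nonempty_iff_ne_empty.2 hb)
    refine hfin _ ?_ hs''
    linarith

/-- The number of darts on bad faces along a side is bounded. -/
theorem card_bad_le {ι : Type} {Z : ι → D → Prop} {B near : Finset D}
    (hZ : ∀ i, M.IsSide (Z i) (· ∈ B)) (hO : ∀ x, M.O x → ∃ i, Z i x)
    (hg : ∀ i d, M.I d → 2 * (M.opp (Z i) d).card ≤ M.len d) (i₀ : ι) {K : ℕ}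
    (hK : ∀ y, M.I y → ∀ L, (∀ j < L, Z i₀ (M.e (M.φ^[j] y))) → L ≤ K)
    (hnear : ∀ x, ∀ z ∈ M.face x, M.I x →
      M.O (M.e x) → ¬ Z i₀ (M.e x) → Z i₀ (M.e z) → M.len x ≤ 12 * K → M.e x ∈ near)
    (hB : B.card ≤ 4) (hspur : ∀ d, M.O d → M.deg d = 1 → d ∈ B) {T : Finset D}
    (hT : ∀ d ∈ T, M.I d ∧ Z i₀ (M.e d) ∧ ¬ M.Good (· ∈ B) d) :
    T.card ≤ 5 * K * (34 + near.card) := by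
  classical
  set h : D → ℚ := fun x =>
    7 * ind (M.deg x = 2 ∧ M.O (M.e x) ∧ M.σ x ∈ B) + ind (M.e x ∈ near) with hh
  have hh1 : ∀ d, ∑ x ∈ M.face d, h x = 7 * (M.breaks (· ∈ B) d).card +
      ((M.face d).filter fun x => M.e x ∈ near).card := by
    intro d
    rw [card_breaks_eq, card_filter_eq_sum_ind, Finset.mul_sum, ← Finset.sum_add_distrib]
  have hB' : (B.card : ℚ) ≤ 4 := by exact_mod_cast hB
  have hh2 : ∑ d, ind (M.I d) * h d ≤ 28 + near.card := by
    have h1 := M.sum_breaks_le B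
    have h2 : ∑ d, ind (M.I d) * ind (M.e d ∈ near) ≤ near.card := by
      have h3 : ∀ d, ind (M.I d) * ind (M.e d ∈ near) ≤ ind (M.e d ∈ near) := fun d =>
        mul_le_of_le_one_left (ind_nonneg _) (ind_le_one _)
      refine (Finset.sum_le_sum fun d _ => h3 d).trans ?_
      have h4 : Function.Bijective M.e := Function.Involutive.bijective M.e_e
      rw [h4.sum_comp fun d => ind (d ∈ near), sum_ind]
      simp
    have h3 : ∑ d, ind (M.I d) * h d =
        7 * ∑ d, ind (M.I d) * ind (M.deg d = 2 ∧ M.O (M.e d) ∧ M.σ d ∈ B) +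
          ∑ d, ind (M.I d) * ind (M.e d ∈ near) := by
      rw [Finset.mul_sum, ← Finset.sum_add_distrib]
      refine Finset.sum_congr rfl fun d _ => ?_
      simp only [hh]
      ring
    rw [h3]
    linarith
  have hκ : -6 ≤ ∑ d, ind (M.I d) * (M.κ d / M.len d) := by
    refine le_trans ?_ M.sum_κ_ge
    have h1 : ∑ d, ind (M.O d ∧ M.deg d = 1) ≤ 4 := by
      refine le_trans (Finset.sum_le_sum fun d _ =>
        ind_mono (q := d ∈ B) fun h => hspur d h.1 h.2) ?_
      rw [sum_ind]
      simpa using hB'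
    linarith
  have hT' : (T.card : ℚ) ≤
      ∑ d, ind (M.I d ∧ ¬ M.Good (· ∈ B) d) * ind (Z i₀ (M.e d)) := by
    have h1 : (T.card : ℚ) = ∑ d, ind (d ∈ T) := by
      rw [sum_ind]
      simp
    rw [h1]
    refine Finset.sum_le_sum fun d _ => ?_
    rw [← ind_and]
    exact ind_mono fun h => ⟨⟨(hT d h).1, (hT d h).2.2⟩, (hT d h).2.1⟩
  rw [sum_ind_div_per M.φ (fun d => M.I d ∧ ¬ M.Good (· ∈ B) d) (fun d => ind (Z i₀ (M.e d)))
    fun x hx => ⟨(M.I_φ x).2 hx.1, fun h =>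
      hx.2 ((M.good_iff (M.φ_mem_face.2 (M.self_mem_face x))).1 h)⟩] at hT'
  have hpt : ∀ d, ind (M.I d ∧ ¬ M.Good (· ∈ B) d) *
      ((∑ x ∈ cycleOf M.φ d, ind (Z i₀ (M.e x))) / per M.φ d) ≤
      5 * K * (ind (M.I d) * ((∑ x ∈ cycleOf M.φ d, h x) / per M.φ d) -
        ind (M.I d) * (M.κ d / M.len d)) := by
    intro d
    by_cases hd : M.I d
    swap
    · rw [ind_false (p := _ ∧ _) (fun h => hd h.1), ind_false hd]
      simp
    change ind _ * ((∑ x ∈ M.face d, ind (Z i₀ (M.e x))) / (M.len d : ℚ)) ≤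
      5 * K * (ind _ * ((∑ x ∈ M.face d, h x) / (M.len d : ℚ)) - _)
    have hge : 0 ≤ 5 * (K : ℚ) * (7 * (M.breaks (· ∈ B) d).card - M.κ d +
        ((M.face d).filter fun x => M.e x ∈ near).card) := by
      refine mul_nonneg (by positivity) ?_
      have h1 := M.κ_le_six_breaks hZ hO hd fun i => hg i d hd
      have h2 : (0 : ℚ) ≤ (M.breaks (· ∈ B) d).card := Nat.cast_nonneg _
      have h3 : (0 : ℚ) ≤ ((M.face d).filter fun x => M.e x ∈ near).card := Nat.cast_nonneg _
      linarith
    have hle : ind (M.I d ∧ ¬ M.Good (· ∈ B) d) * ∑ x ∈ M.face d, ind (Z i₀ (M.e x)) ≤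
        5 * (K : ℚ) * (7 * (M.breaks (· ∈ B) d).card - M.κ d +
        ((M.face d).filter fun x => M.e x ∈ near).card) := by
      by_cases hgood : M.Good (· ∈ B) d
      · rw [ind_false (p := M.I d ∧ ¬ M.Good (· ∈ B) d) (fun h => h.2 hgood), zero_mul]
        exact hge
      · rw [ind_true (p := M.I d ∧ ¬ M.Good (· ∈ B) d) ⟨hd, hgood⟩, one_mul, sum_ind]
        have h5 := M.card_opp_le_of_not_good hZ hO hd (fun i => hg i d hd) i₀ (K := K)
          (fun y hy => hK y (M.I_of_mem_face hd hy)) hgood (near := (· ∈ near))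
          fun x hx z hz h1 h2 h3 h4 => hnear x z (by rwa [M.face_eq hx])
            (M.I_of_mem_face hd hx) h1 h2 h3 (by rwa [M.len_eq hx])
        refine le_trans (le_of_eq ?_) (h5.trans (le_of_eq ?_))
        · unfold opp
          congr
        · congr
    rw [ind_true hd, one_mul, one_mul, hh1, ← sub_div, mul_div_assoc', mul_div_assoc']
    refine div_le_div_of_nonneg_right (hle.trans (le_of_eq ?_)) (Nat.cast_nonneg _)
    ring
  have hsum := hT'.trans (Finset.sum_le_sum fun d _ => hpt d)
  rw [← Finset.mul_sum, Finset.sum_sub_distrib,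
    ← sum_ind_div_per M.φ M.I h fun x hx => (M.I_φ x).2 hx] at hsum
  have hfin : (T.card : ℚ) ≤ 5 * K * (34 + near.card) := by
    refine hsum.trans (mul_le_mul_of_nonneg_left ?_ (by positivity))
    linarith
  exact_mod_cast hfin

end Diagram

end

section

/-- Among sufficiently many consecutive indices, few of which are bad, there is a long run
without bad indices. -/
theorem exists_window {p : ℕ → Prop} {q W a : ℕ} {T : Finset ℕ} (hT : T.card ≤ q)
    (h : ∀ i < a, ¬ p i → i ∈ T) (ha : (q + 1) * W ≤ a) :
    ∃ s, s + W ≤ a ∧ ∀ i, s ≤ i → i < s + W → p i := by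
  by_contra hc
  push Not at hc
  have hle : ∀ j < q + 1, j * W + W ≤ a := fun j hj => by
    refine le_trans ?_ ha
    rw [← Nat.succ_mul]
    exact Nat.mul_le_mul_right _ hj
  choose! f hf using fun j (hj : j < q + 1) => hc (j * W) (hle j hj)
  have h1 : (Finset.range (q + 1)).card ≤ T.card := by
    refine Finset.card_le_card_of_injOn f (fun j hj => ?_) fun i hi j hj hij => ?_
    · rw [Finset.mem_coe, Finset.mem_range] at hj
      have h2 := hf j hj
      exact h _ (lt_of_lt_of_le h2.2.1 (hle j hj)) h2.2.2
    · rw [Finset.mem_coe, Finset.mem_range] at hi hj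
      have h2 := hf i hi
      have h3 := hf j hj
      rw [← hij] at h3
      by_contra hne
      rcases Nat.lt_or_gt_of_ne hne with h4 | h4
      · have := Nat.mul_le_mul_right W h4
        rw [Nat.succ_mul] at this
        omega
      · have := Nat.mul_le_mul_right W h4
        rw [Nat.succ_mul] at this
        omega
  rw [Finset.card_range] at h1
  omega

variable {S : Type} {P : C6Presentation S} {D : Type} [Fintype D] [DecidableEq D]

/-- A diagram whose boundary, read from `x₀`, starts with a geodesic of length `a`, and whose
boundary is divided into four geodesic sides. At most `ν` outer darts on the other sides
are near the first side, and faces meet the first side in arcs of length at most `K`. -/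
structure Quad (M : Diagram D) (pos : D → P.Grp) (K ν : ℕ) (x₀ : D) (a : ℕ) where
  Z : Fin 4 → D → Prop
  B : Finset D
  near : Finset D
  O_base : M.O x₀
  isSide : ∀ i, M.IsSide (Z i) (· ∈ B)
  outer : ∀ x, M.O x → ∃ i, Z i x
  first : ∀ x, Z 0 x ↔ ∃ i < a, M.φ^[i] x₀ = x
  le_len : a ≤ M.len x₀
  two_mul_le : ∀ i d, M.I d → 2 * (M.opp (Z i) d).card ≤ M.len d
  arc_le : ∀ y, M.I y → ∀ L, (∀ j < L, Z 0 (M.e (M.φ^[j] y))) → L ≤ K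
  near_of_face : ∀ x, ∀ z ∈ M.face x, M.I x →
    M.O (M.e x) → ¬ Z 0 (M.e x) → Z 0 (M.e z) → M.len x ≤ 12 * K → M.e x ∈ near
  near_of_edge : ∀ x, Z 0 x → M.O (M.e x) → M.e x ∈ near
  card_near : near.card ≤ ν
  card_B : B.card ≤ 4
  spur : ∀ d, M.O d → M.deg d = 1 → d ∈ B
  geod : ∀ i j, i ≤ j → j ≤ a → P.dist (pos (M.φ^[i] x₀)) (pos (M.φ^[j] x₀)) = j - i
  pos_e : ∀ d, pos (M.e d) = pos (M.φ d)
  dist_le : ∀ d n, P.dist (pos d) (pos (M.φ^[n] d)) ≤ n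

namespace Quad

variable {M : Diagram D} {pos : D → P.Grp} {K ν : ℕ} {x₀ : D} {a : ℕ}
  (Q : Quad M pos K ν x₀ a)

include Q

theorem lt_len : a < M.len x₀ := by
  refine lt_of_le_of_ne Q.le_len fun h => ?_
  have h1 := Q.geod 0 a (Nat.zero_le _) le_rfl
  rw [h, show M.φ^[M.len x₀] x₀ = x₀ from iterate_per M.φ x₀] at h1
  have h2 := M.len_pos x₀
  rw [Function.iterate_zero_apply, dist_self] at h1
  omega

theorem inj {i j : ℕ} (hi : i ≤ a) (hj : j ≤ a) (h : M.φ^[i] x₀ = M.φ^[j] x₀) : i = j :=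
  M.iter_inj (lt_of_le_of_lt hi Q.lt_len) (lt_of_le_of_lt hj Q.lt_len) h

/-- A good index on the first side: the face across its edge is good. -/
def GoodAt (i : ℕ) : Prop :=
  M.I (M.e (M.φ^[i] x₀)) ∧ M.Good (· ∈ Q.B) (M.e (M.φ^[i] x₀))

/-- All but boundedly many indices on the first side are good. -/
theorem exists_bad : ∃ T : Finset ℕ, T.card ≤ 5 * K * (34 + ν) + ν ∧
    ∀ i < a, ¬ Q.GoodAt i → i ∈ T := by
  classical
  set T : Finset D := Finset.univ.filter fun d =>
    M.I d ∧ Q.Z 0 (M.e d) ∧ ¬ M.Good (· ∈ Q.B) d with hTdef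
  have hT : T.card ≤ 5 * K * (34 + Q.near.card) :=
    M.card_bad_le Q.isSide Q.outer Q.two_mul_le 0 Q.arc_le Q.near_of_face Q.card_B Q.spur
      fun d hd => (Finset.mem_filter.1 hd).2
  refine ⟨(Finset.range a).filter fun i => ¬ Q.GoodAt i, ?_, fun i hi h =>
    Finset.mem_filter.2 ⟨Finset.mem_range.2 hi, h⟩⟩
  have h1 : ((Finset.range a).filter fun i => ¬ Q.GoodAt i).card ≤ (T ∪ Q.near).card := by
    refine Finset.card_le_card_of_injOn (fun i => M.e (M.φ^[i] x₀)) (fun i hi => ?_)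
      fun i hi j hj hij => ?_
    · rw [Finset.mem_coe, Finset.mem_filter, Finset.mem_range] at hi
      obtain ⟨h2, h3⟩ := hi
      have hZ : Q.Z 0 (M.φ^[i] x₀) := (Q.first _).2 ⟨i, h2, rfl⟩
      rw [Finset.mem_coe, Finset.mem_union]
      by_cases hO : M.O (M.e (M.φ^[i] x₀))
      · exact Or.inr (Q.near_of_edge _ hZ hO)
      · have hI := (M.live_e (Or.inl ((M.O_iter x₀ i).2 Q.O_base))).resolve_left hO
        refine Or.inl (Finset.mem_filter.2 ⟨Finset.mem_univ _, hI, ?_, fun hg => h3 ⟨hI, hg⟩⟩)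
        rwa [M.e_e]
    · rw [Finset.mem_coe, Finset.mem_filter, Finset.mem_range] at hi hj
      exact Q.inj hi.1.le hj.1.le (M.e.injective hij)
  have h2 := Finset.card_union_le T Q.near
  have h3 := Q.card_near
  have h4 : 5 * K * (34 + Q.near.card) ≤ 5 * K * (34 + ν) :=
    Nat.mul_le_mul_left _ (by omega)
  omega

omit Q in
variable (M x₀ a) in
/-- The edges of the first side with indices from `lo` to `hi - 1` form the outer arc of a
good face. -/
structure Run (lo hi : ℕ) : Prop where
  lt : lo < hi
  le : hi ≤ a
  arc : M.GoodArc (M.e (M.φ^[hi - 1] x₀)) (hi - lo)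
  opp : ∀ j < hi - lo, M.φ^[j] (M.e (M.φ^[hi - 1] x₀)) = M.e (M.φ^[hi - 1 - j] x₀)

end Quad

end

section

variable {S : Type} {P : C6Presentation S} {D : Type} [Fintype D] [DecidableEq D]

namespace Quad

variable {M : Diagram D} {pos : D → P.Grp} {K ν : ℕ} {x₀ : D} {a : ℕ}
  (Q : Quad M pos K ν x₀ a)

/-- A good index lies on a run. -/
theorem GoodAt.exists_run {i : ℕ} (h : Q.GoodAt i) (hi : i < a) :
    ∃ lo hi, Run M x₀ a lo hi ∧ lo ≤ i ∧ i < hi := by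
  obtain ⟨hI, hb, hκ, h1⟩ := h
  have hmem : M.e (M.φ^[i] x₀) ∈ M.opp (Q.Z 0) (M.e (M.φ^[i] x₀)) :=
    M.mem_opp.2 ⟨M.self_mem_face _, by rw [M.e_e]; exact (Q.first _).2 ⟨i, hi, rfl⟩⟩
  obtain ⟨h4, -, hopp⟩ := M.four_le_of_geodesic (Q.isSide 0) hI hb hmem h1.le
    (Q.two_mul_le 0 _ hI)
  obtain ⟨x, hx, n, hn⟩ := M.exists_goodArc hI h1 h4 hκ
  have hm : ∀ j < n, ∃ m < a, M.φ^[m] x₀ = M.e (M.φ^[j] x) := fun j hj => by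
    have h5 : M.φ^[j] x ∈ M.opp M.O (M.e (M.φ^[i] x₀)) :=
      M.mem_opp.2 ⟨(M.φ_iter_mem_face j).2 hx, hn.outer j hj⟩
    rw [← hopp] at h5
    exact (Q.first _).1 (M.mem_opp.1 h5).2
  obtain ⟨m, hma, hm0⟩ := hm 0 hn.pos
  have hstep : ∀ j < n, j ≤ m ∧ M.φ^[m - j] x₀ = M.e (M.φ^[j] x) := by
    intro j
    induction j with
    | zero => exact fun _ => ⟨Nat.zero_le _, hm0⟩
    | succ j ih =>
      intro hj
      obtain ⟨h5, h6⟩ := ih (by omega)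
      obtain ⟨k, hk, hk'⟩ := hm (j + 1) hj
      have h7 := hn.deg_two (j + 1) (by omega) hj
      rw [Function.iterate_succ_apply' M.φ] at h7 hk'
      have h8 : M.φ^[k + 1] x₀ = M.φ^[m - j] x₀ := by
        rw [Function.iterate_succ_apply' M.φ, hk', h6, M.φ_e_of_deg h7]
      have h9 := Q.inj (by omega) (by omega) h8
      refine ⟨by omega, ?_⟩
      rw [Function.iterate_succ_apply' M.φ, ← hk']
      congr 1
      omega
  have hx' : M.e (M.φ^[m] x₀) = x := by rw [hm0, M.e_e, Function.iterate_zero_apply]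
  have hlen := (hstep (n - 1) (by have := hn.pos; omega)).1
  have hpos := hn.pos
  refine ⟨m + 1 - n, m + 1, ⟨by omega, hma, ?_, ?_⟩, ?_⟩
  · rw [Nat.add_sub_cancel, hx', show m + 1 - (m + 1 - n) = n by omega]
    exact hn
  · intro j hj
    rw [Nat.add_sub_cancel, hx', (hstep j (by omega)).2, M.e_e]
  · obtain ⟨j, hj, hj'⟩ := hn.exists_iter (y := M.e (M.φ^[i] x₀))
      (by rw [M.face_eq hx]; exact M.self_mem_face _)
      (by rw [M.e_e]; exact (M.O_iter x₀ i).2 Q.O_base)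
    have h5 := hstep j hj
    rw [hj', M.e_e] at h5
    have := Q.inj (by omega) hi.le h5.2
    omega

namespace Run

variable {lo hi : ℕ} (h : Run M x₀ a lo hi)

include h

theorem iter_sub : M.φ^[hi - lo] (M.e (M.φ^[hi - 1] x₀)) = M.σ (M.φ^[lo] x₀) := by
  have h1 := h.lt
  have h2 := h.opp (hi - lo - 1) (by omega)
  rw [show hi - lo = hi - lo - 1 + 1 by omega, Function.iterate_succ_apply' M.φ, h2, M.σ_apply]
  congr 4
  omega

/-- Consecutive runs are adjacent. -/
theorem eq_of_le {lo' hi' : ℕ} (h' : Run M x₀ a lo' hi') (h1 : lo' ≤ hi) (h2 : hi < hi') :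
    lo' = hi := by
  by_contra hne
  have h3 := h.lt
  have h4 := h'.opp (hi' - hi) (by omega)
  have h5 := h'.arc.deg_two (hi' - hi) (by omega) (by omega)
  rw [h4, show hi' - 1 - (hi' - hi) = hi - 1 by omega, h.arc.deg_left] at h5
  omega

end Run

variable (M pos x₀) in
/-- The endpoint of the inner arc following a run. -/
noncomputable def far (i : ℕ) : P.Grp :=
  pos (M.φ^[M.run (M.σ (M.φ^[i] x₀))] (M.σ (M.φ^[i] x₀)))

include Q

theorem length_le {lo hi : ℕ} (h : Run M x₀ a lo hi) : hi - lo ≤ K := by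
  refine Q.arc_le _ h.arc.I _ fun j hj => ?_
  rw [h.opp j hj, M.e_e]
  have := h.le
  have := h.lt
  exact (Q.first _).2 ⟨_, by omega, rfl⟩

theorem dist_far_le {lo hi : ℕ} (h : Run M x₀ a lo hi) :
    P.dist (pos (M.φ^[lo] x₀)) (far M pos x₀ lo) ≤ K := by
  have hlt := h.lt
  have h1 : pos (M.σ (M.φ^[lo] x₀)) = pos (M.φ^[lo] x₀) := by
    rw [M.σ_apply, ← Q.pos_e, M.e_e]
  have h2 := Q.dist_le (M.σ (M.φ^[lo] x₀)) (M.run (M.σ (M.φ^[lo] x₀)))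
  rw [h1] at h2
  refine h2.trans ?_
  have h3 := Q.length_le h
  have h4 := h.arc.six_mul_le
  have h5 := h.arc.inner _ le_rfl h.arc.lt
  have h6 := h.arc.deg_right
  have h7 : M.I (M.φ^[hi - lo] (M.e (M.φ^[hi - 1] x₀))) := (M.I_iter _ _).2 h.arc.I
  have h8 : M.len (M.φ^[hi - lo] (M.e (M.φ^[hi - 1] x₀))) = M.len (M.e (M.φ^[hi - 1] x₀)) :=
    M.len_eq ((M.φ_iter_mem_face _).2 (M.self_mem_face _))
  rw [h.iter_sub] at h5 h6 h7 h8
  have h9 := M.six_mul_run_lt h7 h5 (by omega)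
  have h10 := h.arc.lt
  omega

theorem dist_far_far_lt {lo mid hi : ℕ} (h : Run M x₀ a lo mid) (h' : Run M x₀ a mid hi) :
    P.dist (far M pos x₀ lo) (far M pos x₀ mid) + 1 ≤ mid - lo := by
  have hlt := h.lt
  have hσ : M.σ (M.e (M.φ^[mid - 1] x₀)) = M.φ^[mid] x₀ := by
    rw [M.σ_apply, M.e_e, ← Function.iterate_succ_apply' M.φ]
    congr 2
    omega
  have ht : M.I (M.σ (M.φ^[mid] x₀)) := by
    rw [← h'.iter_sub]
    exact (M.I_iter _ _).2 h'.arc.I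
  have hdt : M.deg (M.σ (M.φ^[mid] x₀)) = 3 := by
    rw [M.deg_σ, ← hσ, M.deg_σ, h.arc.deg_left]
  have htx : M.φ (M.e (M.σ (M.φ^[mid] x₀))) = M.e (M.φ^[mid - 1] x₀) := by
    rw [← M.σ_apply, ← hσ]
    have h1 := iterate_per M.σ (M.e (M.φ^[mid - 1] x₀))
    rw [show per M.σ (M.e (M.φ^[mid - 1] x₀)) = 3 from h.arc.deg_left] at h1
    exact h1
  obtain ⟨p, hp1, hp2, hp3⟩ := h.arc.exists_shortcut ht hdt.ge htx
  rw [h.iter_sub] at hp1 hp2 hp3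
  obtain ⟨hk, -⟩ := M.run_spec hdt.ge
  have h3 : pos (M.φ^[p] (M.σ (M.φ^[lo] x₀))) = far M pos x₀ mid := by
    rw [hp3, Q.pos_e, ← Function.iterate_succ_apply' M.φ]
    unfold far
    congr 3
    omega
  have h4 := Q.dist_le (M.φ^[M.run (M.σ (M.φ^[lo] x₀))] (M.σ (M.φ^[lo] x₀)))
    (p - M.run (M.σ (M.φ^[lo] x₀)))
  rw [← Function.iterate_add_apply, Nat.sub_add_cancel hp1, h3] at h4
  unfold far at h4 ⊢
  omega

/-- The first side of a quadrangle is bounded. -/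
theorem le_bound : a ≤ (5 * K * (34 + ν) + ν + 1) * ((2 * K + 1) * K + 1) := by
  by_contra hlt
  push Not at hlt
  obtain ⟨T, hT, hbad⟩ := Q.exists_bad
  obtain ⟨s, hs, hgood⟩ := exists_window hT hbad hlt.le
  obtain ⟨h₀, h₁, hr₀, h₀s, hsh⟩ := (hgood s le_rfl (by omega)).exists_run Q (by omega)
  have key : ∀ N ≤ 2 * K + 1, ∃ lo hi, Run M x₀ a lo hi ∧ h₀ ≤ lo ∧ s < hi ∧
      hi ≤ h₀ + (N + 1) * K ∧ P.dist (far M pos x₀ h₀) (far M pos x₀ lo) + N ≤ lo - h₀ := by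
    intro N
    induction N with
    | zero =>
      intro _
      have := Q.length_le hr₀
      refine ⟨h₀, h₁, hr₀, le_rfl, hsh, by omega, ?_⟩
      rw [dist_self]
      omega
    | succ N ih =>
      intro hN
      obtain ⟨lo, hi, hr, h1, h2, h3, h4⟩ := ih (by omega)
      have h5 : (N + 1) * K ≤ (2 * K + 1) * K := Nat.mul_le_mul_right _ (by omega)
      obtain ⟨lo', hi', hr', h6, h7⟩ := (hgood hi h2.le (by omega)).exists_run Q (by omega)
      obtain rfl := hr.eq_of_le hr' h6 h7
      have h8 := hr.lt
      have h9 := Q.dist_far_far_lt hr hr'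
      have h10 := dist_triangle (far M pos x₀ h₀) (far M pos x₀ lo) (far M pos x₀ lo')
      have h11 := Q.length_le hr'
      refine ⟨lo', hi', hr', by omega, by omega, ?_, by omega⟩
      rw [Nat.succ_mul]
      omega
  obtain ⟨lo, hi, hr, h1, -, -, h4⟩ := key _ le_rfl
  have h5 := Q.dist_far_le hr₀
  have h6 := Q.dist_far_le hr
  have h7 := Q.geod h₀ lo h1 (by have := hr.lt; have := hr.le; omega)
  have h8 := dist_triangle (pos (M.φ^[h₀] x₀)) (far M pos x₀ h₀) (pos (M.φ^[lo] x₀))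
  have h9 := dist_triangle (far M pos x₀ h₀) (far M pos x₀ lo) (pos (M.φ^[lo] x₀))
  rw [dist_comm (far M pos x₀ lo)] at h9
  omega

end Quad

end

section

variable {S : Type} {P : C6Presentation S} {α : Set P.Grp}

/-- Points of a geodesic are joined by geodesic words along it. -/
theorem C6Presentation.Coord.exists_path {κ : P.Grp → ℤ} (hκ : P.Coord α κ) {y y' : P.Grp}
    (hy : y ∈ α) (hy' : y' ∈ α) : ∃ A : Word S, y * P.elt A = y' ∧ A.length = P.dist y y' ∧
      ∀ i ≤ A.length, y * P.elt (A.take i) ∈ α := by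
  induction hn : P.dist y y' generalizing y with
  | zero =>
    refine ⟨[], ?_, rfl, fun i _ => ?_⟩
    · rw [elt_nil, mul_one, eq_of_dist_eq_zero hn]
    · rwa [List.take_nil, elt_nil, mul_one]
  | succ n ih =>
    have h1 := hκ.dist_eq y hy y' hy'
    rw [hn] at h1
    obtain ⟨z, hz, h2, h3⟩ : ∃ z ∈ α, |κ y - κ z| = 1 ∧ |κ z - κ y'| = n := by
      rcases lt_or_ge (κ y) (κ y') with h | h
      · obtain ⟨z, hz, h2⟩ := hκ.surj y hy y' hy' (κ y + 1) (by omega) (by omega)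
        rw [abs_of_neg (by omega)] at h1
        push_cast at h1
        refine ⟨z, hz, ?_, ?_⟩
        · rw [h2, abs_of_neg] <;> omega
        · rw [h2, abs_of_nonpos] <;> omega
      · rw [abs_of_nonneg (by omega)] at h1
        push_cast at h1
        obtain ⟨z, hz, h2⟩ := hκ.surj y' hy' y hy (κ y - 1) (by omega) (by omega)
        refine ⟨z, hz, ?_, ?_⟩
        · rw [h2, abs_of_nonneg] <;> omega
        · rw [h2, abs_of_nonneg] <;> omega
    rw [← hκ.dist_eq y hy z hz] at h2
    rw [← hκ.dist_eq z hz y' hy'] at h3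
    obtain ⟨A, hA1, hA2, hA3⟩ := ih hz (by exact_mod_cast h3)
    obtain ⟨v, hv1, hv2⟩ := exists_geodesic_word (P := P) (y⁻¹ * z)
    have hv3 : v.length = 1 := by
      rw [hv2]
      exact_mod_cast h2
    obtain ⟨l, rfl⟩ := List.length_eq_one_iff.1 hv3
    have hl : y * P.elt [l] = z := by rw [hv1, mul_inv_cancel_left]
    have hcons : ∀ u : Word S, y * P.elt (l :: u) = z * P.elt u := fun u => by
      rw [← hl, ← List.singleton_append, elt_append, mul_assoc]
    refine ⟨l :: A, by rw [hcons, hA1], by simp [hA2], fun i hi => ?_⟩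
    cases i with
    | zero => simpa [elt_nil] using hy
    | succ i =>
      rw [List.take_succ_cons, hcons]
      exact hA3 i (by simpa using hi)

variable {D : Type} [Fintype D] [DecidableEq D] {lab : D → S × Bool} {pos : D → P.Grp}

/-- Positions along a face are read off from its labels. -/
theorem Cfg.pos_iterate (c : Cfg P lab pos) (d : D) {i : ℕ} (hi : i ≤ per c.φ d) :
    pos (c.φ^[i] d) = pos d * P.elt (((faceList c.φ d).map lab).take i) := by
  induction i with
  | zero => simp [elt_nil]
  | succ i ih =>
    rw [Function.iterate_succ_apply' c.φ, c.pos_φ, ih (by omega), List.take_add_one,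
      getElem?_map_faceList lab (by omega), elt_append, mul_assoc]
    congr 2
    simp [elt_cons, elt_nil]

/-- A relator face meets the geodesic side in short arcs. -/
theorem IsFilling.arc_le {c : Cfg P lab pos} {l₀ : List D} {w : Word S} {g : P.Grp}
    (hF : IsFilling c l₀ w g) (hmin : ∀ m, FillSize P w g m → c.size l₀ ≤ m) (hne : l₀ ≠ [])
    {κ : P.Grp → ℤ} (hκ : P.Coord α κ) {K : ℕ} (hK : P.StepBound α K) {x₀ : D} {n : ℕ}
    (hg : c.GeodArc x₀ 0 n) (hα : ∀ i ≤ n, pos (c.φ^[i] x₀) ∈ α) {y : D}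
    (hy : (hF.diagram hmin hne).I y) {L : ℕ} (hL : ∀ j < L, c.Arc x₀ 0 n (c.e (c.φ^[j] y))) :
    L ≤ K := by
  have h1 := hF.two_mul_card_opp_le hmin hne hg y
  have hlen := (hF.diagram hmin hne).len_pos y
  have h2 : min L ((hF.diagram hmin hne).len y) ≤
      ((hF.diagram hmin hne).opp (c.Arc x₀ 0 n) y).card := by
    rw [← Finset.card_range (min _ _)]
    refine Finset.card_le_card_of_injOn (fun j => c.φ^[j] y) (fun j hj => ?_) fun i hi j hj h => ?_
    · rw [Finset.mem_coe, Finset.mem_range, lt_min_iff] at hj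
      exact (hF.diagram hmin hne).mem_opp.2 ⟨((hF.diagram hmin hne).φ_iter_mem_face j).2
        ((hF.diagram hmin hne).self_mem_face y), hL j hj.1⟩
    · rw [Finset.mem_coe, Finset.mem_range, lt_min_iff] at hi hj
      exact (hF.diagram hmin hne).iter_inj hi.2 hj.2 h
  have h3 : 2 * L ≤ per c.φ y := by
    change _ ≤ (hF.diagram hmin hne).len y
    omega
  rcases Nat.eq_zero_or_pos L with rfl | hL0
  · exact Nat.zero_le _
  have hr := hF.faceWord_mem hy.1 hy.2
  rw [← List.take_append_drop L ((faceList c.φ y).map lab)] at hr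
  have hs : (((faceList c.φ y).map lab).take L).length = L := by
    rw [List.length_take, List.length_map, length_faceList]
    omega
  rw [← hs]
  refine hK.length_le hκ hr ?_ (pos y) fun i hi => ?_
  · rw [hs, List.length_drop, List.length_map, length_faceList]
    omega
  · rw [hs] at hi
    rw [List.take_take, min_eq_left hi, ← c.pos_iterate y (by omega)]
    rcases hi.lt_or_eq with hi | rfl
    · obtain ⟨m, -, hm, hm'⟩ := hL i hi
      have := hα (m + 1) hm
      rwa [Function.iterate_succ_apply' c.φ, hm', c.pos_φ_e] at this
    · obtain ⟨m, -, hm, hm'⟩ := hL (i - 1) (by omega)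
      have := hα m hm.le
      rwa [hm', c.pos_e', ← Function.iterate_succ_apply' c.φ, Nat.succ_eq_add_one,
        Nat.sub_add_cancel hL0] at this

end

section

variable {S : Type} {P : C6Presentation S} {α : Set P.Grp}

/-- If `q` is not farther from `p` than `α`, then closest points of `α` to `p` and `q` are
close to each other. -/
theorem C6Presentation.StepBound.dist_proj_le {κ : P.Grp → ℤ} (hκ : P.Coord α κ) {K : ℕ}
    (hK : P.StepBound α K) {p q y y' : P.Grp} (hp : P.IsProj α p y) (hq : P.IsProj α q y')
    (hpq : P.dist p q ≤ P.dist p y) :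
    P.dist y y' ≤ (5 * K * (34 + 3 * (6 * K + 1)) + 3 * (6 * K + 1) + 1) *
      ((2 * K + 1) * K + 1) := by
  obtain ⟨A, hA, hAl, hAα⟩ := hκ.exists_path hp.1 hq.1
  obtain ⟨B, hB, hBl⟩ := exists_geodesic_word (P := P) (y'⁻¹ * q)
  obtain ⟨X, hX, hXl⟩ := exists_geodesic_word (P := P) (q⁻¹ * p)
  obtain ⟨Y, hY, hYl⟩ := exists_geodesic_word (P := P) (p⁻¹ * y)
  have hAg : wordLength P.gens (P.elt A) = A.length := by
    rw [hAl, ← hA]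
    unfold C6Presentation.dist
    rw [inv_mul_cancel_left]
  have hB' : y' * P.elt B = q := by rw [hB, mul_inv_cancel_left]
  have hX' : q * P.elt X = p := by rw [hX, mul_inv_cancel_left]
  have hY' : p * P.elt Y = y := by rw [hY, mul_inv_cancel_left]
  have hBd : B.length = P.dist q y' := by rw [hBl, dist_comm]; rfl
  have hXd : X.length = P.dist p q := by rw [hXl, dist_comm]; rfl
  have hYd : Y.length = P.dist p y := hYl
  rw [← hB] at hBl
  rw [← hX] at hXl
  rw [← hY] at hYl
  rw [← hAl]
  set w := A ++ B ++ X ++ Y with hw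
  by_cases hw0 : w = []
  · have : A.length = 0 := by
      have := congrArg List.length hw0
      simp only [hw, List.length_append, List.length_nil] at this
      omega
    rw [this]
    exact Nat.zero_le _
  have hw1 : P.elt w = 1 := by
    rw [hw, elt_append, elt_append, elt_append]
    refine mul_left_cancel (a := y) ?_
    rw [← mul_assoc, ← mul_assoc, ← mul_assoc, hA, hB', hX', hY', mul_one]
  classical
  have hex := exists_filling hw0 hw1 y
  obtain ⟨D, hD1, hD2, lab, pos, c, l₀, hF, hsize⟩ := Nat.find_spec hex
  have hmin : ∀ m, FillSize P w y m → c.size l₀ ≤ m := fun m hm => by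
    rw [hsize]
    exact Nat.find_min' hex hm
  obtain ⟨x₀, hl, hper, -, hpos⟩ := hF.exists_base hw0
  have hne : l₀ ≠ [] := by
    rintro rfl
    exact hw0 hF.word.symm
  set M := hF.diagram hmin hne with hM
  set a := A.length with ha
  set b := B.length with hb
  set x := X.length with hx
  set z := Y.length with hz
  have hn : w.length = a + b + x + z := by simp [hw, ha, hb, hx, hz]; ring
  rw [hn] at hper
  have hgA : c.GeodArc x₀ 0 a := by
    have := Cfg.geodArc (c := c) (x₀ := x₀) (g := y) (u := []) (v := A) (w := B ++ X ++ Y)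
      (by simpa [hw, List.append_assoc] using hpos) hAg
    simpa using this
  have hgB : c.GeodArc x₀ a (a + b) :=
    Cfg.geodArc (c := c) (x₀ := x₀) (g := y) (u := A) (v := B) (w := X ++ Y)
      (by simpa [hw, List.append_assoc] using hpos) hBl.symm
  have hgX : c.GeodArc x₀ (a + b) (a + b + x) := by
    have := Cfg.geodArc (c := c) (x₀ := x₀) (g := y) (u := A ++ B) (v := X) (w := Y)
      (by simpa [hw, List.append_assoc] using hpos) hXl.symm
    simpa using this
  have hgY : c.GeodArc x₀ (a + b + x) (a + b + x + z) := by
    have := Cfg.geodArc (c := c) (x₀ := x₀) (g := y) (u := A ++ B ++ X) (v := Y) (w := [])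
      (by simpa [hw, List.append_assoc] using hpos) hYl.symm
    simpa [add_assoc] using this
  have hq' : pos (c.φ^[a + b] x₀) = q := by
    rw [hpos _ (by omega), hw, List.append_assoc, List.take_append_of_le_length (by simp [ha, hb]),
      List.take_of_length_le (by simp [ha, hb]), elt_append, ← mul_assoc, hA, hB']
  have hp' : pos (c.φ^[a + b + x] x₀) = p := by
    rw [hpos _ (by omega), hw, List.take_append_of_le_length (by simp [ha, hb, hx, add_assoc]),
      List.take_of_length_le (by simp [ha, hb, hx, add_assoc]), elt_append, elt_append, ← mul_assoc,
      ← mul_assoc, hA, hB', hX']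
  have hposα : ∀ i ≤ a, pos (c.φ^[i] x₀) ∈ α := fun i hi => by
    rw [hpos i (by omega), hw, List.append_assoc, List.append_assoc,
      List.take_append_of_le_length hi]
    exact hAα i hi
  have hnear : ∀ k, a ≤ k → k ≤ a + b + x + z → ∀ u ∈ α,
      P.dist (pos (c.φ^[k] x₀)) u ≤ 6 * K →
      (a ≤ k ∧ k ≤ a + 6 * K) ∨ (a + b ≤ k ∧ k ≤ a + b + 6 * K) ∨
        (a + b + x + z - 6 * K ≤ k ∧ k ≤ a + b + x + z) := by
    intro k hk1 hk2 u hu hku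
    rcases le_or_gt k (a + b) with h1 | h1
    · have h2 := hgB k (a + b) hk1 h1 le_rfl
      have h3 := hq.2 u hu
      have h4 := dist_triangle q (pos (c.φ^[k] x₀)) u
      rw [hq', dist_comm] at h2
      omega
    rcases le_or_gt k (a + b + x) with h5 | h5
    · have h2 := hgX k (a + b + x) h1.le h5 le_rfl
      have h3 := hp.2 u hu
      have h4 := dist_triangle p (pos (c.φ^[k] x₀)) u
      rw [hp', dist_comm] at h2
      omega
    · have h2 := hgY (a + b + x) k le_rfl h5.le hk2
      have h3 := hp.2 u hu
      have h4 := dist_triangle p (pos (c.φ^[k] x₀)) u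
      rw [hp'] at h2
      omega
  set lo : Fin 4 → ℕ := ![0, a, a + b, a + b + x] with hlo
  set hi : Fin 4 → ℕ := ![a, a + b, a + b + x, a + b + x + z] with hhi
  set C : Finset D := {x₀, c.φ^[a] x₀, c.φ^[a + b] x₀, c.φ^[a + b + x] x₀} with hC
  have hn0 : c.φ^[a + b + x + z] x₀ = x₀ := by
    rw [← hper]
    exact iterate_per _ _
  have hside : ∀ i, c.φ^[lo i] x₀ ∈ C ∧ c.φ^[hi i] x₀ ∈ C ∧ hi i ≤ a + b + x + z ∧
      c.GeodArc x₀ (lo i) (hi i) := by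
    intro i
    fin_cases i
    · exact ⟨by simp [hlo, hC], by simp [hhi, hC], by simp only [hhi]; change a ≤ _; omega, hgA⟩
    · exact ⟨by simp [hlo, hC], by simp [hhi, hC], by simp only [hhi]; change a + b ≤ _; omega, hgB⟩
    · exact ⟨by simp [hlo, hC], by simp [hhi, hC],
        by simp only [hhi]; change a + b + x ≤ _; omega, hgX⟩
    · exact ⟨by simp [hlo, hC], by simp [hhi, hC, hn0], le_rfl, hgY⟩
  have hcov : ∀ m < a + b + x + z, ∃ i, lo i ≤ m ∧ m < hi i := by
    intro m hm
    rcases lt_or_ge m a with h1 | h1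
    · exact ⟨0, Nat.zero_le _, h1⟩
    rcases lt_or_ge m (a + b) with h2 | h2
    · exact ⟨1, h1, h2⟩
    rcases lt_or_ge m (a + b + x) with h3 | h3
    · exact ⟨2, h2, h3⟩
    · exact ⟨3, h3, hm⟩
  have hO : ∀ d, M.O d → ∃ m < a + b + x + z, c.φ^[m] x₀ = d := fun d hd => by
    have h1 : d ∈ l₀ := hd
    rw [hl, mem_faceList, sameCycle_iff, hper] at h1
    exact h1
  set I : Finset ℕ := Finset.Icc a (a + 6 * K) ∪ Finset.Icc (a + b) (a + b + 6 * K) ∪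
    Finset.Icc (a + b + x + z - 6 * K) (a + b + x + z) with hI
  have hIcard : I.card ≤ 3 * (6 * K + 1) := by
    have h1 := Finset.card_union_le (Finset.Icc a (a + 6 * K) ∪ Finset.Icc (a + b) (a + b + 6 * K))
      (Finset.Icc (a + b + x + z - 6 * K) (a + b + x + z))
    have h2 := Finset.card_union_le (Finset.Icc a (a + 6 * K))
      (Finset.Icc (a + b) (a + b + 6 * K))
    simp only [Nat.card_Icc] at h1 h2
    rw [hI]
    omega
  have hmem : ∀ d, M.O (M.e d) → ¬ c.Arc x₀ 0 a (M.e d) → ∀ u ∈ α,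
      P.dist (pos d) u ≤ 6 * K → M.e d ∈ I.image fun k => c.φ^[k - 1] x₀ := by
    intro d hd hda u hu hdu
    obtain ⟨m, hm, hm'⟩ := hO _ hd
    have h1 : a ≤ m := by
      by_contra h
      exact hda ⟨m, Nat.zero_le _, not_le.1 h, hm'⟩
    have h2 : pos (c.φ^[m + 1] x₀) = pos d := by
      rw [Function.iterate_succ_apply' c.φ, hm']
      exact c.pos_φ_e d
    refine Finset.mem_image.2 ⟨m + 1, ?_, hm'⟩
    have h3 := hnear (m + 1) (by omega) (by omega) u hu (h2 ▸ hdu)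
    simp only [hI, Finset.mem_union, Finset.mem_Icc]
    tauto
  refine Quad.le_bound (M := M) (pos := pos) (x₀ := x₀) (ν := 3 * (6 * K + 1))
    { Z := fun i => c.Arc x₀ (lo i) (hi i)
      B := C
      near := I.image fun k => c.φ^[k - 1] x₀
      O_base := ?_
      isSide := fun i => hF.isSide hmin hne hl (B := (· ∈ C)) (by simp [hC]) (hside i).1
        (hside i).2.1 (hper ▸ (hside i).2.2.1)
      outer := fun d hd => ?_
      first := fun d => ?_
      le_len := ?_
      two_mul_le := fun i d _ => hF.two_mul_card_opp_le hmin hne (hside i).2.2.2 d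
      arc_le := fun d hd L hL => hF.arc_le hmin hne hκ hK hgA hposα hd hL
      near_of_face := fun d u hu _ h1 h2 h3 h4 => ?_
      near_of_edge := fun d h1 h2 => ?_
      card_near := Finset.card_image_le.trans hIcard
      card_B := Finset.card_le_four
      spur := fun d h1 h2 => ?_
      geod := fun i j h1 h2 => hgA i j (Nat.zero_le _) h1 h2
      pos_e := c.pos_e'
      dist_le := c.dist_pos_iterate_le }
  · change x₀ ∈ l₀
    rw [hl, mem_faceList]
  · obtain ⟨m, hm, hm'⟩ := hO d hd
    obtain ⟨i, h1, h2⟩ := hcov m hm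
    exact ⟨i, m, h1, h2, hm'⟩
  · constructor
    · rintro ⟨i, -, h1, h2⟩
      exact ⟨i, h1, h2⟩
    · rintro ⟨i, h1, h2⟩
      exact ⟨i, Nat.zero_le _, h1, h2⟩
  · change a ≤ per c.φ x₀
    omega
  · obtain ⟨i, -, hia, hi'⟩ := h3
    have h5 : pos (c.φ^[i + 1] x₀) = pos u := by
      rw [Function.iterate_succ_apply' c.φ, hi']
      exact c.pos_φ_e u
    refine hmem d h1 h2 (pos u) (h5 ▸ hposα (i + 1) hia) ?_
    have h6 : 2 * P.dist (pos d) (pos u) ≤ M.len d := c.two_mul_dist_le (M.mem_face.1 hu)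
    omega
  · obtain ⟨i, -, hia, rfl⟩ := h1
    refine hmem _ h2 ?_ _ (hposα i hia.le) (by rw [dist_self]; exact Nat.zero_le _)
    rintro ⟨m, -, hma, hm⟩
    have hma' : m < a := hma
    have hia' : i < a := hia
    have h3 : pos (c.φ^[m + 1] x₀) = pos (c.φ^[i] x₀) := by
      rw [Function.iterate_succ_apply' c.φ, hm]
      exact c.pos_φ_e _
    have h4 : pos (c.φ^[m] x₀) = pos (c.φ^[i + 1] x₀) := by
      rw [hm, Function.iterate_succ_apply' c.φ]
      exact c.pos_e' _
    rcases le_total (m + 1) i with h5 | h5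
    · have h6 := hgA m (i + 1) (Nat.zero_le _) (by omega) (by omega)
      rw [h4, dist_self] at h6
      omega
    · have h6 := hgA i (m + 1) (Nat.zero_le _) h5 (by omega)
      rw [h3, dist_self] at h6
      have h7 := hgA m (i + 1) (Nat.zero_le _) (by omega) (by omega)
      rw [h4, dist_self] at h7
      omega
  · obtain ⟨m, hm, rfl⟩ := hO d h1
    obtain ⟨i, h3, h4⟩ := hcov m hm
    rcases h3.eq_or_lt with h5 | h5
    · rw [← h5]
      exact (hside i).1
    · refine absurd h2 ?_
      have := c.not_spur_of_geodArc (hside i).2.2.2 (i := m - 1) (by omega) (by omega)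
      rwa [Nat.sub_add_cancel (by omega)] at this

theorem stronglyContracting_of_stepBound {κ : P.Grp → ℤ} (hκ : P.Coord α κ) {K : ℕ}
    (hK : P.StepBound α K) : StronglyContracting P.gens α := by
  set C := (5 * K * (34 + 3 * (6 * K + 1)) + 3 * (6 * K + 1) + 1) * ((2 * K + 1) * K + 1) with hC
  have key : ∀ {p q y y' : P.Grp}, P.IsProj α p y → P.IsProj α q y' →
      P.dist p q ≤ P.dist p y → P.dist y y' ≤ C := fun h1 h2 h3 => hK.dist_proj_le hκ h1 h2 h3
  refine ⟨(2 * C : ℕ), ⟨monotone_id, monotone_const, Filter.eventually_ge_atTop 0,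
    Filter.Eventually.of_forall fun _ => Nat.cast_nonneg _, fun r => le_rfl, fun m => ⟨m, le_rfl⟩,
    Filter.Tendsto.div_atTop tendsto_const_nhds Filter.tendsto_id⟩, ?_⟩
  intro p _ q _ hpq y hy y' hy'
  have hproj : ∀ u, u ∈ proj P.gens α p ∪ proj P.gens α q → P.IsProj α p u ∨ P.IsProj α q u :=
    fun u hu => hu.imp mem_proj_iff.1 mem_proj_iff.1
  have hne : α.Nonempty := by
    rcases hproj y hy with h | h <;> exact ⟨y, h.1⟩
  obtain ⟨v, hv⟩ := P.exists_isProj hne p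
  have hpq' : P.dist p q ≤ P.dist p v := by
    have h1 : wdist P.gens p q ≤ setDist P.gens p α := hpq
    rw [hv.setDist_eq, wdist_eq] at h1
    exact_mod_cast h1
  have hv' : ∀ u, u ∈ proj P.gens α p ∪ proj P.gens α q → P.dist v u ≤ C := fun u hu => by
    rcases hproj u hu with h | h
    · exact key hv h (by rw [dist_self]; exact Nat.zero_le _)
    · exact key hv h hpq'
  have h1 := hv' y hy
  have h2 := hv' y' hy'
  have h3 := dist_triangle y v y'
  rw [dist_comm y v] at h3
  rw [wdist_eq]
  exact Nat.cast_le.2 (by omega : P.dist y y' ≤ 2 * C)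

end

end GSC

namespace GSC

/-- In a classical C'(1/6) group, a `(ρ₁,ρ₂)`-contracting geodesic
with `ρ₂` bounded is strongly contracting. -/
theorem statement3 {S : Type} (P : C6Presentation S) (α : Set P.Grp)
    (hα : IsGeodesic P.gens α) (ρ₁ ρ₂ : ℝ → ℝ)
    (h : ContractingWith P.gens ρ₁ ρ₂ α) (hbdd : BddAbove (Set.range ρ₂)) :
    StronglyContracting P.gens α := by
  obtain ⟨κ, hκ⟩ := exists_coord hα
  obtain ⟨K, hK⟩ := exists_stepBound h hbdd
  exact stronglyContracting_of_stepBound hκ hK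

end GSC
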